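/- For every ε>0 and all sufficiently large N, there exists a function Ψ : F₂[x] → ℝ such that: (1) Ψ(f)=0 whenever f is not of the form r−1 for some prime r ∈ G_N; (2) for every θ ∈ T, Σ_{f∈G_N} Ψ(f)e(fθ) ≥ −2^{N−K}; (3) Σ_{f∈G_N} Ψ(f) ≫ 2^N; where K = (1/8−ε)N. -/

import Mathlib

open Polynomial
open scoped Classical

noncomputable section

abbrev F2 := ZMod 2
abbrev Kinf := LaurentSeries F2
def polyToK (f : F2[X]) : Kinf :=
  ∑ i ∈ f.support, HahnSeries.single (-(i : ℤ)) (f.coeff i)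
def ordK (a : Kinf) : WithBot ℤ := if a = 0 then ⊥ else (↑(-a.order) : WithBot ℤ)
def eKr (a : Kinf) : ℝ := (-1 : ℝ) ^ ((a.coeff 1).val)
def eK (a : Kinf) : ℂ := ((eKr a : ℝ) : ℂ)
def InT (θ : Kinf) : Prop := ordK θ ≤ ((-1 : ℤ) : WithBot ℤ)
def GN (N : ℕ) : Finset F2[X] :=
  Set.Finite.toFinset (s := {f : F2[X] | f.degree < (N : ℕ)}) (by
    have h : {f : F2[X] | f.degree < (N : ℕ)} = ↑(Polynomial.degreeLT F2 N) := by
      ext f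
      simp [Polynomial.mem_degreeLT]
    rw [h]
    have : Finite (Polynomial.degreeLT F2 N) :=
      Finite.of_equiv _ (Polynomial.degreeLTEquiv F2 N).symm.toEquiv
    exact (Polynomial.degreeLT F2 N : Set F2[X]).toFinite)
def ratK (u s : F2[X]) : Kinf := polyToK u * (polyToK s)⁻¹

/-- τ(f): the number of divisors of `f`. -/
def tau (f : F2[X]) : ℕ := ((GN (f.natDegree + 1)).filter (fun g => g ∣ f)).card

/-- φ(f): the number of invertible residues modulo `f`. -/
def phi (f : F2[X]) : ℕ := ((GN f.natDegree).filter (fun g => IsCoprime g f)).card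

/-- ω(f): the number of (irreducible nonconstant, i.e. prime) divisors of `f`. -/
def omegaP (f : F2[X]) : ℕ :=
  ((GN (f.natDegree + 1)).filter (fun r => Irreducible r ∧ r ∣ f)).card

/-- The Möbius function on `F₂[x]`. -/
def mu (f : F2[X]) : ℤ := if Squarefree f then (-1) ^ (omegaP f) else 0

/-- The set of invertible residues modulo `s` (canonical representatives of
`(F₂[x]/(s))^×`, i.e. polynomials of degree `< deg s` coprime to `s`). -/
def residues (s : F2[X]) : Finset F2[X] := (GN s.natDegree).filter (fun t => IsCoprime t s)

/-- `α(s) = μ(s)/φ(s)`. -/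
def alphaA (s : F2[X]) : ℝ := (mu s : ℝ) / (phi s : ℝ)

/-- `α'(s) = ∏_{r | s prime} 3/(2^{deg r}+3)` for `s` squarefree, `0` otherwise. -/
def alphaB (s : F2[X]) : ℝ :=
  if Squarefree s then
    ∏ r ∈ (GN (s.natDegree + 1)).filter (fun r => Irreducible r ∧ r ∣ s),
      (3 : ℝ) / ((2 : ℝ) ^ r.natDegree + 3)
  else 0

/-- `Λ_M(f) = Σ_{s ∈ G_M} α(s) Σ_{t ∈ (F₂[x]/(s))^×} e(f t s⁻¹)`. -/
def LambdaM (M : ℕ) (f : F2[X]) : ℝ :=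
  ∑ s ∈ GN M, alphaA s * ∑ t ∈ residues s, eKr (polyToK f * ratK t s)

/-- `H_M(f) = Σ_{s ∈ G_M} α'(s) Σ_{t ∈ (F₂[x]/(s))^×} e(f t s⁻¹)`. -/
def HM (M : ℕ) (f : F2[X]) : ℝ :=
  ∑ s ∈ GN M, alphaB s * ∑ t ∈ residues s, eKr (polyToK f * ratK t s)

/-- `Λ'(f) = deg f` if `f` is prime, `0` otherwise. -/
def LambdaP (f : F2[X]) : ℝ := if Irreducible f then (f.natDegree : ℝ) else 0

/-- `Ψ(f) = Λ'(f+1) H_Q(f) 1_{f ∈ G_N}`. -/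
def Psi (N Q : ℕ) (f : F2[X]) : ℝ :=
  LambdaP (f + 1) * HM Q f * (if f ∈ GN N then 1 else 0)

/-- `Ψ'(f) = Λ_R(f+1) H_Q(f) 1_{f ∈ G_N}`. -/
def Psi' (N R Q : ℕ) (f : F2[X]) : ℝ :=
  LambdaM R (f + 1) * HM Q f * (if f ∈ GN N then 1 else 0)

/-- `Λ_r(f)` for a single prime `r`. -/
def Lambda_r (r f : F2[X]) : ℝ :=
  if r ∣ f then 0 else (2 : ℝ) ^ r.natDegree / ((2 : ℝ) ^ r.natDegree - 1)

/-- `τ²_r(f)` for a single prime `r`. -/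
def tauSq_r (r f : F2[X]) : ℝ :=
  if r ∣ f then 4 * (2 : ℝ) ^ r.natDegree / ((2 : ℝ) ^ r.natDegree + 3)
  else (2 : ℝ) ^ r.natDegree / ((2 : ℝ) ^ r.natDegree + 3)

/-- `˜Λ_M(f) = ∏_{r ∈ G_M prime} Λ_r(f)`. -/
def LambdaTilde (M : ℕ) (f : F2[X]) : ℝ :=
  ∏ r ∈ (GN M).filter (fun r => Irreducible r), Lambda_r r f

/-- `˜H_M(f) = ∏_{r ∈ G_M prime} τ²_r(f)`. -/
def HTilde (M : ℕ) (f : F2[X]) : ℝ :=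
  ∏ r ∈ (GN M).filter (fun r => Irreducible r), tauSq_r r f

/-- The element of `K∞` determined by a rational function (with `x ↦ t⁻¹`). -/
def ratToK (l : RatFunc F2) : Kinf := polyToK l.num * (polyToK l.denom)⁻¹

/-- `c : F₂(x)/F₂[x] → ℝ` (encoded on the canonical representatives
`λ = num/denom` in lowest terms with `deg num < deg denom`) is the system of Fourier
coefficients of `F : F₂[x] → ℝ`, i.e. `F(f) = Σ_λ c(λ) e(λ f)`. -/
def IsFourierCoeffs (F : F2[X] → ℝ) (c : RatFunc F2 → ℝ) : Prop :=
  (Function.support c).Finite ∧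
  (∀ l : RatFunc F2, c l ≠ 0 → (l.num).degree < (l.denom).degree) ∧
  ∀ f : F2[X], F f = ∑ᶠ l : RatFunc F2, c l * eKr (ratToK l * polyToK f)

/-- The canonical representative (mod `F₂[x]`) of a rational function. -/
def fracRat (l : RatFunc F2) : RatFunc F2 :=
  l - algebraMap F2[X] (RatFunc F2) (l.num / l.denom)

/-- `c(n, η)` from the statement of the exponential sum estimate for `Λ'`. -/
def cFun (n : ℕ) (η : Kinf) : ℝ :=
  if ordK η < ((-(n : ℤ) - 1 : ℤ) : WithBot ℤ) then 1
  else if ordK η = ((-(n : ℤ) - 1 : ℤ) : WithBot ℤ) then -1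
  else 0

/-- The class `C_B(X)` (with explicit implied constant `Cst`): functions whose Fourier
coefficients are supported on `λ` with squarefree denominator of degree `≤ X` and satisfy
`|c(λ)| ≤ Cst · τ(denom λ)^B / 2^{deg (denom λ)}`. -/
def InClassC (B X : ℕ) (Cst : ℝ) (F : F2[X] → ℝ) : Prop :=
  ∃ c : RatFunc F2 → ℝ, IsFourierCoeffs F c ∧
    (∀ l : RatFunc F2, c l ≠ 0 → Squarefree l.denom ∧ (l.denom).natDegree ≤ X) ∧
    (∀ l : RatFunc F2, |c l| ≤ Cst * (tau l.denom : ℝ) ^ B / 2 ^ (l.denom).natDegree)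

/-- The fractional part `‖θ‖` of `θ ∈ K∞`: keep exactly the coefficients of `x^{-n}`, `n ≥ 1`. -/
def fracK (θ : Kinf) : Kinf :=
  ⟨fun n => if 1 ≤ n then θ.coeff n else 0, by
    apply θ.isPWO_support'.mono
    intro n hn
    simp only [Function.mem_support, ne_eq] at hn ⊢
    intro h
    apply hn
    split_ifs
    · exact h
    · rfl⟩

namespace VDC
set_option linter.all false

/-! ### Stepanov's method -/

section Step
variable {k : Type} [Field k] {B : Type} [CommRing B] [Algebra k[X] B]
  [Algebra k B] [IsScalarTower k k[X] B] {I : Type} [Fintype I] (b : Module.Basis I k[X] B)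

/-- elements whose coordinates have degree `< l` -/
def Bl (l : ℕ) : Submodule k B where
  carrier := {z | ∀ i, b.repr z i ∈ degreeLT k l}
  add_mem' := by
    intro x y hx hy i
    rw [map_add, Finsupp.add_apply]
    exact Submodule.add_mem _ (hx i) (hy i)
  zero_mem' := by intro i; simp
  smul_mem' := by
    intro a x hx i
    have : b.repr (a • x) = a • b.repr x := by
      rw [← algebraMap_smul k[X] a x, map_smul, algebraMap_smul]
    rw [this, Finsupp.smul_apply]
    exact Submodule.smul_mem _ _ (hx i)

lemma mem_Bl {l : ℕ} {z : B} : z ∈ Bl (k := k) b l ↔ ∀ i, b.repr z i ∈ degreeLT k l := Iff.rfl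

/-- coordinates -/
def BlEquiv (l : ℕ) : Bl (k := k) b l ≃ₗ[k] (I → degreeLT k l) where
  toFun z := fun i => ⟨b.repr z.1 i, z.2 i⟩
  map_add' := by intro x y; ext i; simp
  map_smul' := by
    intro a x
    funext i
    apply Subtype.ext
    have : b.repr (a • x.1) = a • b.repr x.1 := by
      rw [← algebraMap_smul k[X] a x.1, map_smul, algebraMap_smul]
    simp [this]
  invFun f := ⟨b.equivFun.symm (fun i => (f i).1), by
    intro i
    have := congrFun (b.equivFun.apply_symm_apply (fun i => (f i).1)) i
    rw [Module.Basis.equivFun_apply] at this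
    rw [this]; exact (f i).2⟩
  left_inv := by
    intro z
    apply Subtype.ext
    exact b.equivFun.symm_apply_apply z.1
  right_inv := by
    intro f
    funext i
    apply Subtype.ext
    exact congrFun (b.equivFun.apply_symm_apply (fun i => (f i).1)) i

lemma finrank_Bl (l : ℕ) : Module.finrank k (Bl (k := k) b l) = Fintype.card I * l := by
  rw [(BlEquiv b l).finrank_eq, Module.finrank_pi_fintype]
  simp [(degreeLTEquiv k l).finrank_eq]

instance (l : ℕ) : FiniteDimensional k (Bl (k := k) b l) := by
  have : FiniteDimensional k (degreeLT k l) := (degreeLTEquiv k l).symm.finiteDimensional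
  exact (BlEquiv b l).symm.finiteDimensional

lemma mul3_deg {l m c : ℕ} {p q r : k[X]} (hp : p ∈ degreeLT k l) (hq : q ∈ degreeLT k m)
    (hr : r.natDegree ≤ c) : p * q * r ∈ degreeLT k (l + m + c) := by
  by_cases h : p * q * r = 0
  · rw [h]; exact Submodule.zero_mem _
  have hp0 : p ≠ 0 := by rintro rfl; simp at h
  have hq0 : q ≠ 0 := by rintro rfl; simp at h
  rw [mem_degreeLT] at *
  rw [← natDegree_lt_iff_degree_lt h]
  rw [← natDegree_lt_iff_degree_lt hp0] at hp
  rw [← natDegree_lt_iff_degree_lt hq0] at hq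
  have h1 : (p*q*r).natDegree ≤ (p*q).natDegree + r.natDegree := natDegree_mul_le
  have h2 : (p*q).natDegree ≤ p.natDegree + q.natDegree := natDegree_mul_le
  omega

lemma mul2_deg {l c : ℕ} {p r : k[X]} (hp : p ∈ degreeLT k l)
    (hr : r.natDegree ≤ c) : p * r ∈ degreeLT k (l + c) := by
  by_cases h : p * r = 0
  · rw [h]; exact Submodule.zero_mem _
  have hp0 : p ≠ 0 := by rintro rfl; simp at h
  rw [mem_degreeLT] at *
  rw [← natDegree_lt_iff_degree_lt h]
  rw [← natDegree_lt_iff_degree_lt hp0] at hp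
  have h1 : (p*r).natDegree ≤ p.natDegree + r.natDegree := natDegree_mul_le
  omega

lemma degreeLT_mono' {l m : ℕ} (h : l ≤ m) : degreeLT k l ≤ degreeLT k m := by
  intro p hp
  rw [mem_degreeLT] at *
  exact hp.trans_le (by exact_mod_cast h)

lemma Bl_mono {l m : ℕ} (h : l ≤ m) : Bl (k := k) b l ≤ Bl b m :=
  fun _ hz i => degreeLT_mono' h (hz i)

lemma Bl_mul {c : ℕ} (hc : ∀ i j m, (b.repr (b i * b j) m).natDegree ≤ c) {l m : ℕ} {z w : B}
    (hz : z ∈ Bl (k := k) b l) (hw : w ∈ Bl (k := k) b m) : z * w ∈ Bl (k := k) b (l + m + c) := by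
  intro t
  have : z * w = ∑ i, ∑ j, (b.repr z i * b.repr w j) • (b i * b j) := by
    conv_lhs => rw [← b.sum_repr z, ← b.sum_repr w, Finset.sum_mul_sum]
    refine Finset.sum_congr rfl fun i _ => Finset.sum_congr rfl fun j _ => ?_
    rw [smul_mul_smul_comm]
  rw [this]
  simp only [map_sum, map_smul, Finsupp.coe_finsetSum, Finset.sum_apply, Finsupp.smul_apply,
    smul_eq_mul]
  exact Submodule.sum_mem _ fun i _ => Submodule.sum_mem _ fun j _ => mul3_deg (hz i) (hw j) (hc i j t)

lemma Bl_lin {c : ℕ} (σ : B →ₗ[k[X]] B) (hc : ∀ i m, (b.repr (σ (b i)) m).natDegree ≤ c)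
    {l : ℕ} {z : B} (hz : z ∈ Bl (k := k) b l) : σ z ∈ Bl (k := k) b (l + c) := by
  intro t
  conv in σ z => rw [← b.sum_repr z]
  simp only [map_sum, map_smul, Finsupp.coe_finsetSum, Finset.sum_apply, Finsupp.smul_apply,
    smul_eq_mul]
  exact Submodule.sum_mem _ fun i _ => mul2_deg (hz i) (hc i t)

lemma Bl_pow {c : ℕ} (hc : ∀ i j m, (b.repr (b i * b j) m).natDegree ≤ c) {l : ℕ} {z : B}
    (hz : z ∈ Bl (k := k) b l) (r : ℕ) (hr : 1 ≤ r) : z ^ r ∈ Bl (k := k) b (r * (l + c)) := by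
  induction r, hr using Nat.le_induction with
  | base => simpa using Bl_mono b (by omega) hz
  | succ r hr ih =>
    rw [pow_succ]
    refine Bl_mono b ?_ (Bl_mul b hc ih hz)
    ring_nf; omega

lemma det_deg {n : Type} [Fintype n] [DecidableEq n] (M : Matrix n n k[X]) (D : ℕ)
    (h : ∀ i j, (M i j).natDegree ≤ D) : M.det.natDegree ≤ Fintype.card n * D := by
  rw [Matrix.det_apply]
  refine natDegree_sum_le_of_forall_le _ _ fun σ _ => ?_
  refine (natDegree_smul_le _ _).trans ?_
  refine (natDegree_prod_le _ _).trans ?_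
  refine (Finset.sum_le_card_nsmul _ _ D fun i _ => h _ _).trans ?_
  simp

lemma norm_deg {c : ℕ} (hc : ∀ i j m, (b.repr (b i * b j) m).natDegree ≤ c) {m : ℕ} {w : B}
    (hw : w ∈ Bl (k := k) b m) : (Algebra.norm k[X] w).natDegree ≤ Fintype.card I * (m + c) := by
  rw [Algebra.norm_eq_matrix_det b]
  apply det_deg
  intro i j
  rw [Algebra.leftMulMatrix_eq_repr_mul]
  have : b.repr (w * b j) i ∈ degreeLT k (m + c) := by
    conv in w * b j => rw [← b.sum_repr w]
    simp only [Finset.sum_mul, smul_mul_assoc, map_sum, map_smul, Finsupp.coe_finsetSum,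
      Finset.sum_apply, Finsupp.smul_apply, smul_eq_mul]
    exact Submodule.sum_mem _ fun t _ => mul2_deg (hw t) (hc t j i)
  rw [mem_degreeLT] at this
  exact natDegree_le_of_degree_le this.le

lemma dvd_norm' {R : Type} [CommRing R] [Algebra R B] (b : Module.Basis I R B) (u : B) :
    u ∣ algebraMap R B (Algebra.norm R u) := by
  have h1 : aeval u (Algebra.leftMulMatrix b u).charpoly = 0 := by
    apply Algebra.leftMulMatrix_injective b
    rw [map_zero, ← Polynomial.aeval_algHom_apply]
    exact Matrix.aeval_self_charpoly _
  rw [Algebra.norm_eq_matrix_det b, Matrix.det_eq_sign_charpoly_coeff, map_mul]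
  apply Dvd.dvd.mul_left
  set p := (Algebra.leftMulMatrix b u).charpoly
  rw [← Polynomial.divX_mul_X_add p] at h1
  rw [map_add, map_mul, aeval_X, aeval_C] at h1
  rw [show algebraMap R B (p.coeff 0) = - (aeval u p.divX * u) from (eq_neg_of_add_eq_zero_right h1)]
  exact (Dvd.intro_left _ rfl).neg_right
end Step

section Main
variable {k : Type} [Field k] {B : Type} [CommRing B] [IsDomain B] [Algebra k[X] B]
  [Algebra k B] [IsScalarTower k k[X] B] {I : Type} [Fintype I] (b : Module.Basis I k[X] B)

lemma card_points (b : Module.Basis I k[X] B) {Ω : Type} [Field Ω] [Algebra k Ω] (w : B) (hw : w ≠ 0)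
    (S : Finset (B →ₐ[k] Ω)) (hS : ∀ P ∈ S, P w = 0) :
    S.card ≤ (Algebra.norm k[X] w).natDegree := by
  rw [← finrank_quotient_span_eq_natDegree_norm b hw]
  set J := Ideal.span ({w} : Set B) with hJd
  have hJ : J ≠ ⊥ := by simpa [J] using hw
  have hfin : FiniteDimensional k (B ⧸ J) := by
    have := (J.quotientEquivDirectSum k b hJ).symm
    exact this.finiteDimensional
  let F : S → ((B ⧸ J) →ₐ[k] Ω) := fun P => Ideal.Quotient.liftₐ J P.1 (by
    intro a ha
    obtain ⟨t, rfl⟩ := Ideal.mem_span_singleton.1 ha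
    rw [map_mul, hS P.1 P.2, zero_mul])
  have hF : Function.Injective F := by
    intro P P' h
    apply Subtype.ext
    ext z
    have := congrArg (fun g : (B ⧸ J) →ₐ[k] Ω => g (Ideal.Quotient.mk J z)) h
    exact this
  have h1 := card_algHom_le_finrank k (B ⧸ J) Ω
  have h2 := Nat.card_le_card_of_injective F hF
  simp only [Nat.card_eq_fintype_card, Fintype.card_coe] at h2
  rw [Nat.card_eq_fintype_card] at h1
  omega

lemma nonvanish [CharP k 2] (ι : B →+* PowerSeries k) (hinj : Function.Injective ι)
    (hι : ∀ p : k[X], ι (algebraMap k[X] B p) = (p : PowerSeries k))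
    {J : Type} [Fintype J] (u w : J → B) (e : ℕ)
    (hu : ∀ a : J → k, a ≠ 0 → ¬ (PowerSeries.X ^ (2 ^ e) ∣ ι (∑ i, a i • u i)))
    (hw : w ≠ 0) : ∑ i, u i * w i ^ (2 ^ e) ≠ 0 := by
  intro h0
  have hex : ∃ n, ∃ i, PowerSeries.coeff n (ι (w i)) ≠ 0 := by
    by_contra hcon
    push Not at hcon
    apply hw
    funext i
    apply hinj
    rw [Pi.zero_apply, map_zero]
    ext n
    rw [hcon n i, map_zero]
  set v := Nat.find hex
  obtain ⟨i0, hi0⟩ := Nat.find_spec hex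
  have hdiv : ∀ i, ∃ y, ι (w i) = PowerSeries.X ^ v * y := by
    intro i
    apply PowerSeries.X_pow_dvd_iff.2
    intro m hm
    have := Nat.find_min hex hm
    push Not at this
    exact this i
  choose y hy using hdiv
  have hy0 : PowerSeries.constantCoeff (y i0) ≠ 0 := by
    intro h
    apply hi0
    change PowerSeries.coeff v _ = 0
    rw [hy i0, PowerSeries.coeff_X_pow_mul', if_pos le_rfl, Nat.sub_self]
    simpa using h
  have : CharP (PowerSeries k) 2 := charP_of_injective_algebraMap (algebraMap k (PowerSeries k)).injective 2
  have hexp : ∀ i, ∃ g, y i ^ (2 ^ e) = PowerSeries.C (PowerSeries.constantCoeff (y i) ^ (2^e))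
      + PowerSeries.X ^ (2 ^ e) * g := by
    intro i
    have : PowerSeries.X ∣ y i - PowerSeries.C (PowerSeries.constantCoeff (y i)) := by
      rw [PowerSeries.X_dvd_iff]; simp
    obtain ⟨g, hg⟩ := this
    refine ⟨g ^ (2 ^ e), ?_⟩
    conv_lhs => rw [eq_add_of_sub_eq hg, add_pow_char_pow, mul_pow]
    rw [map_pow, add_comm]
  choose g hg using hexp
  refine hu (fun i => PowerSeries.constantCoeff (y i) ^ (2^e)) ?_ ?_
  · intro h
    have := congrFun h i0
    exact hy0 (pow_eq_zero_iff (by positivity) |>.1 this)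
  · have h1 : ι (∑ i, u i * w i ^ (2 ^ e)) = 0 := by rw [h0, map_zero]
    have h2 : PowerSeries.X ^ (v * 2 ^ e) * ∑ i, ι (u i) * y i ^ (2 ^ e) = 0 := by
      rw [← h1, map_sum, Finset.mul_sum]
      refine Finset.sum_congr rfl fun i _ => ?_
      rw [map_mul, map_pow, hy i, mul_pow, pow_mul]; ring
    have h3 : ∑ i, ι (u i) * y i ^ (2 ^ e) = 0 := by
      rcases mul_eq_zero.1 h2 with h | h
      · exact absurd h (pow_ne_zero _ PowerSeries.X_ne_zero)
      · exact h
    have h4 : ∀ i, ι ((PowerSeries.constantCoeff (y i) ^ (2^e)) • u i) =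
        ι (u i) * PowerSeries.C (PowerSeries.constantCoeff (y i) ^ (2^e)) := by
      intro i
      rw [← algebraMap_smul k[X], Algebra.smul_def, map_mul, hι, Polynomial.algebraMap_apply,
        mul_comm]
      simp
    rw [map_sum]
    simp_rw [h4]
    refine ⟨- ∑ i, ι (u i) * g i, ?_⟩
    rw [← sub_eq_zero, ← h3, mul_neg, sub_neg_eq_add, Finset.mul_sum, ← Finset.sum_add_distrib]
    refine Finset.sum_congr rfl fun i _ => ?_
    rw [hg i]; ring

/-- monomial basis elements -/
def uu (l : ℕ) (i : I × Fin l) : B := (X ^ (i.2 : ℕ) : k[X]) • b i.1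

lemma uu_mem (l : ℕ) (i : I × Fin l) : uu b l i ∈ Bl (k := k) b l := by
  intro t
  rw [uu, map_smul, Finsupp.smul_apply, b.repr_self, Finsupp.single_apply, smul_eq_mul]
  rw [mem_degreeLT]
  split_ifs
  · rw [mul_one, degree_X_pow]; exact_mod_cast i.2.2
  · rw [mul_zero, degree_zero]; exact WithBot.bot_lt_coe _

lemma uu_indep (l : ℕ) (a : I × Fin l → k) (h : ∑ i, a i • uu b l i = 0) : a = 0 := by
  funext ⟨t, m⟩
  have h1 := congrArg (fun z => (b.repr z t).coeff m) h
  simp only [map_sum, Finsupp.coe_finsetSum, Finset.sum_apply, map_zero, Finsupp.zero_apply,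
    coeff_zero, finsetSum_coeff] at h1
  rw [Finset.sum_eq_single (t, m)] at h1
  · rw [← algebraMap_smul k[X], uu, map_smul, map_smul] at h1
    simpa using h1
  · rintro ⟨t', m'⟩ _ hne
    rw [← algebraMap_smul k[X], uu, map_smul, map_smul]
    by_cases ht : t' = t
    · subst ht
      have : (m : ℕ) ≠ m' := by
        intro h; apply hne; ext <;> simp [h]
      simp [coeff_X_pow, this]
    · simp [ht]
  · simp

lemma step_main [CharP k 2] (ι : B →+* PowerSeries k) (hinj : Function.Injective ι)
    (hι : ∀ p : k[X], ι (algebraMap k[X] B p) = (p : PowerSeries k)) (σ : B →ₗ[k[X]] B)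
    {c : ℕ} (hc : ∀ i j m, (b.repr (b i * b j) m).natDegree ≤ c)
    (hσ : ∀ i m, (b.repr (σ (b i)) m).natDegree ≤ c)
    {Ω : Type} [Field Ω] [Algebra k Ω] (e l M : ℕ)
    (h1 : Fintype.card I * (l + c) < 2 ^ e)
    (h2 : (2 ^ e) * (l + c) + M + 2 * c < Fintype.card I * l * M)
    (S : Finset (B →ₐ[k] Ω)) (hS : ∀ P ∈ S, ∀ z, P z ^ (2 ^ e * 2 ^ e) = P (σ z)) :
    S.card ≤ Fintype.card I * (l + 2 ^ e * (M + c) + 2 * c) := by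
  let T := (2 ^ e) * (l + c) + (M + c) + c
  let Φ : (I × Fin l → Bl (k := k) b M) →ₗ[k] Bl (k := k) b T :=
    LinearMap.codRestrict _ (∑ i, (LinearMap.mulLeft k (uu b l i ^ (2^e))) ∘ₗ (σ.restrictScalars k) ∘ₗ
      (Bl (k := k) b M).subtype ∘ₗ LinearMap.proj i) (by
        intro z
        simp only [LinearMap.coe_sum, Finset.sum_apply]
        refine Submodule.sum_mem _ fun i _ => ?_
        exact Bl_mul b hc (Bl_pow b hc (uu_mem b l i) _ Nat.one_le_two_pow) (Bl_lin b σ hσ (z i).2))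
  have hker : LinearMap.ker Φ ≠ ⊥ := by
    apply LinearMap.ker_ne_bot_of_finrank_lt
    rw [Module.finrank_pi_fintype]
    simp only [finrank_Bl, Finset.sum_const, Finset.card_univ, Fintype.card_prod, Fintype.card_fin,
      smul_eq_mul]
    have hn : 0 < Fintype.card I := by
      rcases Nat.eq_zero_or_pos (Fintype.card I) with h | h
      · rw [h] at h2; omega
      · exact h
    calc Fintype.card I * T < Fintype.card I * (Fintype.card I * l * M) := by
          apply Nat.mul_lt_mul_of_pos_left _ hn
          simp only [T]; omega
      _ = _ := by ring
  obtain ⟨z, hz, hz0⟩ := Submodule.exists_mem_ne_zero_of_ne_bot hker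
  have hsum : ∑ i, uu b l i ^ (2^e) * σ (z i) = 0 := by
    have := congrArg Subtype.val (LinearMap.mem_ker.1 hz)
    simpa [Φ] using this
  set w := ∑ i, uu b l i * ((z i : B)) ^ (2 ^ e) with hw
  have hu : ∀ a : I × Fin l → k, a ≠ 0 →
      ¬ (PowerSeries.X ^ (2 ^ e) ∣ ι (∑ i, a i • uu b l i)) := by
    intro a ha hdvd
    set u := ∑ i, a i • uu b l i with hu
    have hu0 : u ≠ 0 := fun h => ha (uu_indep b l a h)
    have hum : u ∈ Bl (k := k) b l := Submodule.sum_mem _ fun i _ => Submodule.smul_mem _ _ (uu_mem b l i)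
    have hd := norm_deg b hc hum
    have hd2 := hdvd.trans (map_dvd ι (dvd_norm' b u))
    rw [hι] at hd2
    have hN : Algebra.norm k[X] u ≠ 0 := (Algebra.norm_ne_zero_iff_of_basis b).2 hu0
    have hlt : (Algebra.norm k[X] u).natDegree < 2 ^ e := by omega
    have := PowerSeries.X_pow_dvd_iff.1 hd2 _ hlt
    rw [Polynomial.coeff_coe] at this
    exact hN (leadingCoeff_eq_zero.1 this)
  have hw0 : w ≠ 0 := by
    apply nonvanish ι hinj hι (uu b l) (fun i => (z i : B)) e hu
    intro h
    apply hz0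
    funext i
    exact Subtype.ext (congrFun h i)
  have hwm : w ∈ Bl (k := k) b (l + 2 ^ e * (M + c) + c) := Submodule.sum_mem _ fun i _ =>
    Bl_mul b hc (uu_mem b l i) (Bl_pow b hc (z i).2 _ Nat.one_le_two_pow)
  have hdeg := norm_deg b hc hwm
  refine (card_points b w hw0 S ?_).trans (hdeg.trans (le_of_eq (by ring)))
  intro P hP
  have : CharP Ω 2 := charP_of_injective_algebraMap (algebraMap k Ω).injective 2
  have : P w ^ (2 ^ e) = 0 := by
    rw [hw, map_sum, sum_pow_char_pow]
    have h := congrArg P hsum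
    rw [map_zero, map_sum] at h
    rw [← h]
    refine Finset.sum_congr rfl fun i _ => ?_
    rw [map_mul, map_mul, map_pow, map_pow, ← hS P hP, mul_pow, ← pow_mul]
  exact pow_eq_zero_iff (by positivity) |>.1 this

/-- Stepanov upper bound. -/
theorem stepanov (b : Module.Basis I k[X] B) [CharP k 2] (ι : B →+* PowerSeries k) (hinj : Function.Injective ι)
    (hι : ∀ p : k[X], ι (algebraMap k[X] B p) = (p : PowerSeries k)) (σ : B →ₗ[k[X]] B)
    (Ω : Type) [Field Ω] [Algebra k Ω] : ∃ C e0 : ℕ, ∀ e, e0 ≤ e →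
    ∀ (S : Finset (B →ₐ[k] Ω)), (∀ P ∈ S, ∀ z, P z ^ (2 ^ e * 2 ^ e) = P (σ z)) →
    S.card ≤ 2 ^ e * 2 ^ e + C * 2 ^ e := by
  obtain ⟨c, hc, hσ⟩ : ∃ c : ℕ, (∀ i j m, (b.repr (b i * b j) m).natDegree ≤ c) ∧
    (∀ i m, (b.repr (σ (b i)) m).natDegree ≤ c) := by
    refine ⟨(∑ i, ∑ j, ∑ m, (b.repr (b i * b j) m).natDegree) +
      ∑ i, ∑ m, (b.repr (σ (b i)) m).natDegree, ?_, ?_⟩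
    · intro i j m
      refine le_trans ?_ (Nat.le_add_right _ _)
      refine le_trans ?_ (Finset.single_le_sum (f := fun i => ∑ j, ∑ m, (b.repr (b i * b j) m).natDegree) (fun _ _ => Nat.zero_le _) (Finset.mem_univ i))
      refine le_trans ?_ (Finset.single_le_sum (f := fun j => ∑ m, (b.repr (b i * b j) m).natDegree) (fun _ _ => Nat.zero_le _) (Finset.mem_univ j))
      exact (Finset.single_le_sum (f := fun m => (b.repr (b i * b j) m).natDegree) (fun _ _ => Nat.zero_le _) (Finset.mem_univ m))
    · intro i m
      refine le_trans ?_ (Nat.le_add_left _ _)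
      refine le_trans ?_ (Finset.single_le_sum (f := fun i => ∑ m, (b.repr (σ (b i)) m).natDegree) (fun _ _ => Nat.zero_le _) (Finset.mem_univ i))
      exact (Finset.single_le_sum (f := fun m => (b.repr (σ (b i)) m).natDegree) (fun _ _ => Nat.zero_le _) (Finset.mem_univ m))
  set n := Fintype.card I with hn
  have hn0 : 0 < n := by
    rcases Nat.eq_zero_or_pos n with h | h
    · have : IsEmpty I := Fintype.card_eq_zero_iff.1 h
      have hs := b.sum_repr (1 : B)
      simp at hs
    · exact h
  set t := 8 * (c + 3) + 1
  refine ⟨n * t + 1 + n * c + 2 * n * c, 8 * n + 8 * n * c + t + 2 * c, ?_⟩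
  intro e he S hS
  set R := 2 ^ e with hR
  have hRe : e < R := Nat.lt_two_pow_self
  set l := R / (4 * n)
  set M := R / n + t
  have hl1 : 4 * n * l ≤ R := Nat.mul_div_le R (4 * n)
  have hl2 : R < 4 * n * l + 4 * n := by
    have := Nat.div_add_mod R (4 * n)
    have := Nat.mod_lt R (show 0 < 4 * n by omega)
    simp only [l]; omega
  have hM1 : n * (R / n) ≤ R := Nat.mul_div_le R n
  have hM2 : R < n * (R / n) + n := by
    have := Nat.div_add_mod R n
    have := Nat.mod_lt R hn0
    omega
  have hRn : 8 * n + 8 * n * c + t + 2 * c < R := by omega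
  have := step_main b ι hinj hι σ hc hσ e l M ?_ ?_ S hS
  · refine this.trans ?_
    rw [← hn, ← hR]
    have e1 : n * M ≤ R + n * t := by simp only [M]; nlinarith
    have e2 : n * l ≤ R := by nlinarith
    have e3 : 1 ≤ R := by omega
    calc n * (l + R * (M + c) + 2 * c) = n * l + R * (n * M) + n * c * R + 2 * n * c := by ring
      _ ≤ R + R * (R + n * t) + n * c * R + 2 * n * c * R := by
          have e7 : 2 * n * c ≤ 2 * n * c * R := Nat.le_mul_of_pos_right _ e3
          have e8 := Nat.mul_le_mul_left R e1
          omega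
      _ = _ := by ring
  · rw [← hn, ← hR]
    nlinarith [Nat.zero_le (n*c)]
  · rw [← hn, ← hR]
    have hl8 : R ≤ 8 * (n * l) := by nlinarith [Nat.zero_le (n*c)]
    have hMR : R / n ≤ R := Nat.div_le_self _ _
    have e1 : n * M + n ≥ R + n * t := by simp only [M]; nlinarith
    have e2 : l * (n * M + n) ≥ l * (R + n * t) := Nat.mul_le_mul_left _ e1
    have e3 : n * l * (8 * (c + 3)) ≥ R * (c + 3) := by nlinarith
    have e4 : n * l * t = n * l * (8 * (c+3)) + n * l := by simp only [t]; ring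
    have e5 : n * l * M + n * l ≥ l * R + n * l * t := by nlinarith
    have e6 : n * l * M ≥ l * R + R * (c+3) := by omega
    have : R * (l + c) + M + 2 * c < l * R + R * (c + 3) := by
      simp only [M]; nlinarith [Nat.zero_le (n*c)]
    omega

end Main

/-! ### The Carlitz module -/

/-- value of `a ∈ F₂[X]` at `x` in a ring of characteristic two -/
def evz {S : Type} [CommRing S] (x : S) (a : F2[X]) : S := ∑ i ∈ a.support, x ^ i

/-- Carlitz action -/
def carl {S : Type} [CommRing S] (x : S) (a : F2[X]) (z : S) : S :=
  ∑ i ∈ a.support, (fun z => x * z + z ^ 2)^[i] z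

section Carl
variable {S : Type} [CommRing S] [CharP S 2]

/-- endomorphism `z ↦ x z + z²` -/
def carEnd (x : S) : letI := ZMod.algebra S 2; Module.End (ZMod 2) S :=
  letI := ZMod.algebra S 2
  AddMonoidHom.toZModLinearMap 2
  { toFun := fun z => x * z + z ^ 2
    map_zero' := by simp
    map_add' := by intro a b; rw [add_pow_char]; ring }

lemma F2_coeff (a : F2[X]) (i : ℕ) (h : i ∈ a.support) : a.coeff i = 1 := by
  rw [mem_support_iff] at h
  revert h
  generalize a.coeff i = t
  revert t; decide

lemma carl_eq (x : S) (a : F2[X]) (z : S) : letI := ZMod.algebra S 2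
    carl x a z = aeval (carEnd x) a z := by
  letI := ZMod.algebra S 2
  change carl x a z = aeval (carEnd x) a z
  rw [aeval_eq_sum_range' (n := a.natDegree + 1) (by omega), LinearMap.sum_apply, carl]
  apply Finset.sum_subset_zero_on_sdiff supp_subset_range_natDegree_succ
  · intro i hi
    rw [notMem_support_iff.1 (Finset.mem_sdiff.1 hi).2, zero_smul, LinearMap.zero_apply]
  · intro i hi
    rw [F2_coeff a i hi, one_smul, Module.End.pow_apply]
    rfl

lemma evz_eq (x : S) (a : F2[X]) : letI := ZMod.algebra S 2
    evz x a = aeval x a := by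
  letI := ZMod.algebra S 2
  change evz x a = aeval x a
  rw [aeval_eq_sum_range' (n := a.natDegree + 1) (by omega), evz]
  apply Finset.sum_subset_zero_on_sdiff supp_subset_range_natDegree_succ
  · intro i hi
    rw [notMem_support_iff.1 (Finset.mem_sdiff.1 hi).2, zero_smul]
  · intro i hi
    rw [F2_coeff a i hi, one_smul]

lemma evz_mul (x : S) (a b : F2[X]) : evz x (a * b) = evz x a * evz x b := by
  letI := ZMod.algebra S 2
  simp only [evz_eq, map_mul]

lemma evz_add (x : S) (a b : F2[X]) : evz x (a + b) = evz x a + evz x b := by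
  letI := ZMod.algebra S 2
  simp only [evz_eq, map_add]

lemma evz_X_pow (x : S) (i : ℕ) : evz x (X ^ i) = x ^ i := by
  letI := ZMod.algebra S 2
  rw [evz_eq, map_pow, aeval_X]

lemma evz_one (x : S) : evz x 1 = 1 := by
  letI := ZMod.algebra S 2
  rw [evz_eq, map_one]

lemma carl_mul (x : S) (a b : F2[X]) (z : S) : carl x (a * b) z = carl x a (carl x b z) := by
  letI := ZMod.algebra S 2
  simp only [carl_eq, map_mul, Module.End.mul_apply]

lemma carl_add (x : S) (a b : F2[X]) (z : S) : carl x (a + b) z = carl x a z + carl x b z := by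
  letI := ZMod.algebra S 2
  simp only [carl_eq, map_add, LinearMap.add_apply]

lemma carl_sub (x : S) (a b : F2[X]) (z : S) : carl x (a - b) z = carl x a z - carl x b z := by
  letI := ZMod.algebra S 2
  simp only [carl_eq, map_sub, LinearMap.sub_apply]

lemma carl_zero_arg (x : S) (a : F2[X]) : carl x a 0 = 0 := by
  letI := ZMod.algebra S 2
  simp only [carl_eq, map_zero]

lemma carl_add_arg (x : S) (a : F2[X]) (z w : S) : carl x a (z + w) = carl x a z + carl x a w := by
  letI := ZMod.algebra S 2
  simp only [carl_eq, map_add]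

lemma carl_map {S' : Type} [CommRing S'] (g : S →+* S') (x : S) (a : F2[X]) (z : S) :
    g (carl x a z) = carl (g x) a (g z) := by
  rw [carl, carl, map_sum]
  refine Finset.sum_congr rfl fun i hi => ?_
  clear hi
  induction i generalizing z with
  | zero => rfl
  | succ n ih => rw [Function.iterate_succ_apply, Function.iterate_succ_apply, ih]; simp

lemma evz_map {S' : Type} [CommRing S'] (g : S →+* S') (x : S) (a : F2[X]) :
    g (evz x a) = evz (g x) a := by
  simp [evz]

/-- Carlitz polynomial -/
def carP (x : S) (a : F2[X]) : S[X] := carl (C x) a X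

lemma eval_carP (x : S) (a : F2[X]) (z : S) : (carP x a).eval z = carl x a z := by
  have := carl_map (evalRingHom z) (C x) a X
  simpa [carP] using this

lemma map_carP {S' : Type} [CommRing S'] [CharP S' 2] (g : S →+* S') (x : S) (a : F2[X]) :
    (carP x a).map g = carP (g x) a := by
  have := carl_map (mapRingHom g) (C x) a X
  simpa [carP] using this

lemma deriv_carP (x : S) (a : F2[X]) : derivative (carP x a) = C (evz x a) := by
  rw [carP, carl, derivative_sum, evz, map_sum]
  refine Finset.sum_congr rfl fun i hi => ?_
  clear hi
  induction i with
  | zero => simp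
  | succ n ih =>
    rw [Function.iterate_succ_apply']
    simp only [derivative_add, derivative_mul, derivative_C, derivative_pow, ih]
    have : ((2 : ℕ) : S[X]) = 0 := CharP.cast_eq_zero _ 2
    rw [show (C ((2:ℕ):S) : S[X]) = 0 by rw [CharP.cast_eq_zero S 2, C_0]]
    rw [pow_succ x n, C_mul]; ring

lemma iter_monic [Nontrivial S] (x : S) (i : ℕ) :
    ((fun z : S[X] => C x * z + z ^ 2)^[i] X).Monic ∧
    ((fun z : S[X] => C x * z + z ^ 2)^[i] X).natDegree = 2 ^ i := by
  induction i with
  | zero => simp [monic_X]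
  | succ n ih =>
    rw [Function.iterate_succ_apply']
    set p := ((fun z : S[X] => C x * z + z ^ 2)^[n] X)
    obtain ⟨h1, h2⟩ := ih
    have h3 : (p ^ 2).Monic := h1.pow 2
    have h4 : (p ^ 2).natDegree = 2 ^ (n + 1) := by rw [h1.natDegree_pow, h2]; ring
    have h5 : (C x * p).natDegree < (p ^ 2).natDegree := by
      refine (natDegree_C_mul_le _ _).trans_lt ?_
      rw [h2, h4]; exact Nat.pow_lt_pow_right (by norm_num) (by omega)
    have h6 : degree (C x * p) < degree (p ^ 2) := degree_lt_degree h5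
    exact ⟨h3.add_of_right h6, by rw [natDegree_add_eq_right_of_natDegree_lt h5, h4]⟩

lemma carP_deg_lt [Nontrivial S] (x : S) (a : F2[X]) (n : ℕ) (h : a.degree < n) :
    (carP x a).degree < (2 ^ n : ℕ) := by
  rw [carP, carl]
  refine (degree_sum_le _ _).trans_lt ?_
  rw [Finset.sup_lt_iff (WithBot.bot_lt_coe _)]
  intro i hi
  rw [degree_eq_natDegree (iter_monic x i).1.ne_zero, (iter_monic x i).2]
  have : i < n := by
    have := (le_degree_of_mem_supp i hi).trans_lt h
    exact_mod_cast this
  exact_mod_cast Nat.pow_lt_pow_right (by norm_num) this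

lemma carP_monic [Nontrivial S] (x : S) (a : F2[X]) (ha : a ≠ 0) :
    (carP x a).Monic ∧ (carP x a).natDegree = 2 ^ a.natDegree := by
  have h1 := eraseLead_add_monomial_natDegree_leadingCoeff a
  have hl : a.leadingCoeff = 1 := F2_coeff a _ (natDegree_mem_support_of_nonzero ha)
  have h2 : carP x a = carP x a.eraseLead + ((fun z : S[X] => C x * z + z ^ 2)^[a.natDegree] X) := by
    conv_lhs => rw [← h1]
    rw [carP, carl_add, hl, monomial_one_right_eq_X_pow]
    congr 1
    rw [carl, support_X_pow, Finset.sum_singleton]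
  have h3 := carP_deg_lt x a.eraseLead a.natDegree (by
    rw [← degree_eq_natDegree ha]; exact degree_eraseLead_lt ha)
  obtain ⟨h4, h5⟩ := iter_monic x a.natDegree
  rw [← h5, ← degree_eq_natDegree h4.ne_zero] at h3
  rw [h2]
  exact ⟨h4.add_of_right h3, by rw [natDegree_add_eq_right_of_degree_lt h3, h5]⟩

/-- left-coefficient evaluation -/
def lev (c : S) (p : S[X]) (z : S) : S := ∑ i ∈ p.support, p.coeff i * (fun z => c * z + z ^ 2)^[i] z

lemma lev_range (c : S) (p : S[X]) (z : S) (n : ℕ) (h : p.natDegree < n) :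
    lev c p z = ∑ i ∈ Finset.range n, p.coeff i * (fun z => c * z + z ^ 2)^[i] z := by
  rw [lev]
  apply Finset.sum_subset
  · exact supp_subset_range h
  · intro i _ hi
    rw [notMem_support_iff.1 hi, zero_mul]

lemma lev_step (c : S) (p : S[X]) (d : S) (z : S) :
    lev c (p * (X - C d)) z = lev c p (c * z + z ^ 2) - d * lev c p z := by
  set n := max p.natDegree (p * (X - C d)).natDegree + 1
  rw [lev_range c _ z (n + 1) (by omega), lev_range c p _ n (by omega),
    lev_range c p z (n + 1) (by omega)]
  rw [Finset.mul_sum]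
  have h1 : ∑ i ∈ Finset.range n, p.coeff i * (fun z => c * z + z ^ 2)^[i] (c * z + z ^ 2)
     = ∑ i ∈ Finset.range (n + 1), (p * X).coeff i * (fun z => c * z + z ^ 2)^[i] z := by
    rw [Finset.sum_range_succ' _ n]
    simp only [coeff_mul_X, mul_coeff_zero, coeff_X_zero, mul_zero, zero_mul, add_zero,
      Function.iterate_succ_apply]
  rw [h1, ← Finset.sum_sub_distrib]
  refine Finset.sum_congr rfl fun i _ => ?_
  rw [mul_sub, coeff_sub, coeff_mul_C]; ring

lemma lev_prod (c : S) (m : ℕ) (z : S) :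
    lev c (∏ i ∈ Finset.range m, (X - C (c ^ (2 ^ i)))) z = z ^ (2 ^ m) := by
  induction m generalizing z with
  | zero =>
    rw [lev_range c _ z 1 (by simp)]
    simp
  | succ n ih =>
    rw [Finset.prod_range_succ, lev_step, ih, ih, add_pow_char_pow]
    rw [mul_pow]; ring

lemma carl_frob (c : S) (m : ℕ) (F : F2[X])
    (hF : F.map (ZMod.castHom (dvd_refl 2) S) = ∏ i ∈ Finset.range m, (X - C (c ^ (2 ^ i))))
    (z : S) : carl c F z = z ^ (2 ^ m) := by
  rw [← lev_prod c m z, ← hF, lev_range c _ z (F.natDegree + 1)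
    (Nat.lt_succ_of_le natDegree_map_le), carl]
  apply Finset.sum_subset_zero_on_sdiff supp_subset_range_natDegree_succ
  · intro i hi
    rw [coeff_map, notMem_support_iff.1 (Finset.mem_sdiff.1 hi).2, map_zero, zero_mul]
  · intro i hi
    rw [coeff_map, F2_coeff F i hi, map_one, one_mul]

end Carl

/-- If `C_F` and `C_F'` agree on `2^{deg s}` torsion points then `s ∣ F - F'`. -/
lemma dvd_of_carl {S : Type} [CommRing S] [IsDomain S] [CharP S 2] (x : S) (s : F2[X]) (hs : s ≠ 0)
    (Λ : Finset S) (hΛ : ∀ z ∈ Λ, carl x s z = 0) (hcard : 2 ^ s.natDegree ≤ Λ.card) (F F' : F2[X])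
    (h : ∀ z ∈ Λ, carl x F z = carl x F' z) : s ∣ F - F' := by
  rw [← EuclideanDomain.mod_eq_zero]
  by_contra hne
  set G := (F - F') % s with hG
  have h0 : ∀ z ∈ Λ, carl x G z = 0 := by
    intro z hz
    have h1 : F - F' = G + ((F - F') / s) * s := by
      have := EuclideanDomain.div_add_mod (F - F') s
      rw [← hG] at this
      rw [mul_comm, add_comm]; exact this.symm
    have h2 : carl x (F - F') z = 0 := by rw [carl_sub, h z hz, sub_self]
    rw [h1, carl_add, carl_mul, hΛ z hz, carl_zero_arg, add_zero] at h2
    exact h2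
  have hm := carP_monic x G hne
  have hle : Λ.card ≤ (carP x G).natDegree := by
    apply card_le_degree_of_subset_roots
    intro z hz
    rw [mem_roots hm.1.ne_zero, IsRoot, eval_carP]
    exact h0 z hz
  rw [hm.2] at hle
  have hd : G.natDegree < s.natDegree := by
    apply natDegree_lt_natDegree hne
    exact EuclideanDomain.mod_lt (F - F') hs
  have := Nat.pow_lt_pow_right (a := 2) (by norm_num) hd
  omega

lemma hensel_carl {k : Type} [Field k] [CharP k 2] (x : PowerSeries k) (a : F2[X]) (z0 : k)
    (hu : evz (PowerSeries.constantCoeff x) a ≠ 0)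
    (h0 : carl (PowerSeries.constantCoeff x) a z0 = 0) :
    ∃ y : PowerSeries k, carl x a y = 0 ∧ PowerSeries.constantCoeff y = z0 := by
  have : CharP (PowerSeries k) 2 := charP_of_injective_algebraMap (algebraMap k (PowerSeries k)).injective 2
  have ha : a ≠ 0 := by rintro rfl; simp [evz] at hu
  have hH : HenselianRing (PowerSeries k) (Ideal.span {PowerSeries.X}) := inferInstance
  obtain ⟨y, hy1, hy2⟩ := hH.is_henselian (carP x a) (carP_monic x a ha).1 (PowerSeries.C z0) (by
    rw [eval_carP, Ideal.mem_span_singleton, PowerSeries.X_dvd_iff, carl_map]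
    simpa using h0) (by
    rw [deriv_carP, eval_C]
    apply IsUnit.map
    rw [PowerSeries.isUnit_iff_constantCoeff, evz_map]
    exact hu.isUnit)
  refine ⟨y, ?_, ?_⟩
  · rw [IsRoot, eval_carP] at hy1; exact hy1
  · rw [Ideal.mem_span_singleton, PowerSeries.X_dvd_iff] at hy2
    simpa [sub_eq_zero] using hy2

/-! ### Points and Frobenius elements -/

section Cheb
variable {R B I Ω G : Type} [CommRing R] [CommRing B] [Algebra R B] [Fintype I] [Field Ω]

lemma exists_point [Nonempty I] [IsAlgClosed Ω] (b : Module.Basis I R B) (f : R →+* Ω) :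
    ∃ P : B →+* Ω, ∀ r, P (algebraMap R B r) = f r := by
  letI := f.toAlgebra
  have b' := b.baseChange Ω
  haveI : Nontrivial (TensorProduct R Ω B) := b'.repr.toEquiv.nontrivial
  haveI : Module.Finite Ω (TensorProduct R Ω B) := Module.Finite.of_basis b'
  obtain ⟨M, hM⟩ := Ideal.exists_maximal (TensorProduct R Ω B)
  letI : Field (TensorProduct R Ω B ⧸ M) := Ideal.Quotient.field M
  haveI : Algebra.IsIntegral Ω (TensorProduct R Ω B ⧸ M) := inferInstance
  have hb := IsAlgClosed.algebraMap_bijective_of_isIntegral (k := Ω) (K := TensorProduct R Ω B ⧸ M)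
  let E := RingEquiv.ofBijective _ hb
  refine ⟨(E.symm : _ →+* Ω).comp ((Ideal.Quotient.mk M).comp
    (Algebra.TensorProduct.includeRight (R := R) (A := Ω) (B := B)).toRingHom), fun r => ?_⟩
  simp only [RingHom.comp_apply, AlgHom.toRingHom_eq_coe, RingHom.coe_coe, AlgHom.commutes]
  rw [RingEquiv.symm_apply_eq]
  rfl

lemma exists_conj [Group G] [Fintype G] [MulSemiringAction G B] [SMulCommClass G R B]
    [Algebra.IsInvariant R B G] (b : Module.Basis I R B) (P P' : B →+* Ω)
    (h : ∀ r, P (algebraMap R B r) = P' (algebraMap R B r)) : ∃ g : G, ∀ z, P' z = P (g • z) := by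
  let en := Fintype.equivFin I
  let z : B[X] := ∑ i : I, C (b i) * X ^ (en i : ℕ)
  have hzc : ∀ i, z.coeff (en i) = b i := by
    intro i
    simp only [z, finset_sum_coeff, coeff_C_mul, coeff_X_pow]
    rw [Finset.sum_eq_single i]
    · simp
    · intro j _ hj
      have : ¬ ((en i : ℕ) = en j) := fun h => hj (en.injective (Fin.ext h)).symm
      simp [this]
    · simp
  -- characteristic polynomial
  have hinv : ∀ w : B[X], (∀ g : G, g • w = w) → ∃ v : R[X], w = v.map (algebraMap R B) := by
    intro w hw
    have : w ∈ Polynomial.lifts (algebraMap R B) := by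
      rw [Polynomial.lifts_iff_coeff_lifts]
      intro n
      apply Algebra.IsInvariant.isInvariant (A := R) (G := G)
      intro g
      rw [← Polynomial.coeff_smul, hw]
    rw [Polynomial.mem_lifts] at this
    obtain ⟨v, hv⟩ := this
    exact ⟨v, hv.symm⟩
  have hmap : ∀ w : B[X], (∀ g : G, g • w = w) → w.map P = w.map P' := by
    intro w hw
    obtain ⟨v, rfl⟩ := hinv w hw
    rw [Polynomial.map_map, Polynomial.map_map]
    congr 1
    ext r
    exact h r
  have hcp : (MulSemiringAction.charpoly G z).map (mapRingHom P) =
      (MulSemiringAction.charpoly G z).map (mapRingHom P') := by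
    ext1 n
    rw [coeff_map, coeff_map]
    exact hmap _ (fun g => MulSemiringAction.smul_coeff_charpoly z n g)
  have hroot : (((MulSemiringAction.charpoly G z).map (mapRingHom P')).eval (z.map P')) = 0 := by
    have := congrArg (mapRingHom P') (MulSemiringAction.eval_charpoly G z)
    rw [map_zero, ← Polynomial.eval₂_at_apply, ← Polynomial.eval_map] at this
    exact this
  rw [← hcp, MulSemiringAction.charpoly_eq, Polynomial.map_prod, eval_prod, Finset.prod_eq_zero_iff] at hroot
  obtain ⟨g, _, hg⟩ := hroot
  simp only [Polynomial.map_sub, map_X, map_C, eval_sub, eval_X, eval_C, coe_mapRingHom, sub_eq_zero] at hg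
  refine ⟨g, fun y => ?_⟩
  have hb : ∀ i, P' (b i) = P (g • b i) := by
    intro i
    have := congrArg (fun q => q.coeff (en i)) hg
    simpa [coeff_map, coeff_smul, hzc] using this
  rw [← b.sum_repr y]
  simp only [Finset.smul_sum, map_sum]
  refine Finset.sum_congr rfl fun i _ => ?_
  rw [smul_comm, Algebra.smul_def, Algebra.smul_def, map_mul, map_mul, hb, h]
end Cheb

/-- fixed points of the `Q`-power map -/
def fixQ (Ω : Type) [Field Ω] (Q : ℕ) : Finset Ω := ((X ^ Q - X : Polynomial Ω).roots).toFinset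

section FixQ
variable {Ω : Type} [Field Ω]

lemma X_pow_sub_ne (Q : ℕ) (hQ : 1 < Q) : (X ^ Q - X : Polynomial Ω) ≠ 0 := by
  have := FiniteField.X_pow_card_sub_X_ne_zero Ω hQ
  exact this

lemma mem_fixQ (Q : ℕ) (hQ : 1 < Q) (c : Ω) : c ∈ fixQ Ω Q ↔ c ^ Q = c := by
  unfold fixQ
  rw [Multiset.mem_toFinset, mem_roots (X_pow_sub_ne Q hQ)]
  simp [sub_eq_zero]

lemma card_fixQ [IsAlgClosed Ω] [CharP Ω 2] (Q : ℕ) (hQ : 1 < Q) (h2 : 2 ∣ Q) :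
    (fixQ Ω Q).card = Q := by
  unfold fixQ
  have hs : (X ^ Q - X : Polynomial Ω).Separable := galois_poly_separable 2 Q h2
  rw [Multiset.toFinset_card_of_nodup (nodup_roots hs)]
  have := (IsAlgClosed.splits (X ^ Q - X : Polynomial Ω)).natDegree_eq_card_roots
  rw [← this, FiniteField.X_pow_card_sub_X_natDegree_eq Ω hQ]
end FixQ

section Cheb
variable {k B I Ω G : Type} [Field k] [CharP k 2] [CommRing B] [IsDomain B] [Algebra k[X] B]
  [Algebra k B] [IsScalarTower k k[X] B] [Fintype I] [Field Ω] [IsAlgClosed Ω] [Algebra k Ω]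
  [Group G] [Fintype G] [MulSemiringAction G B] [SMulCommClass G k[X] B]
  [Algebra.IsInvariant k[X] B G] [FaithfulSMul G B]

lemma ne_zero_of_norm (b : Module.Basis I k[X] B) (P : B →+* Ω) (c : Ω)
    (hP : ∀ p : k[X], P (algebraMap k[X] B p) = aeval c p) (u : B)
    (hu : aeval c (Algebra.norm k[X] u) ≠ 0) : P u ≠ 0 := by
  intro h0
  apply hu
  rw [← hP]
  obtain ⟨v, hv⟩ := dvd_norm' b u
  rw [hv, map_mul, h0, zero_mul]

theorem chebotarev (b : Module.Basis I k[X] B) (ι : B →+* PowerSeries k)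
    (hinj : Function.Injective ι)
    (hι : ∀ p : k[X], ι (algebraMap k[X] B p) = (p : PowerSeries k)) (W : Finset B)
    (hW : ∀ w ∈ W, w ≠ 0) :
    ∃ (D : k[X]) (C e0 : ℕ), D ≠ 0 ∧ ∀ e, e0 ≤ e → 0 < e → (∀ a : k, a ^ (2 ^ e * 2 ^ e) = a) →
    ∃ (Pt : Ω → G → (B →ₐ[k] Ω)) (Fr : Ω → G → G),
      (∀ c ∈ fixQ Ω (2 ^ e * 2 ^ e), aeval c D ≠ 0 → ∀ g,
        Pt c g (algebraMap k[X] B X) = c ∧ (∀ z, Pt c g z ^ (2 ^ e * 2 ^ e) = Pt c g (Fr c g • z)) ∧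
        ∀ w ∈ W, Pt c g w ≠ 0) ∧
      ∀ τ : G, |((((((fixQ Ω (2 ^ e * 2 ^ e)).filter (fun c => aeval c D ≠ 0)) ×ˢ
          (Finset.univ : Finset G)).filter (fun x => Fr x.1 x.2 = τ)).card : ℝ)) - (2 ^ e * 2 ^ e : ℝ)|
          ≤ C * 2 ^ e := by
  haveI : CharP Ω 2 := charP_of_injective_algebraMap (algebraMap k Ω).injective 2
  haveI : Nonempty I := b.index_nonempty
  -- the separating elements
  have hsep : ∀ g g' : G, ∃ z : B, g ≠ g' → g • z - g' • z ≠ 0 := by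
    intro g g'
    by_contra! hcon
    by_cases hgg : g = g'
    · exact absurd hgg (hcon 0).1
    · exact hgg (FaithfulSMul.eq_of_smul_eq_smul (α := B) fun z => sub_eq_zero.1 (hcon z).2)
  choose z hz using hsep
  let D : k[X] := (∏ g : G, ∏ g' : G, (if g = g' then 1 else Algebra.norm k[X] (g • z g g' - g' • z g g'))) *
    ∏ g : G, ∏ w ∈ W, Algebra.norm k[X] (g • w)
  have hD : D ≠ 0 := by
    apply mul_ne_zero
    · refine Finset.prod_ne_zero_iff.2 fun g _ => Finset.prod_ne_zero_iff.2 fun g' _ => ?_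
      split_ifs with h
      · exact one_ne_zero
      · exact (Algebra.norm_ne_zero_iff_of_basis b).2 (hz g g' h)
    · refine Finset.prod_ne_zero_iff.2 fun g _ => Finset.prod_ne_zero_iff.2 fun w hw => ?_
      refine (Algebra.norm_ne_zero_iff_of_basis b).2 ?_
      rw [Ne, smul_eq_zero_iff_eq]
      exact hW w hw
  have hst : ∀ τ : G, ∃ C e0 : ℕ, ∀ e, e0 ≤ e →
    ∀ (S : Finset (B →ₐ[k] Ω)), (∀ P ∈ S, ∀ z, P z ^ (2 ^ e * 2 ^ e) = P (τ • z)) →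
    S.card ≤ 2 ^ e * 2 ^ e + C * 2 ^ e := by
    intro τ
    exact stepanov b ι hinj hι ((MulSemiringAction.toAlgHom k[X] B τ).toLinearMap) Ω
  choose C1 e1 hC1 using hst
  have hpt : ∀ c : Ω, ∃ P : B →ₐ[k] Ω, ∀ p : k[X], P (algebraMap k[X] B p) = aeval c p := by
    intro c
    obtain ⟨P, hP⟩ := exists_point (Ω := Ω) b (aeval c : k[X] →ₐ[k] Ω).toRingHom
    refine ⟨{ P with commutes' := fun r => ?_ }, fun p => hP p⟩
    have : algebraMap k B r = algebraMap k[X] B (C r) := by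
      rw [IsScalarTower.algebraMap_apply k k[X] B]; rfl
    rw [this]
    refine (hP (C r)).trans ?_
    simp
  choose P hP using hpt
  let Cs := ∑ τ : G, C1 τ
  refine ⟨D, Fintype.card G * (D.natDegree + Cs), ∑ τ : G, e1 τ, hD, ?_⟩
  intro e he he0 hk
  have hQ1 : 1 < 2 ^ e * 2 ^ e := by
    have : 1 < 2 ^ e := Nat.one_lt_two_pow he0.ne'
    nlinarith
  set Q := 2 ^ e * 2 ^ e with hQdef
  have h2Q : 2 ∣ Q := Dvd.dvd.mul_right (dvd_pow_self 2 he0.ne') _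
  have hfr : ∀ c : Ω, ∃ σ : G, c ^ Q = c → ∀ z, P c z ^ Q = P c (σ • z) := by
    intro c
    by_cases hc : c ^ Q = c
    swap
    · exact ⟨1, fun h => absurd h hc⟩
    have hQ2 : Q = 2 ^ (e + e) := by rw [hQdef, pow_add]
    let P' : B →+* Ω := (iterateFrobenius Ω 2 (e + e)).comp (P c).toRingHom
    have hP' : ∀ z, P' z = P c z ^ Q := by
      intro z
      rw [hQ2]; exact iterateFrobenius_def ..
    obtain ⟨σ, hσ⟩ := exists_conj (G := G) b (P c).toRingHom P' (by
      intro r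
      rw [hP']
      show P c (algebraMap k[X] B r) = _
      rw [hP]
      induction r using Polynomial.induction_on' with
      | add p q hp hq =>
        rw [map_add, hQ2, add_pow_char_pow, ← hQ2, ← hp, ← hq]
      | monomial n a =>
        rw [aeval_monomial, mul_pow, ← map_pow, hk, ← pow_mul, mul_comm n Q, pow_mul, hc])
    exact ⟨σ, fun _ z => by rw [← hP']; exact hσ z⟩
  choose s hs using hfr
  let Pt : Ω → G → (B →ₐ[k] Ω) := fun c g =>
    (P c).comp ((MulSemiringAction.toAlgHom k[X] B g).restrictScalars k)
  have hPt : ∀ c g y, Pt c g y = P c (g • y) := fun c g y => rfl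
  refine ⟨Pt, fun c g => g⁻¹ * s c * g, ?_, ?_⟩
  · intro c hc hcD g
    rw [mem_fixQ Q hQ1] at hc
    refine ⟨?_, ?_, ?_⟩
    · rw [hPt, smul_algebraMap, hP, aeval_X]
    · intro y
      rw [hPt, hPt, hs c hc, smul_smul, smul_smul]
      congr 2
      group
    · intro w hw
      rw [hPt]
      refine ne_zero_of_norm b (P c : B →+* Ω) c (hP c) _ ?_
      intro h0
      apply hcD
      simp only [D, map_mul, map_prod]
      apply mul_eq_zero_of_right
      exact Finset.prod_eq_zero (Finset.mem_univ g) (Finset.prod_eq_zero hw h0)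
  · set good := (fixQ Ω Q).filter (fun c => aeval c D ≠ 0) with hgood
    set NN : G → ℕ := fun τ => ((good ×ˢ (Finset.univ : Finset G)).filter
      (fun x => x.2⁻¹ * s x.1 * x.2 = τ)).card with hNN
    have hinjP : Set.InjOn (fun x : Ω × G => Pt x.1 x.2) (good ×ˢ (Finset.univ : Finset G) : Finset _) := by
      rintro ⟨c, g⟩ hx ⟨c', g'⟩ hx' hxx
      simp only at hxx
      have hcc : c = c' := by
        have := congrArg (fun F : B →ₐ[k] Ω => F (algebraMap k[X] B X)) hxx
        simpa [hPt, smul_algebraMap, hP] using this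
      subst hcc
      simp only [hgood, Finset.coe_product, Finset.coe_filter, Finset.coe_univ, Set.mem_prod, Set.mem_setOf_eq, Set.mem_univ, and_true] at hx
      by_contra hne
      have hgg : g ≠ g' := fun h => hne (by rw [h])
      have h1 : P c (g • z g g' - g' • z g g') = 0 := by
        rw [map_sub, ← hPt, ← hPt, hxx, sub_self]
      refine ne_zero_of_norm b (P c : B →+* Ω) c (hP c) _ ?_ h1
      intro h0
      apply hx.2
      simp only [D, map_mul, map_prod]
      apply mul_eq_zero_of_left
      refine Finset.prod_eq_zero (Finset.mem_univ g) (Finset.prod_eq_zero (Finset.mem_univ g') ?_)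
      rw [if_neg hgg]; exact h0
    have hup : ∀ τ, NN τ ≤ Q + Cs * 2 ^ e := by
      intro τ
      have h1 : NN τ ≤ Q + C1 τ * 2 ^ e := by
        rw [hNN]
        simp only
        rw [← Finset.card_image_of_injOn (f := fun x : Ω × G => Pt x.1 x.2) (hinjP.mono (by
          intro x hx; exact (Finset.mem_filter.1 hx).1))]
        apply hC1 τ e (le_trans (Finset.single_le_sum (f := e1) (fun _ _ => Nat.zero_le _) (Finset.mem_univ τ)) he)
        intro F hF y
        rw [Finset.mem_image] at hF
        obtain ⟨⟨c, g⟩, hx, rfl⟩ := hF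
        rw [Finset.mem_filter, Finset.mem_product, hgood, Finset.mem_filter, mem_fixQ Q hQ1] at hx
        simp only at hx ⊢
        rw [← hQdef, hPt, hPt, hs c hx.1.1.1, ← hx.2, smul_smul, smul_smul]
        congr 2
        group
      have h2 : C1 τ ≤ Cs := Finset.single_le_sum (f := C1) (fun _ _ => Nat.zero_le _) (Finset.mem_univ τ)
      exact h1.trans (by gcongr)
    have htot : ∑ τ, NN τ = good.card * Fintype.card G := by
      rw [hNN]
      simp only
      rw [← Finset.card_univ, ← Finset.card_product]
      exact (Finset.card_eq_sum_card_fiberwise (f := fun x : Ω × G => x.2⁻¹ * s x.1 * x.2) (t := Finset.univ) (fun x _ => Finset.mem_coe.2 (Finset.mem_univ _))).symm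
    have hgc : Q ≤ good.card + D.natDegree := by
      have h1 := card_fixQ (Ω := Ω) Q hQ1 h2Q
      rw [← Finset.card_filter_add_card_filter_not (s := fixQ Ω Q) (fun c => aeval c D ≠ 0)] at h1
      have h2 : ((fixQ Ω Q).filter (fun c => ¬ aeval c D ≠ 0)).card ≤ D.natDegree := by
        have h3 : (fixQ Ω Q).filter (fun c => ¬ aeval c D ≠ 0) ⊆ (D.map (algebraMap k Ω)).roots.toFinset := by
          intro c hc
          rw [Finset.mem_filter, not_not] at hc
          rw [Multiset.mem_toFinset, mem_roots (Polynomial.map_ne_zero hD), IsRoot, eval_map_algebraMap]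
          exact hc.2
        refine (Finset.card_le_card h3).trans ((Multiset.toFinset_card_le _).trans ((card_roots' _).trans ?_))
        exact natDegree_map_le
      have h4 : good.card + ((fixQ Ω Q).filter (fun c => ¬ aeval c D ≠ 0)).card = Q := by
        rw [← h1, hgood]
        congr!
      omega
    intro τ
    have hG : 1 ≤ Fintype.card G := Fintype.card_pos
    have hlow : Q + 0 ≤ NN τ + Fintype.card G * (D.natDegree + Cs) * 2 ^ e := by
      have h1 : ∑ τ', NN τ' ≤ NN τ + (Fintype.card G - 1) * (Q + Cs * 2 ^ e) := by
        rw [← Finset.add_sum_erase _ _ (Finset.mem_univ τ)]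
        gcongr
        refine (Finset.sum_le_card_nsmul _ _ _ fun x _ => hup x).trans ?_
        rw [Finset.card_erase_of_mem (Finset.mem_univ τ), Finset.card_univ, smul_eq_mul]
      rw [htot] at h1
      obtain ⟨n, hn⟩ := Nat.exists_eq_add_of_le hG
      rw [hn] at h1 ⊢
      have h5 : 1 ≤ 2 ^ e := Nat.one_le_two_pow
      have h6 : D.natDegree * 1 ≤ D.natDegree * 2 ^ e := by gcongr
      simp only [Nat.add_sub_cancel_left] at h1
      nlinarith
    have hup' := hup τ
    have e1' : ((2:ℝ) ^ e * 2 ^ e) = (Q : ℝ) := by rw [hQdef]; push_cast; rfl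
    rw [e1']
    show |((NN τ : ℕ) : ℝ) - Q| ≤ _
    rw [abs_le]
    have a1 : (NN τ : ℝ) ≤ Q + Cs * 2 ^ e := by exact_mod_cast hup'
    have a2 : (Q : ℝ) ≤ NN τ + Fintype.card G * (D.natDegree + Cs) * 2 ^ e := by exact_mod_cast hlow
    have a3 : (1:ℝ) ≤ Fintype.card G := by exact_mod_cast hG
    have a4 : (0:ℝ) ≤ (D.natDegree + Cs) * 2 ^ e := by positivity
    have a5 : (Cs:ℝ) * 2 ^ e ≤ (D.natDegree + Cs) * 2 ^ e := by
      gcongr; simp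
    push_cast
    constructor
    · linarith
    · nlinarith
end Cheb

section FC
variable {Ω : Type} [Field Ω] [Algebra F2 Ω] [Algebra.IsAlgebraic F2 Ω]

/-- degree of an element over the prime field -/
def dg (c : Ω) : ℕ := (minpoly F2 c).natDegree

/-- the characteristic polynomial of `c` in degree `n` -/
def Fc (n : ℕ) (c : Ω) : F2[X] := minpoly F2 c ^ (n / dg c)

lemma charP_of_F2 : CharP Ω 2 := charP_of_injective_algebraMap (algebraMap F2 Ω).injective 2

lemma isInt (c : Ω) : IsIntegral F2 c := (Algebra.IsAlgebraic.isAlgebraic c).isIntegral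

lemma dg_pos (c : Ω) : 0 < dg c := minpoly.natDegree_pos (isInt c)

lemma dg_dvd_iff (c : Ω) (n : ℕ) : dg c ∣ n ↔ c ^ (2 ^ n) = c := by
  unfold dg
  rw [(minpoly.irreducible (isInt c)).natDegree_dvd_iff_dvd_X_pow_card_pow_sub_X]
  simp only [Nat.card_zmod]
  rw [minpoly.dvd_iff]
  simp [sub_eq_zero]

lemma minpoly_map (c : Ω) : (minpoly F2 c).map (algebraMap F2 Ω) =
    ∏ i ∈ Finset.range (dg c), (X - C (c ^ (2 ^ i))) := by
  haveI : CharP Ω 2 := charP_of_F2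
  apply Polynomial.eq_of_monic_of_dvd_of_natDegree_le
  · exact monic_prod_of_monic _ _ (fun i _ => monic_X_sub_C _)
  · exact (minpoly.monic (isInt c)).map _
  · apply Finset.prod_dvd_of_coprime
    · intro i hi j hj hij
      have hne : ∀ i j, i < j → j < dg c → c ^ (2 ^ i) ≠ c ^ (2 ^ j) := by
        intro i j hij hj h
        have h1 : (c ^ (2 ^ (j - i)) - c) ^ (2 ^ i) = 0 := by
          rw [sub_pow_char_pow, ← pow_mul, ← pow_add, Nat.sub_add_cancel hij.le, h, sub_self]
        have h2 := (dg_dvd_iff c _).2 (sub_eq_zero.1 (pow_eq_zero_iff (by positivity) |>.1 h1))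
        have := Nat.le_of_dvd (by omega) h2
        omega
      have hi' := Finset.mem_range.1 (Finset.mem_coe.1 hi)
      have hj' := Finset.mem_range.1 (Finset.mem_coe.1 hj)
      apply isCoprime_X_sub_C_of_isUnit_sub
      apply IsUnit.mk0
      rw [sub_ne_zero]
      rcases lt_or_gt_of_ne hij with h | h
      · exact hne i j h hj'
      · exact (hne j i h hi').symm
    · intro i hi
      rw [dvd_iff_isRoot, IsRoot, eval_map_algebraMap]
      have : (aeval c (minpoly F2 c)) ^ (2 ^ i) = aeval (c ^ (2 ^ i)) (minpoly F2 c) := by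
        generalize minpoly F2 c = p
        induction p using Polynomial.induction_on' with
        | add p q hp hq => rw [map_add, map_add, add_pow_char_pow, hp, hq]
        | monomial n a =>
          rw [aeval_monomial, aeval_monomial, mul_pow, ← map_pow, ZMod.pow_card_pow, ← pow_mul, ← pow_mul, mul_comm n]
      rw [← this, minpoly.aeval, zero_pow (by positivity)]
  · rw [natDegree_map, natDegree_prod_of_monic _ _ (fun i _ => monic_X_sub_C _)]
    simp only [natDegree_X_sub_C]
    simp [dg]

lemma Fc_map (n : ℕ) (c : Ω) (hc : c ^ (2 ^ n) = c) : (Fc n c).map (algebraMap F2 Ω) =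
    ∏ i ∈ Finset.range n, (X - C (c ^ (2 ^ i))) := by
  have h := (dg_dvd_iff c n).2 hc
  have hd : c ^ (2 ^ dg c) = c := (dg_dvd_iff c _).1 dvd_rfl
  obtain ⟨t, rfl⟩ := h
  rw [Fc, Polynomial.map_pow, minpoly_map, Nat.mul_div_cancel_left _ (dg_pos c)]
  clear hc
  have key : ∀ t i, c ^ (2 ^ (dg c * t + i)) = c ^ (2 ^ i) := by
    intro t i
    induction t with
    | zero => simp
    | succ t ih =>
      rw [show dg c * (t + 1) + i = dg c + (dg c * t + i) by ring, pow_add, pow_mul, hd, ih]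
  induction t with
  | zero => simp
  | succ t ih =>
    rw [pow_succ, ih, mul_add, mul_one, Finset.prod_range_add]
    congr 1
    refine Finset.prod_congr rfl fun i _ => ?_
    rw [key]

lemma Fc_monic (n : ℕ) (c : Ω) : (Fc n c).Monic := (minpoly.monic (isInt c)).pow _

lemma Fc_natDegree (n : ℕ) (c : Ω) (hc : c ^ (2 ^ n) = c) : (Fc n c).natDegree = n := by
  have h := (dg_dvd_iff c n).2 hc
  rw [Fc, (minpoly.monic (isInt c)).natDegree_pow]
  exact Nat.div_mul_cancel h

lemma reverse_prod_lin {ι : Type} (s : Finset ι) (a : ι → Ω) :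
    (∏ i ∈ s, (X - C (a i))).reverse = ∏ i ∈ s, (1 - C (a i) * X) := by
  induction s using Finset.induction_on with
  | empty => simp [reverse]
  | insert i s hi ih =>
    rw [Finset.prod_insert hi, reverse_mul_of_domain, ih, Finset.prod_insert hi]
    congr 1
    ext n
    rw [coeff_reverse, natDegree_X_sub_C]
    rcases n with _ | _ | n
    · simp [revAt_le, coeff_X, coeff_C]
    · simp [revAt_le, coeff_X, coeff_C, coeff_one]
    · rw [revAt_eq_self_of_lt (by omega)]
      simp [coeff_X, coeff_C, coeff_one]

lemma reverse_map_inj {R S : Type} [CommRing R] [CommRing S] (g : R →+* S) (hg : Function.Injective g) (p : R[X]) :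
    (p.map g).reverse = p.reverse.map g := by
  ext n
  rw [coeff_map, coeff_reverse, coeff_reverse, natDegree_map_eq_of_injective hg, coeff_map]

lemma Fc_rev_map (n : ℕ) (c : Ω) (hc : c ^ (2 ^ n) = c) (h0 : c ≠ 0) :
    (Fc n c).reverse.map (algebraMap F2 Ω) =
    ∏ i ∈ Finset.range n, (X - C ((c⁻¹) ^ (2 ^ i))) := by
  haveI : CharP Ω 2 := charP_of_F2
  rw [← reverse_map_inj _ (algebraMap F2 Ω).injective, Fc_map n c hc, reverse_prod_lin]
  have h1 : ∏ i ∈ Finset.range n, c ^ (2 ^ i) = 1 := by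
    rw [Finset.prod_pow_eq_pow_sum]
    have : ∑ i ∈ Finset.range n, 2 ^ i + 1 = 2 ^ n := by
      rw [Nat.geomSum_eq le_rfl]
      have : 1 ≤ 2 ^ n := Nat.one_le_two_pow
      simp; omega
    have h2 : c ^ (∑ i ∈ Finset.range n, 2 ^ i) * c = c := by rw [← pow_succ, this, hc]
    exact mul_right_cancel₀ h0 (by rw [h2, one_mul])
  calc ∏ i ∈ Finset.range n, (1 - C (c ^ (2 ^ i)) * X)
      = ∏ i ∈ Finset.range n, (C (c ^ (2 ^ i)) * (X - C ((c⁻¹) ^ (2 ^ i)))) := by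
        refine Finset.prod_congr rfl fun i _ => ?_
        rw [mul_sub, ← C_mul, ← mul_pow, mul_inv_cancel₀ h0, one_pow, C_1]
        rw [CharTwo.sub_eq_add, CharTwo.sub_eq_add, add_comm]
    _ = _ := by
        rw [Finset.prod_mul_distrib, ← map_prod C, h1, C_1, one_mul]
end FC

/-! ### torsion of the second Carlitz module, scaled to be integral -/

section Tw
variable {B : Type} [CommRing B]

/-- `w = x ν` with `ν` killed by `X ^ n` for the Carlitz module with parameter `1/x` -/
def tw (x : B) : ℕ → B → Prop
  | 0, w => w = 0
  | n + 1, w => ∃ w', tw x n w' ∧ x * w' = w + w ^ 2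

lemma tw_map {S : Type} [CommRing S] (g : B →+* S) (x : B) (n : ℕ) (w : B) (h : tw x n w) :
    tw (g x) n (g w) := by
  induction n generalizing w with
  | zero => simp only [tw] at *; rw [h, map_zero]
  | succ n ih =>
    obtain ⟨w', h1, h2⟩ := h
    exact ⟨g w', ih w' h1, by rw [← map_mul, h2, map_add, map_pow]⟩

variable [CharP B 2]

lemma tw_zero (x : B) (n : ℕ) : tw x n 0 := by
  induction n with
  | zero => rfl
  | succ n ih => exact ⟨0, ih, by simp⟩

lemma tw_add (x : B) (n : ℕ) (w w' : B) (h : tw x n w) (h' : tw x n w') : tw x n (w + w') := by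
  induction n generalizing w w' with
  | zero => simp only [tw] at *; rw [h, h', add_zero]
  | succ n ih =>
    obtain ⟨v, h1, h2⟩ := h
    obtain ⟨v', h1', h2'⟩ := h'
    exact ⟨v + v', ih v v' h1 h1', by rw [mul_add, h2, h2', add_pow_char]; ring⟩

lemma tw_mono (x : B) (n : ℕ) (w : B) (h : tw x n w) : tw x (n + 1) w := by
  induction n generalizing w with
  | zero => simp only [tw] at h; rw [h]; exact tw_zero x 1
  | succ n ih =>
    obtain ⟨v, h1, h2⟩ := h
    exact ⟨v, ih v h1, h2⟩

lemma tw_iter (x : B) (n i : ℕ) (w : B) (h : tw x n w) : ∃ w', tw x n w' ∧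
    ∀ (S : Type) [Field S] (g : B →+* S), g x ≠ 0 →
      (fun z => (g x)⁻¹ * z + z ^ 2)^[i] (g w / g x) = g w' / g x := by
  induction i with
  | zero => exact ⟨w, h, fun S _ g hg => rfl⟩
  | succ i ih =>
    obtain ⟨w', h1, h2⟩ := ih
    obtain ⟨v, hv1, hv2⟩ := tw_mono x n w' h1
    refine ⟨v, hv1, fun S _ g hg => ?_⟩
    rw [Function.iterate_succ_apply', h2 S g hg]
    have : g x * g v = g w' + g w' ^ 2 := by rw [← map_mul, hv2, map_add, map_pow]
    field_simp
    rw [this]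
    ring

lemma tw_carl (x : B) (n : ℕ) (F : F2[X]) (w : B) (h : tw x n w) : ∃ w', tw x n w' ∧
    ∀ (S : Type) [Field S] (g : B →+* S), g x ≠ 0 →
      carl ((g x)⁻¹) F (g w / g x) = g w' / g x := by
  choose v hv1 hv2 using fun i => tw_iter x n i w h
  refine ⟨∑ i ∈ F.support, v i, ?_, fun S _ g hg => ?_⟩
  · refine Finset.sum_induction _ (tw x n) (fun a b => tw_add x n a b) (tw_zero x n) fun i _ => hv1 i
  · rw [carl, map_sum, Finset.sum_div]
    exact Finset.sum_congr rfl fun i _ => hv2 i S g hg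

lemma tw_carl_zero {S : Type} [Field S] (g : B →+* S) (x : B) (hg : g x ≠ 0) (n : ℕ) (w : B) (h : tw x n w) :
    carl ((g x)⁻¹) (X ^ n) (g w / g x) = 0 := by
  haveI : Nontrivial (ZMod 2) := inferInstance
  rw [carl, support_X_pow (R := F2)]
  rw [Finset.sum_singleton]
  induction n generalizing w with
  | zero => simp only [tw] at h; simp [h]
  | succ n ih =>
    obtain ⟨v, hv1, hv2⟩ := h
    rw [Function.iterate_succ_apply]
    have : g x * g v = g w + g w ^ 2 := by rw [← map_mul, hv2, map_add, map_pow]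
    have h3 : (g x)⁻¹ * (g w / g x) + (g w / g x) ^ 2 = g v / g x := by
      field_simp
      rw [this]
      ring
    rw [h3]
    exact ih v hv1
end Tw

section Cover
variable {k B I Ω G : Type} [Field k] [CharP k 2] [CommRing B] [IsDomain B] [Algebra k[X] B]
  [Algebra k B] [IsScalarTower k k[X] B] [Fintype I] [Field Ω] [IsAlgClosed Ω] [Algebra k Ω]
  [Group G] [Fintype G] [MulSemiringAction G B] [SMulCommClass G k[X] B]
  [Algebra.IsInvariant k[X] B G] [FaithfulSMul G B] [Algebra F2 Ω] [Algebra.IsAlgebraic F2 Ω]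

/-- `σ` acts on torsion through the polynomial `F` -/
def compat (x : B) (Λ M : Finset B) (σ : G) (F : F2[X]) : Prop :=
  (∀ z ∈ Λ, σ • z = carl x F z) ∧
  (∀ w ∈ M, algebraMap B (FractionRing B) (σ • w) / algebraMap B (FractionRing B) x =
    carl (algebraMap B (FractionRing B) x)⁻¹ F.reverse
      (algebraMap B (FractionRing B) w / algebraMap B (FractionRing B) x))

lemma compat_unique [CharP B 2] (x : B) (hx : x ≠ 0) (s : F2[X]) (hs : s ≠ 0) (κ : ℕ) (Λ M : Finset B)
    (hΛ : ∀ z, z ∈ Λ ↔ carl x s z = 0) (hM : ∀ w, w ∈ M ↔ tw x κ w)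
    (hΛc : Λ.card = 2 ^ s.natDegree) (hMc : M.card = 2 ^ κ) (σ : G) (F F' : F2[X])
    (h : compat x Λ M σ F) (h' : compat x Λ M σ F') :
    s ∣ F - F' ∧ X ^ κ ∣ F.reverse - F'.reverse := by
  have hinj : Function.Injective (algebraMap B (FractionRing B)) := IsFractionRing.injective B (FractionRing B)
  have hx' : algebraMap B (FractionRing B) x ≠ 0 := by
    rwa [Ne, map_eq_zero_iff _ hinj]
  haveI : CharP (FractionRing B) 2 := charP_of_injective_ringHom hinj 2
  constructor
  · refine dvd_of_carl x s hs Λ (fun z hz => (hΛ z).1 hz) hΛc.ge F F' fun z hz => ?_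
    rw [← h.1 z hz, ← h'.1 z hz]
  · refine dvd_of_carl (algebraMap B (FractionRing B) x)⁻¹ (X ^ κ) (pow_ne_zero _ X_ne_zero)
      (M.image fun w => algebraMap B (FractionRing B) w / algebraMap B (FractionRing B) x) ?_ ?_ _ _ ?_
    · intro z hz
      obtain ⟨w, hw, rfl⟩ := Finset.mem_image.1 hz
      exact tw_carl_zero _ x hx' κ w ((hM w).1 hw)
    · rw [Finset.card_image_of_injective, hMc, natDegree_X_pow]
      intro w w' hww
      simp only [div_left_inj' hx'] at hww
      exact hinj hww
    · intro z hz
      obtain ⟨w, hw, rfl⟩ := Finset.mem_image.1 hz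
      rw [← h.2 w hw, ← h'.2 w hw]

lemma compat_one [CharP B 2] (x : B) (Λ M : Finset B) : compat x Λ M (1 : G) 1 := by
  have h1 : ∀ {S : Type} [CommRing S] (x z : S), carl x 1 z = z := by
    intro S _ x z
    rw [carl, show (1 : F2[X]) = X ^ 0 by simp, support_X_pow (R := F2), Finset.sum_singleton]
    simp
  have h2 : (1 : F2[X]).reverse = 1 := by
    rw [← C_1]; exact reverse_C _
  refine ⟨fun z _ => by rw [h1, one_smul], fun w _ => by rw [h2, h1, one_smul]⟩

lemma compat_frob [CharP B 2] (x : B) (s : F2[X]) (κ : ℕ) (Λ M : Finset B)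
    (hΛ : ∀ z, z ∈ Λ ↔ carl x s z = 0) (hM : ∀ w, w ∈ M ↔ tw x κ w)
    (P : B →+* Ω) (σ : G) (hσx : ∀ τ : G, τ • x = x) (n : ℕ) (hx : P x ^ (2 ^ n) = P x) (hP : ∀ z, P z ^ (2 ^ n) = P (σ • z))
    (h0 : P x ≠ 0) (hPΛ : ∀ z ∈ Λ, z ≠ 0 → P z ≠ 0) (hPM : ∀ z ∈ M, z ≠ 0 → P z ≠ 0) :
    compat x Λ M σ (Fc n (P x)) := by
  haveI : CharP Ω 2 := charP_of_F2
  have hcast : ZMod.castHom (dvd_refl 2) Ω = algebraMap F2 Ω := Subsingleton.elim _ _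
  have hF := Fc_map n (P x) hx
  have hF' := Fc_rev_map n (P x) hx h0
  rw [← hcast] at hF hF'
  have hinj : Function.Injective (algebraMap B (FractionRing B)) := IsFractionRing.injective B (FractionRing B)
  have hx0 : x ≠ 0 := fun h => h0 (by rw [h, map_zero])
  have hx' : algebraMap B (FractionRing B) x ≠ 0 := by
    rwa [Ne, map_eq_zero_iff _ hinj]
  have hact : ∀ τ : G, τ • x = MulSemiringAction.toRingHom G B τ x := fun _ => rfl
  constructor
  · intro z hz
    by_contra hne
    have hz' := (hΛ z).1 hz
    have h1 : carl x s (σ • z) = 0 := by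
      have := carl_map (MulSemiringAction.toRingHom G B σ) x s z
      rw [hz', map_zero] at this
      rw [show MulSemiringAction.toRingHom G B σ x = x from hσx σ] at this
      exact this.symm
    have h2 : carl x s (carl x (Fc n (P x)) z) = 0 := by
      rw [← carl_mul, mul_comm, carl_mul, hz', carl_zero_arg]
    have h3 : σ • z + carl x (Fc n (P x)) z ∈ Λ := by
      rw [hΛ, carl_add_arg, h1, h2, add_zero]
    refine hPΛ _ h3 ?_ ?_
    · intro h; exact hne (CharTwo.add_eq_zero.1 h)
    · rw [map_add, ← hP, carl_map, carl_frob (P x) n _ hF, CharTwo.add_self_eq_zero]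
  · intro w hw
    have hw' := (hM w).1 hw
    obtain ⟨v, hv1, hv2⟩ := tw_carl x κ (Fc n (P x)).reverse w hw'
    rw [hv2 _ (algebraMap B (FractionRing B)) hx']
    congr 2
    by_contra hne
    have h1 : tw x κ (σ • w) := by
      have := tw_map (MulSemiringAction.toRingHom G B σ) x κ w hw'
      rw [show MulSemiringAction.toRingHom G B σ x = x from hσx σ] at this
      exact this
    have h3 : σ • w + v ∈ M := by
      rw [hM]; exact tw_add x κ _ _ h1 hv1
    refine hPM _ h3 ?_ ?_
    · intro h; exact hne (CharTwo.add_eq_zero.1 h)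
    · have h4 := hv2 Ω P h0
      rw [carl_frob (P x)⁻¹ n _ hF', div_pow, hx, div_left_inj' h0, hP] at h4
      rw [map_add, h4, CharTwo.add_self_eq_zero]

lemma card_bad (D : k[X]) (hD : D ≠ 0) (A : Finset Ω) :
    (A.filter (fun c => ¬ aeval c D ≠ 0)).card ≤ D.natDegree := by
  have h3 : A.filter (fun c => ¬ aeval c D ≠ 0) ⊆ (D.map (algebraMap k Ω)).roots.toFinset := by
    intro c hc
    rw [Finset.mem_filter, not_not] at hc
    rw [Multiset.mem_toFinset, mem_roots (Polynomial.map_ne_zero hD), IsRoot, eval_map_algebraMap]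
    exact hc.2
  refine (Finset.card_le_card h3).trans ((Multiset.toFinset_card_le _).trans ((card_roots' _).trans ?_))
  exact natDegree_map_le

theorem equidist_of_cover (r : ℕ) (hr : 0 < r) (hk : ∀ a : k, a ^ (2 ^ r) = a)
    (b : Module.Basis I k[X] B) (ι : B →+* PowerSeries k)
    (hinj : Function.Injective ι)
    (hι : ∀ p : k[X], ι (algebraMap k[X] B p) = (p : PowerSeries k)) (c : k)
    (s : F2[X]) (hs : s ≠ 0) (κ : ℕ) (Λ M : Finset B)
    (hΛ : ∀ z, z ∈ Λ ↔ carl (algebraMap k[X] B (X + C c)) s z = 0)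
    (hM : ∀ w, w ∈ M ↔ tw (algebraMap k[X] B (X + C c)) κ w)
    (hΛc : Λ.card = 2 ^ s.natDegree) (hMc : M.card = 2 ^ κ) :
    ∃ (a : G → F2[X]) (K j0 : ℕ), (s ∣ a 1 - 1 ∧ X ^ κ ∣ (a 1).reverse - 1) ∧
    ∀ j, j0 ≤ j → ∀ Φ : F2[X] → ℂ, (∀ f, ‖Φ f‖ ≤ 1) →
      (∀ f f', s ∣ f - f' → X ^ κ ∣ f.reverse - f'.reverse → Φ f = Φ f') →
      ‖∑ z ∈ fixQ Ω (2 ^ (r * j) * 2 ^ (r * j)), Φ (Fc (r * j + r * j) z) -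
        (2 ^ (r * j) * 2 ^ (r * j)) * ((∑ g : G, Φ (a g)) / Fintype.card G)‖ ≤ K * 2 ^ (r * j) := by
  haveI : CharP Ω 2 := charP_of_F2
  have hkB : Function.Injective (algebraMap k B) := (algebraMap k B).injective
  haveI : CharP B 2 := charP_of_injective_algebraMap hkB 2
  set x := algebraMap k[X] B (X + C c) with hxdef
  have hBinj : Function.Injective (algebraMap k[X] B) := by
    intro p q hpq
    have := congrArg ι hpq
    rw [hι, hι] at this
    exact Polynomial.coe_injective _ this
  have hx0 : x ≠ 0 := by
    rw [hxdef, Ne, map_eq_zero_iff _ hBinj]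
    exact X_add_C_ne_zero c
  have hσx : ∀ τ : G, τ • x = x := fun τ => smul_algebraMap τ _
  let W : Finset B := Λ.erase 0 ∪ M.erase 0 ∪ {x}
  have hW : ∀ w ∈ W, w ≠ 0 := by
    intro w hw
    simp only [W, Finset.mem_union, Finset.mem_erase, Finset.mem_singleton] at hw
    rcases hw with (h | h) | h
    · exact h.1
    · exact h.1
    · rw [h]; exact hx0
  obtain ⟨D, K, e0, hD, hch⟩ := chebotarev (Ω := Ω) (G := G) b ι hinj hι W hW
  have hkj : ∀ j (a : k), a ^ (2 ^ (r * j) * 2 ^ (r * j)) = a := by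
    have h1 : ∀ j (a : k), a ^ (2 ^ (r * j)) = a := by
      intro j a
      induction j with
      | zero => simp
      | succ j ih => rw [mul_add, mul_one, pow_add, pow_mul, ih, hk]
    intro j a
    rw [pow_mul, h1, h1]
  set cΩ := algebraMap k Ω c with hcΩ
  have hstep : ∀ j, e0 ≤ j → 0 < j → ∃ Fr : Ω → G → G,
      (∀ z ∈ fixQ Ω (2 ^ (r * j) * 2 ^ (r * j)), aeval z D ≠ 0 → ∀ g,
        compat x Λ M (Fr z g) (Fc (r * j + r * j) (z + cΩ))) ∧
      ∀ τ : G, |((((((fixQ Ω (2 ^ (r * j) * 2 ^ (r * j))).filter (fun c => aeval c D ≠ 0)) ×ˢ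
          (Finset.univ : Finset G)).filter (fun x => Fr x.1 x.2 = τ)).card : ℝ)) - (2 ^ (r * j) * 2 ^ (r * j) : ℝ)|
          ≤ K * 2 ^ (r * j) := by
    intro j hj hj0
    have he : 0 < r * j := Nat.mul_pos hr hj0
    obtain ⟨Pt, Fr, h1, h2⟩ := hch (r * j) (hj.trans (Nat.le_mul_of_pos_left j hr)) he (hkj j)
    refine ⟨Fr, ?_, h2⟩
    intro z hz hzD g
    obtain ⟨p1, p2, p3⟩ := h1 z hz hzD g
    have hQ1 : 1 < 2 ^ (r * j) * 2 ^ (r * j) := by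
      have : 1 < 2 ^ (r * j) := Nat.one_lt_two_pow he.ne'
      nlinarith
    rw [mem_fixQ _ hQ1] at hz
    have hPx : Pt z g x = z + cΩ := by
      have : algebraMap k[X] B (C c) = algebraMap k B c := by
        rw [IsScalarTower.algebraMap_apply k k[X] B]; rfl
      rw [hxdef, map_add, map_add, p1, this, AlgHom.commutes]
    rw [← hPx]
    refine compat_frob x s κ Λ M hΛ hM (Pt z g : B →+* Ω) (Fr z g) hσx (r * j + r * j) ?_ ?_ ?_ ?_ ?_
    · show Pt z g x ^ _ = Pt z g x
      rw [hPx, add_pow_char_pow, pow_add, hz, hcΩ, ← map_pow, hkj]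
    · intro y
      rw [pow_add]; exact p2 y
    · exact p3 x (by simp [W])
    · intro y hy hy0
      exact p3 y (by simp [W, hy, hy0])
    · intro y hy hy0
      exact p3 y (by simp [W, hy, hy0])
  -- choose representatives
  have hrep : ∀ τ : G, ∃ F : F2[X], compat x Λ M τ F := by
    obtain ⟨Fr, h1, h2⟩ := hstep (e0 + K + 1) (by omega) (by omega)
    intro τ
    have h3 := h2 τ
    have hpos : (0:ℝ) < ((((fixQ Ω (2 ^ (r * (e0 + K + 1)) * 2 ^ (r * (e0 + K + 1)))).filter (fun c => aeval c D ≠ 0)) ×ˢ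
          (Finset.univ : Finset G)).filter (fun x => Fr x.1 x.2 = τ)).card := by
      rw [abs_le] at h3
      have h4 : (K : ℝ) < 2 ^ (r * (e0 + K + 1)) := by
        have : K < 2 ^ (r * (e0 + K + 1)) := by
          refine lt_of_lt_of_le (Nat.lt_two_pow_self) (Nat.pow_le_pow_right (by norm_num) ?_)
          calc K ≤ e0 + K + 1 := by omega
            _ ≤ _ := Nat.le_mul_of_pos_left _ hr
        exact_mod_cast this
      have h5 : (0:ℝ) < 2 ^ (r * (e0 + K + 1)) := by positivity
      nlinarith [h3.1]
    have := Finset.card_pos.1 (Nat.cast_pos.1 hpos)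
    obtain ⟨⟨z, g⟩, hzg⟩ := this
    rw [Finset.mem_filter, Finset.mem_product, Finset.mem_filter] at hzg
    have h9 := h1 z hzg.1.1.1 hzg.1.1.2 g
    have h10 : Fr z g = τ := hzg.2
    rw [h10] at h9
    exact ⟨_, h9⟩
  choose a ha using hrep
  have hone : (1 : F2[X]).reverse = 1 := by
    rw [← C_1]; exact reverse_C _
  refine ⟨a, D.natDegree + K, e0 + 1, ?_, ?_⟩
  · have := compat_unique x hx0 s hs κ Λ M hΛ hM hΛc hMc 1 (a 1) 1 (ha 1) (compat_one x Λ M)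
    rwa [hone] at this
  intro j hj Φ hΦ hcl
  obtain ⟨Fr, h1, h2⟩ := hstep j (by omega) (by omega)
  have he : 0 < r * j := Nat.mul_pos hr (by omega)
  have hQ1 : 1 < 2 ^ (r * j) * 2 ^ (r * j) := by
    have : 1 < 2 ^ (r * j) := Nat.one_lt_two_pow he.ne'
    nlinarith
  have hsq : 2 ^ (r * j) * 2 ^ (r * j) = 2 ^ (r * j + r * j) := by rw [pow_add]
  set A := fixQ Ω (2 ^ (r * j) * 2 ^ (r * j)) with hA
  have hmem : ∀ z : Ω, z + cΩ ∈ A ↔ z ∈ A := by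
    intro z
    rw [hA, mem_fixQ _ hQ1, mem_fixQ _ hQ1]
    have h6 : cΩ ^ (2 ^ (r * j) * 2 ^ (r * j)) = cΩ := by rw [hcΩ, ← map_pow, hkj]
    have h7 : (z + cΩ) ^ (2 ^ (r * j) * 2 ^ (r * j)) = z ^ (2 ^ (r * j) * 2 ^ (r * j)) + cΩ := by
      rw [hsq, add_pow_char_pow, ← hsq, h6]
    rw [h7, add_left_inj]
  have hshift : ∑ z ∈ A, Φ (Fc (r * j + r * j) z) = ∑ z ∈ A, Φ (Fc (r * j + r * j) (z + cΩ)) := by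
    symm
    refine Finset.sum_bij (fun z _ => z + cΩ) (fun z hz => (hmem z).2 hz)
      (fun z _ z' _ h => add_right_cancel h) (fun z hz => ⟨z + cΩ, (hmem z).2 hz, ?_⟩) (fun z _ => rfl)
    rw [add_assoc, CharTwo.add_self_eq_zero, add_zero]
  set n := r * j + r * j with hn
  set good := A.filter (fun c => aeval c D ≠ 0) with hgood
  have hsplit : ∑ z ∈ A, Φ (Fc n (z + cΩ)) = ∑ z ∈ good, Φ (Fc n (z + cΩ)) +
      ∑ z ∈ A.filter (fun c => ¬ aeval c D ≠ 0), Φ (Fc n (z + cΩ)) := by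
    rw [hgood]
    exact (Finset.sum_filter_add_sum_filter_not _ _ _).symm
  have hGpos : (0:ℝ) < Fintype.card G := by exact_mod_cast Fintype.card_pos
  have hG0 : (Fintype.card G : ℂ) ≠ 0 := by exact_mod_cast hGpos.ne'
  have hgd : (Fintype.card G : ℂ) * ∑ z ∈ good, Φ (Fc n (z + cΩ)) =
      ∑ τ : G, (((good ×ˢ (Finset.univ : Finset G)).filter (fun x => Fr x.1 x.2 = τ)).card : ℂ) * Φ (a τ) := by
    have e1 : ∀ y ∈ good ×ˢ (Finset.univ : Finset G), Φ (Fc n (y.1 + cΩ)) = Φ (a (Fr y.1 y.2)) := by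
      intro y hy
      rw [Finset.mem_product, hgood, Finset.mem_filter] at hy
      have hu := compat_unique x hx0 s hs κ Λ M hΛ hM hΛc hMc _ _ _ (h1 y.1 hy.1.1 hy.1.2 y.2) (ha (Fr y.1 y.2))
      exact hcl _ _ hu.1 hu.2
    calc (Fintype.card G : ℂ) * ∑ z ∈ good, Φ (Fc n (z + cΩ))
        = ∑ y ∈ good ×ˢ (Finset.univ : Finset G), Φ (Fc n (y.1 + cΩ)) := by
          rw [Finset.sum_product, Finset.mul_sum]
          simp
      _ = ∑ y ∈ good ×ˢ (Finset.univ : Finset G), Φ (a (Fr y.1 y.2)) := Finset.sum_congr rfl e1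
      _ = _ := by
          rw [← Finset.sum_fiberwise_of_maps_to (s := good ×ˢ (Finset.univ : Finset G)) (t := Finset.univ) (g := fun y => Fr y.1 y.2) (fun _ _ => Finset.mem_univ _)]
          refine Finset.sum_congr rfl fun τ _ => ?_
          rw [Finset.sum_congr rfl (g := fun _ => Φ (a τ)) (fun y hy => by rw [(Finset.mem_filter.1 hy).2])]
          rw [Finset.sum_const, nsmul_eq_mul]
  have hgd' : ∑ z ∈ good, Φ (Fc n (z + cΩ)) - (2 ^ (r * j) * 2 ^ (r * j)) * ((∑ g : G, Φ (a g)) / Fintype.card G) =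
      (∑ τ : G, ((((good ×ˢ (Finset.univ : Finset G)).filter (fun x => Fr x.1 x.2 = τ)).card : ℂ) - (2 ^ (r * j) * 2 ^ (r * j))) * Φ (a τ)) / Fintype.card G := by
    rw [eq_div_iff hG0, sub_mul, mul_comm, hgd]
    simp only [sub_mul, Finset.sum_sub_distrib, ← Finset.mul_sum]
    field_simp
  have hb1 : ‖∑ z ∈ good, Φ (Fc n (z + cΩ)) - (2 ^ (r * j) * 2 ^ (r * j)) * ((∑ g : G, Φ (a g)) / Fintype.card G)‖ ≤ K * 2 ^ (r * j) := by
    rw [hgd', norm_div]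
    have : ‖(Fintype.card G : ℂ)‖ = Fintype.card G := by simp
    rw [this, div_le_iff₀ hGpos]
    refine (norm_sum_le _ _).trans ?_
    refine (Finset.sum_le_card_nsmul _ _ ((K:ℝ) * 2 ^ (r * j)) ?_).trans ?_
    · intro τ _
      rw [norm_mul]
      have h8 := h2 τ
      have h9 : ‖(((good ×ˢ (Finset.univ : Finset G)).filter (fun x => Fr x.1 x.2 = τ)).card : ℂ) - (2 ^ (r * j) * 2 ^ (r * j))‖ ≤ K * 2 ^ (r * j) := by
        rw [← Real.norm_eq_abs, ← Complex.norm_real] at h8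
        push_cast at h8
        exact h8
      calc _ ≤ (K * 2 ^ (r * j) : ℝ) * 1 := by
            gcongr
            exact hΦ _
        _ = _ := mul_one _
    · rw [Finset.card_univ, nsmul_eq_mul, mul_comm]
  have hb2 : ‖∑ z ∈ A.filter (fun c => ¬ aeval c D ≠ 0), Φ (Fc n (z + cΩ))‖ ≤ D.natDegree := by
    refine (norm_sum_le _ _).trans ?_
    refine (Finset.sum_le_card_nsmul _ _ 1 (fun _ _ => hΦ _)).trans ?_
    rw [nsmul_eq_mul, mul_one]
    exact_mod_cast card_bad D hD A
  rw [hshift, hsplit, add_sub_right_comm]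
  refine (norm_add_le _ _).trans ((add_le_add hb1 hb2).trans ?_)
  have : (1:ℝ) ≤ 2 ^ (r * j) := one_le_pow₀ (by norm_num)
  push_cast
  nlinarith [Nat.cast_nonneg (α := ℝ) D.natDegree]
end Cover

section Inst
variable {k : Type} [Field k] [CharP k 2]

/-- the final form of equidistribution -/
def Equi (Ω : Type) [Field Ω] [Algebra F2 Ω] [Algebra.IsAlgebraic F2 Ω] (s : F2[X]) (κ : ℕ) : Prop :=
  ∃ (r : ℕ) (G : Type) (_ : Fintype G) (g0 : G) (a : G → F2[X]) (K j0 : ℕ), 0 < r ∧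
    (s ∣ a g0 - 1 ∧ X ^ κ ∣ (a g0).reverse - 1) ∧
    ∀ j, j0 ≤ j → ∀ Φ : F2[X] → ℂ, (∀ f, ‖Φ f‖ ≤ 1) →
      (∀ f f', s ∣ f - f' → X ^ κ ∣ f.reverse - f'.reverse → Φ f = Φ f') →
      ‖∑ z ∈ fixQ Ω (2 ^ (r * j) * 2 ^ (r * j)), Φ (Fc (r * j + r * j) z) -
        (2 ^ (r * j) * 2 ^ (r * j)) * ((∑ g : G, Φ (a g)) / Fintype.card G)‖ ≤ K * 2 ^ (r * j)

lemma carP_sep {L : Type} [Field L] [CharP L 2] (x : L) (a : F2[X]) (h : evz x a ≠ 0) : (carP x a).Separable := by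
  rw [separable_def, deriv_carP]
  exact isCoprime_of_isUnit_right (isUnit_C.2 (IsUnit.mk0 _ h))
where
  isCoprime_of_isUnit_right {R : Type} [CommRing R] {a b : R} (h : IsUnit b) : IsCoprime a b := by
    obtain ⟨u, rfl⟩ := h
    exact ⟨0, ↑u⁻¹, by simp⟩

lemma splits_of_many {L : Type} [Field L] (f : L[X]) (hf : f ≠ 0) (A : Finset L) (hA : ∀ z ∈ A, f.eval z = 0)
    (hc : f.natDegree ≤ A.card) : f.Splits := by
  rw [splits_iff_card_roots]
  apply le_antisymm (card_roots' f)
  refine hc.trans ?_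
  have : A.val ≤ f.roots := by
    rw [Multiset.le_iff_subset A.nodup]
    intro z hz
    rw [mem_roots hf]
    exact hA z hz
  exact Multiset.card_le_card this

theorem tw_of_carl {L : Type} [Field L] [CharP L 2] (x : L) (hx : x ≠ 0) (n : ℕ) (z : L)
    (h : carl x⁻¹ (X ^ n) z = 0) : tw x n (x * z) := by
  rw [carl, support_X_pow (R := F2), Finset.sum_singleton] at h
  induction n generalizing z with
  | zero => simp at h; simp [tw, h]
  | succ n ih =>
    rw [Function.iterate_succ_apply] at h
    refine ⟨_, ih _ h, ?_⟩
    field_simp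

theorem tw_integral {R L : Type} [CommRing R] [Field L] [Algebra R L] [CharP L 2] [Nontrivial R] (x : R)
    (n : ℕ) (w : L) (h : tw (algebraMap R L x) n w) : IsIntegral R w := by
  induction n generalizing w with
  | zero => simp only [tw] at h; rw [h]; exact isIntegral_zero
  | succ n ih =>
    obtain ⟨w', h1, h2⟩ := h
    have h3 := ih w' h1
    have hm : (X ^ 2 + X : R[X]).Monic := by monicity!
    have hd : (X ^ 2 + X : R[X]).natDegree ≠ 0 := by
      have : (X ^ 2 + X : R[X]).natDegree = 2 := by compute_degree!
      omega
    refine IsIntegral.of_aeval_monic hm hd ?_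
    have : aeval w (X ^ 2 + X : R[X]) = algebraMap R L x * w' := by
      rw [h2]; simp; ring
    rw [this]
    exact isIntegral_algebraMap.mul h3

theorem carl_integral {R L : Type} [CommRing R] [CharP R 2] [Nontrivial R] [Field L] [Algebra R L] [CharP L 2] (x : R)
    (s : F2[X]) (hs : s ≠ 0) (w : L) (h : carl (algebraMap R L x) s w = 0) : IsIntegral R w := by
  refine ⟨carP x s, (carP_monic x s hs).1, ?_⟩
  rw [← eval_map, map_carP, eval_carP, h]

lemma carP_splits_series (x : PowerSeries k) (a : F2[X]) (hu : evz (PowerSeries.constantCoeff x) a ≠ 0)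
    (A : Finset k) (hA : A.card = 2 ^ a.natDegree)
    (hA0 : ∀ z ∈ A, carl (PowerSeries.constantCoeff x) a z = 0) :
    (carP (algebraMap (PowerSeries k) (FractionRing (PowerSeries k)) x) a).Splits := by
  have ha : a ≠ 0 := by rintro rfl; simp [evz] at hu
  haveI : CharP (PowerSeries k) 2 := charP_of_injective_algebraMap (algebraMap k (PowerSeries k)).injective 2
  have hinj := IsFractionRing.injective (PowerSeries k) (FractionRing (PowerSeries k))
  haveI : CharP (FractionRing (PowerSeries k)) 2 := charP_of_injective_ringHom hinj 2
  have hm := carP_monic (algebraMap (PowerSeries k) (FractionRing (PowerSeries k)) x) a ha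
  have hy : ∀ z : k, ∃ y : PowerSeries k, z ∈ A → carl x a y = 0 ∧ PowerSeries.constantCoeff y = z := by
    intro z
    by_cases hz : z ∈ A
    · obtain ⟨y, hy⟩ := hensel_carl x a z hu (hA0 z hz)
      exact ⟨y, fun _ => hy⟩
    · exact ⟨0, fun h => absurd h hz⟩
  choose y hy using hy
  refine splits_of_many _ hm.1.ne_zero (A.image fun z => algebraMap _ (FractionRing (PowerSeries k)) (y z)) ?_ ?_
  · intro z hz
    obtain ⟨z0, h0, rfl⟩ := Finset.mem_image.1 hz
    rw [eval_carP, ← carl_map, (hy z0 h0).1, map_zero]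
  · rw [hm.2, Finset.card_image_of_injOn, hA]
    intro z hz z' hz' h
    have := hinj h
    rw [← (hy z hz).2, ← (hy z' hz').2, this]

set_option maxHeartbeats 1000000 in
theorem equi_of_L (Ω : Type) [Field Ω] [IsAlgClosed Ω] [Algebra F2 Ω] [Algebra.IsAlgebraic F2 Ω] [Algebra k Ω]
    (K L : Type) [Field K] [Field L] [Algebra k[X] K] [IsFractionRing k[X] K] [Algebra K L] [Algebra k[X] L]
    [IsScalarTower k[X] K L] [FiniteDimensional K L] [IsGalois K L] [CharP L 2]
    (φ : L →+* FractionRing (PowerSeries k))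
    (hφ : ∀ p : k[X], φ (algebraMap k[X] L p) = algebraMap (PowerSeries k) _ (p : PowerSeries k))
    (r : ℕ) (hr : 0 < r) (hk : ∀ a : k, a ^ (2 ^ r) = a) (c : k) (s : F2[X]) (hs : s ≠ 0) (κ : ℕ)
    (xL : L) (hxL : xL = algebraMap k[X] L (X + C c)) (hxL0 : xL ≠ 0)
    (h1 : (carP xL s).Splits) (h2 : (carP xL⁻¹ (X ^ κ)).Splits)
    (h1s : (carP xL s).Separable) (h2s : (carP xL⁻¹ (X ^ κ)).Separable) : Equi Ω s κ := by
  let B := integralClosure k[X] L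
  letI : Algebra k B := ((algebraMap k[X] B).comp C).toAlgebra
  haveI : IsScalarTower k k[X] B := IsScalarTower.of_algebraMap_eq (fun x => rfl)
  haveI : IsFractionRing B L := integralClosure.isFractionRing_of_finite_extension K L
  haveI : Algebra.IsInvariant k[X] B (B ≃ₐ[k[X]] B) := Algebra.isInvariant_of_isGalois' k[X] K L B
  haveI : CharP B 2 := (RingHom.charP_iff (f := B.val.toRingHom) Subtype.val_injective 2).2 inferInstance
  haveI : Fintype (B ≃ₐ[k[X]] B) := Fintype.ofEquiv Gal(L/K) (galRestrict k[X] K L B).toEquiv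
  haveI : FaithfulSMul k[X] L := by
    rw [faithfulSMul_iff_algebraMap_injective, IsScalarTower.algebraMap_eq k[X] K L]
    exact (algebraMap K L).injective.comp (IsFractionRing.injective k[X] K)
  haveI : Module.IsTorsionFree k[X] L := inferInstance
  haveI : Module.Free k[X] B := IsIntegralClosure.module_free k[X] K L B
  haveI : Module.Finite k[X] B := IsIntegralClosure.finite k[X] K L B
  let b := Module.Free.chooseBasis k[X] B
  have hinjE := IsFractionRing.injective (PowerSeries k) (FractionRing (PowerSeries k))
  have hyint : ∀ z : B, ∃ y : PowerSeries k, algebraMap _ (FractionRing (PowerSeries k)) y = φ z := by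
    intro z
    rw [← IsIntegrallyClosed.isIntegral_iff]
    obtain ⟨q, hq, hq0⟩ := z.2
    refine ⟨q.map Polynomial.coeToPowerSeries.ringHom, hq.map _, ?_⟩
    rw [eval₂_map]
    have : (algebraMap (PowerSeries k) (FractionRing (PowerSeries k))).comp Polynomial.coeToPowerSeries.ringHom
      = φ.comp (algebraMap k[X] L) := by
      apply RingHom.ext; intro p; simp [hφ]
    rw [this, ← hom_eval₂, hq0, map_zero]
  choose ι0 hι0 using hyint
  let ι : B →+* PowerSeries k :=
    { toFun := ι0
      map_one' := hinjE (by rw [hι0]; simp)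
      map_zero' := hinjE (by rw [hι0]; simp)
      map_mul' := fun x y => hinjE (by rw [map_mul, hι0, hι0, hι0]; simp)
      map_add' := fun x y => hinjE (by rw [map_add, hι0, hι0, hι0]; simp) }
  have hιinj : Function.Injective ι := by
    intro x y h
    have h : ι0 x = ι0 y := h
    have := congrArg (algebraMap _ (FractionRing (PowerSeries k))) h
    rw [hι0, hι0] at this
    exact Subtype.ext (φ.injective this)
  have hι : ∀ p : k[X], ι (algebraMap k[X] B p) = (p : PowerSeries k) := by
    intro p
    apply hinjE
    change algebraMap _ (FractionRing (PowerSeries k)) (ι0 _) = _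
    rw [hι0]
    exact hφ p
  have hcar : ∀ (y : B) (a : F2[X]) (z : B), ((carl y a z : B) : L) = carl (y : L) a (z : L) := by
    intro y a z
    exact carl_map B.val.toRingHom y a z
  have hcard : ∀ (y : L) (a : F2[X]), a ≠ 0 → (carP y a).Splits → (carP y a).Separable →
      (carP y a).roots.toFinset.card = 2 ^ a.natDegree := by
    intro y a ha hh hh'
    rw [Multiset.toFinset_card_of_nodup (nodup_roots hh'), ← (carP_monic y a ha).2]
    exact (splits_iff_card_roots.1 hh)
  have hmem : ∀ (y : L) (a : F2[X]), a ≠ 0 → ∀ z, z ∈ (carP y a).roots.toFinset ↔ carl y a z = 0 := by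
    intro y a ha z
    rw [Multiset.mem_toFinset, mem_roots (carP_monic y a ha).1.ne_zero, IsRoot, eval_carP]
  have hXκ : (X ^ κ : F2[X]) ≠ 0 := pow_ne_zero _ X_ne_zero
  have hxB : ((algebraMap k[X] B (X + C c) : B) : L) = xL := hxL.symm
  let e : B → L := fun z => z
  have he : Function.Injective e := Subtype.val_injective
  let Λ0 := (carP xL s).roots.toFinset
  let M0 := (carP xL⁻¹ (X ^ κ)).roots.toFinset.image (fun z => xL * z)
  have hΛ0 : ∀ z ∈ Λ0, z ∈ Set.range e := by
    intro z hz
    have := (hmem _ _ hs z).1 hz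
    rw [hxL] at this
    exact ⟨⟨z, carl_integral _ s hs z this⟩, rfl⟩
  have hM0 : ∀ w, w ∈ M0 ↔ tw xL κ w := by
    intro w
    simp only [M0, Finset.mem_image]
    constructor
    · rintro ⟨z, hz, rfl⟩
      exact tw_of_carl xL hxL0 κ z ((hmem _ _ hXκ z).1 hz)
    · intro h
      refine ⟨w / xL, ?_, by field_simp⟩
      rw [hmem _ _ hXκ]
      exact tw_carl_zero (RingHom.id L) xL hxL0 κ w h
  have hM0r : ∀ w ∈ M0, w ∈ Set.range e := by
    intro w hw
    have := (hM0 w).1 hw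
    rw [hxL] at this
    exact ⟨⟨w, tw_integral _ κ w this⟩, rfl⟩
  have htw : ∀ (n : ℕ) (w : B), tw (algebraMap k[X] B (X + C c)) n w ↔ tw xL n (w : L) := by
    intro n
    induction n with
    | zero => intro w; simp [tw]
    | succ n ih =>
      intro w
      constructor
      · intro h
        have := tw_map B.val.toRingHom _ _ _ h
        rw [hxL]
        exact this
      · rintro ⟨w', h1, h2⟩
        have h3 := h1
        rw [hxL] at h3
        refine ⟨⟨w', tw_integral _ n w' h3⟩, (ih _).2 h1, ?_⟩
        apply Subtype.ext
        rw [hxL] at h2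
        exact h2
  let Λ := Λ0.preimage e he.injOn
  let M := M0.preimage e he.injOn
  obtain ⟨a, Kc, j0, ha, hj⟩ := equidist_of_cover (Ω := Ω) (G := B ≃ₐ[k[X]] B) r hr hk b ι hιinj hι c s hs κ Λ M
    (by
      intro z
      simp only [Λ, Finset.mem_preimage, Λ0]
      rw [hmem _ _ hs]
      simp only [e]
      rw [← hxB, ← hcar]
      exact ZeroMemClass.coe_eq_zero)
    (by
      intro w
      simp only [M, Finset.mem_preimage]
      rw [hM0, htw])
    (by
      simp only [Λ]
      rw [Finset.card_preimage, Finset.filter_true_of_mem hΛ0]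
      exact hcard _ _ hs h1 h1s)
    (by
      simp only [M]
      rw [Finset.card_preimage, Finset.filter_true_of_mem hM0r]
      simp only [M0]
      rw [Finset.card_image_of_injective _ (mul_right_injective₀ hxL0), hcard _ _ hXκ h2 h2s, natDegree_X_pow])
  exact ⟨r, _, inferInstance, 1, a, Kc, j0, hr, ha, hj⟩

set_option maxHeartbeats 1000000 in
theorem equi_of_k (Ω : Type) [Field Ω] [IsAlgClosed Ω] [Algebra F2 Ω] [Algebra.IsAlgebraic F2 Ω] [Algebra k Ω]
    (r : ℕ) (hr : 0 < r) (hk : ∀ a : k, a ^ (2 ^ r) = a) (c : k) (hc : c ≠ 0) (s : F2[X]) (hs : s ≠ 0) (κ : ℕ)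
    (hsc : evz c s ≠ 0) (A1 : Finset k) (hA1 : A1.card = 2 ^ s.natDegree) (hA1' : ∀ z ∈ A1, carl c s z = 0)
    (A2 : Finset k) (hA2 : A2.card = 2 ^ κ) (hA2' : ∀ z ∈ A2, carl c⁻¹ (X ^ κ) z = 0) : Equi Ω s κ := by
  -- the two base fields
  let E := FractionRing (PowerSeries k)
  let K := FractionRing k[X]
  haveI : CharP k[X] 2 := inferInstance
  haveI : CharP (PowerSeries k) 2 := charP_of_injective_algebraMap (algebraMap k (PowerSeries k)).injective 2
  have hinjE : Function.Injective (algebraMap (PowerSeries k) E) := IsFractionRing.injective (PowerSeries k) E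
  have hinjK : Function.Injective (algebraMap k[X] K) := IsFractionRing.injective k[X] K
  haveI : CharP E 2 := charP_of_injective_ringHom hinjE 2
  haveI : CharP K 2 := charP_of_injective_ringHom hinjK 2
  have hcoe : Function.Injective (Polynomial.coeToPowerSeries.ringHom (R := k)) := Polynomial.coe_injective k
  let jK : K →+* E := IsFractionRing.map (A := k[X]) (B := PowerSeries k) (K := K) (L := E) hcoe
  have hjK : ∀ p : k[X], jK (algebraMap k[X] K p) = algebraMap (PowerSeries k) E (p : PowerSeries k) := by
    intro p
    exact IsLocalization.map_eq _ p
  letI : Algebra K E := jK.toAlgebra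
  have hc2 : evz c⁻¹ (X ^ κ) ≠ 0 := by
    rw [evz_X_pow]; exact pow_ne_zero _ (inv_ne_zero hc)
  let x0 : k[X] := X + C c
  let xK : K := algebraMap k[X] K x0
  have hx00 : x0 ≠ 0 := X_add_C_ne_zero c
  have hxK : xK ≠ 0 := by
    simp only [xK]; rwa [Ne, map_eq_zero_iff _ hinjK]
  have hcc : PowerSeries.constantCoeff (x0 : PowerSeries k) = c := by
    simp [x0]
  have hsp1 : (carP (jK xK) s).Splits := by
    simp only [xK]
    rw [hjK]
    refine carP_splits_series _ s ?_ A1 hA1 ?_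
    · rw [hcc]; exact hsc
    · rw [hcc]; exact hA1'
  have hsp2 : (carP (jK xK⁻¹) (X ^ κ)).Splits := by
    have h0 : PowerSeries.constantCoeff (x0 : PowerSeries k) ≠ 0 := by rw [hcc]; exact hc
    have : jK xK⁻¹ = algebraMap (PowerSeries k) E ((x0 : PowerSeries k)⁻¹) := by
      rw [map_inv₀]
      simp only [xK]
      rw [hjK]
      exact inv_eq_of_mul_eq_one_right (by rw [← map_mul, PowerSeries.mul_inv_cancel _ h0, map_one])
    rw [this]
    refine carP_splits_series _ _ ?_ A2 ?_ ?_
    · rw [PowerSeries.constantCoeff_inv, hcc]; exact hc2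
    · rw [natDegree_X_pow]; exact hA2
    · rw [PowerSeries.constantCoeff_inv, hcc]; exact hA2'
  let p : K[X] := carP xK s * carP xK⁻¹ (X ^ κ)
  have hXκ : (X ^ κ : F2[X]) ≠ 0 := pow_ne_zero _ X_ne_zero
  have hp0 : p ≠ 0 := mul_ne_zero (carP_monic _ _ hs).1.ne_zero (carP_monic _ _ hXκ).1.ne_zero
  have hpE : (p.map (algebraMap K E)).Splits := by
    have : p.map (algebraMap K E) = carP (jK xK) s * carP (jK xK⁻¹) (X ^ κ) := by
      simp only [p]
      rw [Polynomial.map_mul, map_carP, map_carP]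
      rfl
    rw [this]
    exact hsp1.mul hsp2
  have hevK : evz xK s ≠ 0 := by
    intro h
    have h1 := congrArg jK h
    rw [evz_map, map_zero] at h1
    simp only [xK] at h1
    rw [hjK, ← evz_map, map_eq_zero_iff _ hinjE] at h1
    have h2 := congrArg PowerSeries.constantCoeff h1
    rw [evz_map, map_zero, hcc] at h2
    exact hsc h2
  have hevK2 : evz xK⁻¹ (X ^ κ) ≠ 0 := by
    rw [evz_X_pow]; exact pow_ne_zero _ (inv_ne_zero hxK)
  have hsep1 := carP_sep xK s hevK
  have hsep2 := carP_sep xK⁻¹ (X ^ κ) hevK2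
  let L := p.SplittingField
  let φ : L →ₐ[K] E := SplittingField.lift p hpE
  haveI : Algebra.IsSeparable K L := by
    have hadj : IntermediateField.adjoin K (p.rootSet L) = ⊤ := by
      apply IntermediateField.toSubalgebra_injective
      rw [IntermediateField.top_toSubalgebra, eq_top_iff, ← SplittingField.adjoin_rootSet p]
      exact IntermediateField.algebra_adjoin_le_adjoin K _
    have : Algebra.IsSeparable K (IntermediateField.adjoin K (p.rootSet L)) := by
      rw [IntermediateField.isSeparable_adjoin_iff_isSeparable]
      intro z hz
      have hz0 := (mem_rootSet.1 hz).2
      simp only [p, map_mul, mul_eq_zero] at hz0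
      rcases hz0 with h | h
      · exact hsep1.of_dvd (minpoly.dvd K z h)
      · exact hsep2.of_dvd (minpoly.dvd K z h)
    rw [hadj] at this
    exact Algebra.IsSeparable.of_algHom K _ (IntermediateField.topEquiv (F := K) (E := L)).symm.toAlgHom
  haveI : Normal K L := Normal.of_isSplittingField p
  haveI : IsGalois K L := {}
  haveI : CharP L 2 := charP_of_injective_algebraMap (algebraMap K L).injective 2
  have hpL : (p.map (algebraMap K L)).Splits := SplittingField.splits p
  have hpL' : p.map (algebraMap K L) = carP (algebraMap K L xK) s * carP (algebraMap K L xK)⁻¹ (X ^ κ) := by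
    simp only [p]
    rw [Polynomial.map_mul, map_carP, map_carP, map_inv₀]
  have hpL0 : p.map (algebraMap K L) ≠ 0 := by rwa [Ne, Polynomial.map_eq_zero]
  have hm1 : carP (algebraMap K L xK) s = (carP xK s).map (algebraMap K L) := (map_carP _ _ _).symm
  have hm2 : carP (algebraMap K L xK)⁻¹ (X ^ κ) = (carP xK⁻¹ (X ^ κ)).map (algebraMap K L) := by
    rw [map_carP, map_inv₀]
  refine equi_of_L Ω K L φ.toRingHom ?_ r hr hk c s hs κ (algebraMap K L xK) ?_ ?_ ?_ ?_ ?_ ?_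
  · intro q
    rw [IsScalarTower.algebraMap_apply k[X] K L]
    change φ (algebraMap K L _) = _
    rw [AlgHom.commutes]
    exact hjK q
  · rw [IsScalarTower.algebraMap_apply k[X] K L]
  · rwa [Ne, map_eq_zero]
  · exact hpL.of_dvd hpL0 (by rw [hpL']; exact dvd_mul_right _ _)
  · exact hpL.of_dvd hpL0 (by rw [hpL']; exact dvd_mul_left _ _)
  · rw [hm1]; exact hsep1.map
  · rw [hm2]; exact hsep2.map
end Inst

set_option maxHeartbeats 1000000 in
theorem equidist (Ω : Type) [Field Ω] [IsAlgClosed Ω] [Algebra F2 Ω] [Algebra.IsAlgebraic F2 Ω]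
    (s : F2[X]) (hs : s ≠ 0) (κ : ℕ) : Equi Ω s κ := by
  haveI : CharP Ω 2 := charP_of_F2
  haveI : Infinite Ω := inferInstance
  have hXκ : (X ^ κ : F2[X]) ≠ 0 := pow_ne_zero _ X_ne_zero
  obtain ⟨c, hc⟩ : ∃ c : Ω, c ≠ 0 ∧ evz c s ≠ 0 := by
    let P : Polynomial Ω := ∑ i ∈ s.support, X ^ i
    have hP : P ≠ 0 := by
      intro h
      have := congrArg (fun q => q.coeff s.natDegree) h
      simp only [P, finset_sum_coeff, coeff_X_pow, coeff_zero] at this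
      rw [Finset.sum_ite_eq, if_pos (natDegree_mem_support_of_nonzero hs)] at this
      exact one_ne_zero this
    obtain ⟨c, hc⟩ := Infinite.exists_notMem_finset (insert 0 P.roots.toFinset)
    simp only [Finset.mem_insert, Multiset.mem_toFinset, mem_roots hP, not_or, IsRoot] at hc
    refine ⟨c, hc.1, fun h => hc.2 ?_⟩
    simp only [P, eval_finset_sum, eval_pow, eval_X]
    exact h
  obtain ⟨hc0, hcs⟩ := hc
  have hc2 : evz c⁻¹ (X ^ κ) ≠ 0 := by
    rw [evz_X_pow]; exact pow_ne_zero _ (inv_ne_zero hc0)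
  have hcard : ∀ (y : Ω) (a : F2[X]), a ≠ 0 → (carP y a).Separable →
      (carP y a).roots.toFinset.card = 2 ^ a.natDegree := by
    intro y a ha hh'
    rw [Multiset.toFinset_card_of_nodup (nodup_roots hh'), ← (carP_monic y a ha).2]
    exact (splits_iff_card_roots.1 (IsAlgClosed.splits _))
  have hmem : ∀ (y : Ω) (a : F2[X]), a ≠ 0 → ∀ z, z ∈ (carP y a).roots.toFinset ↔ carl y a z = 0 := by
    intro y a ha z
    rw [Multiset.mem_toFinset, mem_roots (carP_monic y a ha).1.ne_zero, IsRoot, eval_carP]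
  let R1 := (carP c s).roots.toFinset
  let R2 := (carP c⁻¹ (X ^ κ)).roots.toFinset
  let S : Finset Ω := insert c (R1 ∪ R2)
  let k := IntermediateField.adjoin F2 (S : Set Ω)
  haveI : FiniteDimensional F2 k := IntermediateField.finiteDimensional_adjoin (fun x _ => isInt x)
  haveI : Finite k := Module.finite_of_finite F2
  letI : Fintype k := Fintype.ofFinite k
  haveI : CharP k 2 := charP_of_F2
  obtain ⟨n, hn, hq⟩ := FiniteField.card k 2
  have hS : ∀ z ∈ S, z ∈ k := fun z hz => IntermediateField.subset_adjoin F2 _ hz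
  let e : k → Ω := fun z => z
  have he : Function.Injective e := Subtype.val_injective
  have hcc : ∀ (y : k) (a : F2[X]) (z : k), ((carl y a z : k) : Ω) = carl (y : Ω) a (z : Ω) := by
    intro y a z
    exact carl_map k.val.toRingHom y a z
  let c' : k := ⟨c, hS c (Finset.mem_insert_self _ _)⟩
  refine equi_of_k (k := k) Ω n n.pos ?_ c' ?_ s hs κ ?_ (R1.preimage e he.injOn) ?_ ?_ (R2.preimage e he.injOn) ?_ ?_
  · intro a
    have := FiniteField.pow_card a
    rwa [hq] at this
  · intro h
    exact hc0 (congrArg Subtype.val h)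
  · intro h
    have := congrArg k.val.toRingHom h
    rw [evz_map, map_zero] at this
    exact hcs this
  · rw [Finset.card_preimage, Finset.filter_true_of_mem]
    · exact hcard _ _ hs (carP_sep c s hcs)
    · intro z hz
      exact ⟨⟨z, hS z (Finset.mem_insert_of_mem (Finset.mem_union_left _ hz))⟩, rfl⟩
  · intro z hz
    rw [Finset.mem_preimage, hmem _ _ hs] at hz
    apply Subtype.ext
    rw [hcc]
    exact hz
  · rw [Finset.card_preimage, Finset.filter_true_of_mem]
    · have := hcard _ _ hXκ (carP_sep c⁻¹ (X ^ κ) hc2)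
      rw [natDegree_X_pow] at this
      exact this
    · intro z hz
      exact ⟨⟨z, hS z (Finset.mem_insert_of_mem (Finset.mem_union_right _ hz))⟩, rfl⟩
  · intro z hz
    rw [Finset.mem_preimage, hmem _ _ hXκ] at hz
    apply Subtype.ext
    rw [hcc]
    exact hz

lemma mem_GN {N : ℕ} {f : F2[X]} : f ∈ GN N ↔ f.degree < N := by
  simp [GN]

/-- polynomials of degree exactly `n` -/
def Mon (n : ℕ) : Finset F2[X] := (GN (n + 1)).filter (fun f => f.degree = n)

lemma mem_Mon {n : ℕ} {f : F2[X]} : f ∈ Mon n ↔ f.degree = n := by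
  simp only [Mon, Finset.mem_filter, mem_GN]
  constructor
  · exact fun h => h.2
  · intro h
    refine ⟨?_, h⟩
    rw [h]; exact_mod_cast Nat.lt_succ_self n

lemma mem_Mon' {n : ℕ} {f : F2[X]} : f ∈ Mon n ↔ f ≠ 0 ∧ f.natDegree = n := by
  rw [mem_Mon]
  constructor
  · intro h
    have : f ≠ 0 := by rintro rfl; simp at h
    exact ⟨this, natDegree_eq_of_degree_eq_some h⟩
  · rintro ⟨h, rfl⟩
    exact degree_eq_natDegree h

lemma monic_F2 {f : F2[X]} (h : f ≠ 0) : f.Monic := by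
  have h1 : f.leadingCoeff ≠ 0 := leadingCoeff_ne_zero.2 h
  unfold Monic
  generalize f.leadingCoeff = a at h1
  revert a; decide

section Euler
variable {Ω : Type} [Field Ω] [IsAlgClosed Ω] [Algebra F2 Ω] [Algebra.IsAlgebraic F2 Ω]

lemma minpoly_pow_dvd (c : Ω) (t : ℕ) (f : F2[X]) (hf : f ≠ 0) :
    minpoly F2 c ^ t ∣ f ↔ t ≤ (f.map (algebraMap F2 Ω)).rootMultiplicity c := by
  have hinj : Function.Injective (algebraMap F2 Ω) := (algebraMap F2 Ω).injective
  have hm0 : minpoly F2 c ≠ 0 := minpoly.ne_zero (isInt c)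
  have hm1 : ((minpoly F2 c).map (algebraMap F2 Ω)).rootMultiplicity c = 1 := by
    have hsep : ((minpoly F2 c).map (algebraMap F2 Ω)).Separable :=
      (PerfectField.separable_of_irreducible (minpoly.irreducible (isInt c))).map
    apply le_antisymm
    · exact rootMultiplicity_le_one_of_separable hsep c
    · rw [Nat.one_le_iff_ne_zero, ← pos_iff_ne_zero, rootMultiplicity_pos (by rwa [Ne, Polynomial.map_eq_zero])]
      rw [IsRoot, eval_map_algebraMap, minpoly.aeval]
  induction t generalizing f with
  | zero => simp
  | succ t ih =>
    have hstep : ∀ g : F2[X], g ≠ 0 → ((minpoly F2 c * g).map (algebraMap F2 Ω)).rootMultiplicity c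
        = 1 + (g.map (algebraMap F2 Ω)).rootMultiplicity c := by
      intro g hg
      rw [Polynomial.map_mul, rootMultiplicity_mul, hm1]
      rw [← Polynomial.map_mul, Ne, Polynomial.map_eq_zero]
      exact mul_ne_zero hm0 hg
    constructor
    · rintro ⟨g, rfl⟩
      have hg : minpoly F2 c ^ t * g ≠ 0 := by
        intro h; apply hf; rw [pow_succ', mul_assoc, h, mul_zero]
      rw [pow_succ', mul_assoc, hstep _ hg]
      have := (ih _ hg).1 (dvd_mul_right _ _)
      omega
    · intro h
      have h1 : minpoly F2 c ∣ f := by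
        rw [minpoly.dvd_iff, ← eval_map_algebraMap]
        have : 0 < (f.map (algebraMap F2 Ω)).rootMultiplicity c := by omega
        rwa [rootMultiplicity_pos (by rwa [Ne, Polynomial.map_eq_zero])] at this
      obtain ⟨g, rfl⟩ := h1
      have hg : g ≠ 0 := right_ne_zero_of_mul hf
      rw [hstep g hg] at h
      rw [pow_succ']
      exact mul_dvd_mul_left _ ((ih g hg).2 (by omega))

lemma count_Fc (n : ℕ) (f : F2[X]) (hf : f ∈ Mon n) :
    ∑ j ∈ Finset.Icc 1 n, ((fixQ Ω (2 ^ j)).filter (fun c => Fc j c ∣ f)).card = n := by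
  obtain ⟨hf0, hn⟩ := mem_Mon'.1 hf
  set q := f.map (algebraMap F2 Ω) with hq
  have hq0 : q ≠ 0 := by rwa [hq, Ne, Polynomial.map_eq_zero]
  have h1 : ∀ j ∈ Finset.Icc 1 n, ((fixQ Ω (2 ^ j)).filter (fun c => Fc j c ∣ f)).card =
      ∑ c ∈ q.roots.toFinset, if dg c ∣ j ∧ j / dg c ≤ q.rootMultiplicity c then 1 else 0 := by
    intro j hj
    have hj1 := (Finset.mem_Icc.1 hj).1
    rw [← Finset.card_filter]
    congr 1
    ext c
    rw [Finset.mem_filter, Finset.mem_filter, mem_fixQ _ (Nat.one_lt_two_pow (by omega)), ← dg_dvd_iff, Fc,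
      minpoly_pow_dvd _ _ _ hf0]
    constructor
    · rintro ⟨h1, h2⟩
      refine ⟨?_, h1, h2⟩
      rw [Multiset.mem_toFinset, mem_roots hq0, ← rootMultiplicity_pos hq0]
      have : 0 < j / dg c := Nat.div_pos (Nat.le_of_dvd (by omega) h1) (dg_pos c)
      exact lt_of_lt_of_le this h2
    · rintro ⟨_, h1, h2⟩
      exact ⟨h1, h2⟩
  rw [Finset.sum_congr rfl h1, Finset.sum_comm]
  have h2 : ∀ c ∈ q.roots.toFinset, (∑ j ∈ Finset.Icc 1 n,
      if dg c ∣ j ∧ j / dg c ≤ q.rootMultiplicity c then 1 else 0) = q.roots.count c := by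
    intro c hc
    rw [← Finset.card_filter, count_roots]
    have : (Finset.Icc 1 n).filter (fun j => dg c ∣ j ∧ j / dg c ≤ q.rootMultiplicity c) =
        (Finset.Icc 1 (q.rootMultiplicity c)).image (fun t => dg c * t) := by
      ext j
      have hd := dg_pos c
      simp only [Finset.mem_filter, Finset.mem_Icc, Finset.mem_image]
      constructor
      · rintro ⟨⟨h1, h2⟩, ⟨t, rfl⟩, h3⟩
        rw [Nat.mul_div_cancel_left _ hd] at h3
        refine ⟨t, ⟨?_, h3⟩, rfl⟩
        rcases Nat.eq_zero_or_pos t with h | h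
        · rw [h] at h1; simp at h1
        · exact h
      · rintro ⟨t, ⟨h1, h2⟩, rfl⟩
        have h3 := (minpoly_pow_dvd c t f hf0).2 h2
        have h4 := natDegree_le_of_dvd h3 hf0
        rw [(minpoly.monic (isInt c)).natDegree_pow, hn] at h4
        refine ⟨⟨Nat.mul_pos hd h1, ?_⟩, dvd_mul_right _ _, ?_⟩
        · rw [mul_comm]; exact h4
        · rw [Nat.mul_div_cancel_left _ hd]; exact h2
    rw [this, Finset.card_image_of_injective _ (fun a b h => Nat.eq_of_mul_eq_mul_left (dg_pos c) h)]
    simp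
  rw [Finset.sum_congr rfl h2, Multiset.toFinset_sum_count_eq, ← hn]
  rw [splits_iff_card_roots.1 (IsAlgClosed.splits q), hq, natDegree_map]

/-- sum over monic polynomials -/
def Asum (χ : F2[X] → ℂ) (n : ℕ) : ℂ := ∑ f ∈ Mon n, χ f
/-- prime power sum -/
def psi (Ω : Type) [Field Ω] [Algebra F2 Ω] (χ : F2[X] → ℂ) (n : ℕ) : ℂ :=
  ∑ c ∈ fixQ Ω (2 ^ n), χ (Fc n c)

lemma euler_rec (χ : F2[X] → ℂ) (hmul : ∀ f g, χ (f * g) = χ f * χ g) (n : ℕ) :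
    (n : ℂ) * Asum χ n = ∑ j ∈ Finset.Icc 1 n, psi Ω χ j * Asum χ (n - j) := by
  have h1 : ∀ j ∈ Finset.Icc 1 n, psi Ω χ j * Asum χ (n - j) =
      ∑ f ∈ Mon n, ∑ c ∈ fixQ Ω (2 ^ j), if Fc j c ∣ f then χ f else 0 := by
    intro j hj
    obtain ⟨hj1, hjn⟩ := Finset.mem_Icc.1 hj
    rw [Finset.sum_comm, psi, Finset.sum_mul]
    refine Finset.sum_congr rfl fun c hc => ?_
    rw [mem_fixQ _ (Nat.one_lt_two_pow (by omega))] at hc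
    have hd := Fc_natDegree j c hc
    have hF0 := (Fc_monic j c).ne_zero
    rw [Asum, Finset.mul_sum, ← Finset.sum_filter]
    refine Finset.sum_bij (fun g _ => Fc j c * g) ?_ ?_ ?_ ?_
    · intro g hg
      obtain ⟨h0, hg⟩ := mem_Mon'.1 hg
      rw [Finset.mem_filter, mem_Mon']
      refine ⟨⟨mul_ne_zero hF0 h0, ?_⟩, dvd_mul_right _ _⟩
      rw [natDegree_mul hF0 h0, hd, hg]; omega
    · intro a _ b _ h
      exact mul_left_cancel₀ hF0 h
    · intro f hf
      rw [Finset.mem_filter, mem_Mon'] at hf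
      obtain ⟨⟨h0, hn⟩, g, rfl⟩ := hf
      have hg := right_ne_zero_of_mul h0
      refine ⟨g, ?_, rfl⟩
      rw [mem_Mon']
      refine ⟨hg, ?_⟩
      rw [natDegree_mul hF0 hg, hd] at hn
      omega
    · intro g _
      rw [hmul]
  rw [Finset.sum_congr rfl h1, Finset.sum_comm, Asum, Finset.mul_sum]
  refine Finset.sum_congr rfl fun f hf => ?_
  have h2 : ∀ j, (∑ c ∈ fixQ Ω (2 ^ j), if Fc j c ∣ f then χ f else 0) =
      (((fixQ Ω (2 ^ j)).filter (fun c => Fc j c ∣ f)).card : ℂ) * χ f := by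
    intro j
    rw [← Finset.sum_filter, Finset.sum_const, nsmul_eq_mul]
  simp only [h2]
  rw [← Finset.sum_mul, ← Nat.cast_sum, count_Fc n f hf]
end Euler

lemma exp_vanish (Z : Finset ℂ) (c : ℂ → ℂ) (q K : ℝ) (hq : 0 < q) (j0 : ℕ)
    (h : ∀ j, j0 ≤ j → ‖∑ z ∈ Z, c z * z ^ j‖ ≤ K * q ^ j) (w : ℂ) (hw : w ∈ Z) (hqw : q < ‖w‖) : c w = 0 := by
  let P : ℂ[X] := ∏ z ∈ Z.erase w, (X - C z)
  have hPz : ∀ z ∈ Z, z ≠ w → P.eval z = 0 := by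
    intro z hz hzw
    simp only [P, eval_prod]
    exact Finset.prod_eq_zero (Finset.mem_erase.2 ⟨hzw, hz⟩) (by simp)
  have hPw : P.eval w ≠ 0 := by
    simp only [P, eval_prod]
    rw [Finset.prod_ne_zero_iff]
    intro z hz
    simp only [eval_sub, eval_X, eval_C]
    exact sub_ne_zero.2 (Finset.mem_erase.1 hz).1.symm
  let M := ∑ i ∈ P.support, ‖P.coeff i‖ * (K * q ^ i)
  have key : ∀ j, j0 ≤ j → ‖c w * P.eval w‖ * ‖w‖ ^ j ≤ M * q ^ j := by
    intro j hj
    have h1 : c w * P.eval w * w ^ j = ∑ i ∈ P.support, P.coeff i * ∑ z ∈ Z, c z * z ^ (j + i) := by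
      have : ∑ z ∈ Z, c z * z ^ j * P.eval z = c w * P.eval w * w ^ j := by
        rw [Finset.sum_eq_single w]
        · ring
        · intro z hz hzw; rw [hPz z hz hzw, mul_zero]
        · exact fun h => absurd hw h
      rw [← this]
      simp only [Finset.mul_sum]
      rw [Finset.sum_comm]
      refine Finset.sum_congr rfl fun z _ => ?_
      rw [eval_eq_sum, Polynomial.sum, Finset.mul_sum]
      refine Finset.sum_congr rfl fun i _ => ?_
      rw [pow_add]; ring
    rw [← norm_pow, ← norm_mul, h1]
    refine (norm_sum_le _ _).trans ?_
    simp only [M]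
    rw [Finset.sum_mul]
    refine Finset.sum_le_sum fun i _ => ?_
    rw [norm_mul, mul_assoc]
    refine mul_le_mul_of_nonneg_left ?_ (norm_nonneg _)
    refine (h (j + i) (by omega)).trans (le_of_eq ?_)
    rw [pow_add]; ring
  by_contra hc
  have ha : 0 < ‖c w * P.eval w‖ := norm_pos_iff.2 (mul_ne_zero hc hPw)
  have hr : 1 < ‖w‖ / q := by rwa [one_lt_div hq]
  obtain ⟨n, hn⟩ := pow_unbounded_of_one_lt (M / ‖c w * P.eval w‖) hr
  have h2 := key (max n j0) (le_max_right _ _)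
  have h3 : M / ‖c w * P.eval w‖ < (‖w‖ / q) ^ (max n j0) :=
    hn.trans_le (pow_le_pow_right₀ hr.le (le_max_left _ _))
  rw [div_lt_iff₀ ha, div_pow, div_mul_eq_mul_div, lt_div_iff₀ (by positivity)] at h3
  linarith

/-- power sums of a multiset satisfy Newton's recursion -/
lemma newton_ms (S : Multiset ℂ) (n : ℕ) :
    (n : ℂ) * (S.map (fun α => (1 - C α * X : ℂ[X]))).prod.coeff n =
      - ∑ j ∈ Finset.Icc 1 n, (S.map (fun α => α ^ j)).sum * (S.map (fun α => (1 - C α * X : ℂ[X]))).prod.coeff (n - j) := by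
  induction S using Multiset.induction_on generalizing n with
  | empty =>
    simp [coeff_one]
  | cons α S ih =>
    simp only [Multiset.map_cons, Multiset.prod_cons, Multiset.sum_cons]
    set P := (S.map (fun α => (1 - C α * X : ℂ[X]))).prod with hP
    set p : ℕ → ℂ := fun j => (S.map (fun α => α ^ j)).sum with hp
    have hc : ∀ m, ((1 - C α * X) * P).coeff m = P.coeff m - α * (if m = 0 then 0 else P.coeff (m - 1)) := by
      intro m
      rw [sub_mul, one_mul, coeff_sub, mul_assoc, coeff_C_mul]
      rcases m with _ | m
      · simp
      · simp [coeff_X_mul]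
    have hA : ∀ n, ∑ j ∈ Finset.Icc 1 n, α ^ j * ((1 - C α * X) * P).coeff (n - j) =
        α * (if n = 0 then 0 else P.coeff (n - 1)) := by
      intro n
      induction n with
      | zero => simp
      | succ n ih2 =>
        have : ∑ j ∈ Finset.Icc 1 (n + 1), α ^ j * ((1 - C α * X) * P).coeff (n + 1 - j) =
          α * ((1 - C α * X) * P).coeff n + α * ∑ j ∈ Finset.Icc 1 n, α ^ j * ((1 - C α * X) * P).coeff (n - j) := by
          rw [← Finset.add_sum_Ioc_eq_sum_Icc (by omega : 1 ≤ n + 1)]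
          simp only [pow_one, Nat.add_sub_cancel]
          congr 1
          rw [Finset.mul_sum]
          symm
          refine Finset.sum_bij (fun j _ => j + 1) ?_ ?_ ?_ ?_
          · intro j hj; simp only [Finset.mem_Icc, Finset.mem_Ioc] at *; omega
          · intro a _ b _ h; omega
          · intro j hj
            simp only [Finset.mem_Icc, Finset.mem_Ioc] at *
            exact ⟨j - 1, by omega, by omega⟩
          · intro j _
            rw [show n + 1 - (j + 1) = n - j by omega, pow_succ]; ring
        rw [this, ih2, hc]
        simp
        split_ifs <;> ring
    simp only [add_mul]
    rw [Finset.sum_add_distrib, hA, hc]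
    rcases n with _ | n
    · simp
    have h1 := ih (n + 1)
    have h2 := ih n
    have h3 : ∑ j ∈ Finset.Icc 1 (n + 1), p j * ((1 - C α * X) * P).coeff (n + 1 - j) =
        ∑ j ∈ Finset.Icc 1 (n + 1), p j * P.coeff (n + 1 - j) - α * ∑ j ∈ Finset.Icc 1 n, p j * P.coeff (n - j) := by
      rw [Finset.mul_sum, Finset.sum_Icc_succ_top (by omega), Finset.sum_Icc_succ_top (by omega : 1 ≤ n + 1)]
      have : ∀ j ∈ Finset.Icc 1 n, p j * ((1 - C α * X) * P).coeff (n + 1 - j) =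
          p j * P.coeff (n + 1 - j) - α * (p j * P.coeff (n - j)) := by
        intro j hj
        have := Finset.mem_Icc.1 hj
        rw [hc, if_neg (by omega), show n + 1 - j - 1 = n - j by omega]; ring
      rw [Finset.sum_congr rfl this, Finset.sum_sub_distrib, hc]
      simp; ring
    have h3' : ∑ j ∈ Finset.Icc 1 (n + 1), (S.map (fun α => α ^ j)).sum * ((1 - C α * X) * P).coeff (n + 1 - j) =
        ∑ j ∈ Finset.Icc 1 (n + 1), (S.map (fun α => α ^ j)).sum * P.coeff (n + 1 - j) - α * ∑ j ∈ Finset.Icc 1 n, (S.map (fun α => α ^ j)).sum * P.coeff (n - j) := h3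
    rw [h3']
    simp only [Nat.add_eq_zero_iff, one_ne_zero, and_false, if_false, Nat.add_sub_cancel]
    push_cast at h1 ⊢
    linear_combination h1 - α * h2

lemma exists_roots (A ψ : ℕ → ℂ) (D : ℕ) (hA0 : A 0 = 1) (hA : ∀ n, D < n → A n = 0)
    (hrec : ∀ n : ℕ, (n : ℂ) * A n = ∑ j ∈ Finset.Icc 1 n, ψ j * A (n - j)) :
    ∃ S : Multiset ℂ, S.card ≤ D ∧ ∀ n, 1 ≤ n → ψ n = - (S.map (fun α => α ^ n)).sum := by
  let P : ℂ[X] := ∑ i ∈ Finset.range (D + 1), C (A i) * X ^ i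
  have hPc : ∀ n, P.coeff n = A n := by
    intro n
    simp only [P, finset_sum_coeff, coeff_C_mul, coeff_X_pow]
    simp only [mul_ite, mul_one, mul_zero]
    rw [Finset.sum_ite_eq]
    split_ifs with h
    · rfl
    · rw [hA]; simpa using h
  have hP0 : P ≠ 0 := by
    intro h; have := hPc 0; rw [h, hA0] at this; simp at this
  have hPd : P.natDegree ≤ D := by
    rw [natDegree_le_iff_coeff_eq_zero]
    intro n hn; rw [hPc, hA n hn]
  have hfac : ∃ S : Multiset ℂ, S.card ≤ D ∧ P = (S.map (fun α => (1 - C α * X : ℂ[X]))).prod := by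
    refine ⟨P.roots.map (fun β => β⁻¹), ?_, ?_⟩
    · rw [Multiset.card_map]; exact (card_roots' P).trans hPd
    have h1 := (IsAlgClosed.splits P).eq_prod_roots
    have hne : ∀ β ∈ P.roots, β ≠ 0 := by
      rintro β hβ rfl
      rw [mem_roots hP0, IsRoot, ← coeff_zero_eq_eval_zero, hPc, hA0] at hβ
      exact one_ne_zero hβ
    have h2 : ∀ T : Multiset ℂ, (∀ β ∈ T, β ≠ 0) → (T.map (fun β => X - C β)).prod =
        C ((T.map (fun β => -β)).prod) * ((T.map (fun β => β⁻¹)).map (fun α => (1 - C α * X : ℂ[X]))).prod := by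
      intro T hT
      induction T using Multiset.induction_on with
      | empty => simp
      | cons β T ih =>
        simp only [Multiset.map_cons, Multiset.prod_cons]
        rw [ih (fun b hb => hT b (Multiset.mem_cons_of_mem hb))]
        have hb : β ≠ 0 := hT β (Multiset.mem_cons_self _ _)
        have : (X - C β : ℂ[X]) = C (-β) * (1 - C β⁻¹ * X) := by
          rw [mul_sub, ← mul_assoc, ← C_mul]
          have : -β * β⁻¹ = -1 := by field_simp
          rw [this]; simp; ring
        rw [this, C_mul]; ring
    rw [h2 _ hne, ← mul_assoc, ← C_mul] at h1
    set Q := ((P.roots.map (fun β => β⁻¹)).map (fun α => (1 - C α * X : ℂ[X]))).prod with hQ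
    have hQ0 : Q.coeff 0 = 1 := by
      rw [coeff_zero_eq_eval_zero, hQ, eval_multiset_prod]
      simp
    have h3 := congrArg (fun q => coeff q 0) h1
    simp only [coeff_C_mul, hPc, hA0, hQ0, mul_one] at h3
    rw [← h3, C_1, one_mul] at h1
    exact h1
  obtain ⟨S, hS, hPS⟩ := hfac
  refine ⟨S, hS, ?_⟩
  have hN := newton_ms S
  rw [← hPS] at hN
  intro n
  induction n using Nat.strong_induction_on with
  | _ n ih =>
    intro hn
    have h1 := hrec n
    have h2 := hN n
    simp only [hPc] at h2
    rw [h1] at h2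
    obtain ⟨m, rfl⟩ : ∃ m, n = m + 1 := ⟨n - 1, by omega⟩
    rw [Finset.sum_Icc_succ_top (by omega), Finset.sum_Icc_succ_top (by omega), Nat.sub_self, hA0] at h2
    have h3 : ∑ j ∈ Finset.Icc 1 m, ψ j * A (m + 1 - j) =
      - ∑ j ∈ Finset.Icc 1 m, (S.map (fun α => α ^ j)).sum * A (m + 1 - j) := by
      rw [← Finset.sum_neg_distrib]
      refine Finset.sum_congr rfl fun j hj => ?_
      have := Finset.mem_Icc.1 hj
      rw [ih j (by omega) this.1]; ring
    rw [h3] at h2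
    linear_combination h2

lemma Mon_zero : Mon 0 = {1} := by
  ext f
  rw [mem_Mon', Finset.mem_singleton]
  constructor
  · rintro ⟨h0, hd⟩
    exact (monic_F2 h0).natDegree_eq_zero.1 hd
  · rintro rfl
    simp

theorem weil {Ω : Type} [Field Ω] [IsAlgClosed Ω] [Algebra F2 Ω] [Algebra.IsAlgebraic F2 Ω]
    (χ : F2[X] → ℂ) (hmul : ∀ f g, χ (f * g) = χ f * χ g) (h1 : χ 1 = 1) (hb : ∀ f, ‖χ f‖ ≤ 1)
    (s : F2[X]) (hs : s ≠ 0) (κ : ℕ)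
    (hcl : ∀ f f', s ∣ f - f' → X ^ κ ∣ f.reverse - f'.reverse → χ f = χ f') (D : ℕ)
    (hA : ∀ n, D < n → Asum χ n = 0) (n : ℕ) (hn : 1 ≤ n) : ‖psi Ω χ n‖ ≤ D * (Real.sqrt 2) ^ n := by
  obtain ⟨S, hS, hψ⟩ := exists_roots (Asum χ) (psi Ω χ) D (by simp [Asum, Mon_zero, h1]) hA
    (fun n => euler_rec χ hmul n)
  obtain ⟨r, G, _, g0, a, K, j0, hr, ⟨ha1, ha2⟩, hE⟩ := equidist Ω s hs κ
  have hT := fun j hj => hE j hj χ hb hcl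
  set T : ℂ := (∑ g : G, χ (a g)) / Fintype.card G with hTdef
  have hg0 : χ (a g0) = 1 := by
    rw [← h1]
    apply hcl _ _ ha1
    have : (1 : F2[X]).reverse = 1 := by
      have := Polynomial.reverse_C (1 : F2)
      simpa using this
    rw [this]; exact ha2
  haveI : Nonempty G := ⟨g0⟩
  have hGpos : (0 : ℝ) < Fintype.card G := by exact_mod_cast Fintype.card_pos
  have hTn : ∀ m : ℕ, 1 ≤ m → (m : ℂ) + T ≠ 0 := by
    intro m hm h
    have h2 : (∑ g : G, (χ (a g)).re) = - m * Fintype.card G := by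
      have h3 : (∑ g : G, χ (a g)) = - m * Fintype.card G := by
        have : T = -m := by linear_combination h
        rw [hTdef, div_eq_iff (by exact_mod_cast hGpos.ne')] at this
        exact this
      have := congrArg Complex.re h3
      rw [Complex.re_sum] at this
      rw [this]
      have h5 : (-(m : ℂ) * (Fintype.card G : ℂ)) = ((-(m : ℝ) * (Fintype.card G : ℝ) : ℝ) : ℂ) := by push_cast; ring
      rw [h5, Complex.ofReal_re]
    have h4 : (∑ g : G, (χ (a g)).re) > ∑ g : G, (-1 : ℝ) := by
      apply Finset.sum_lt_sum
      · intro g _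
        have := (abs_le.1 ((Complex.abs_re_le_norm (χ (a g))).trans (hb _))).1
        exact this
      · exact ⟨g0, Finset.mem_univ _, by rw [hg0]; simp⟩
    rw [Finset.sum_const, h2, Finset.card_univ, nsmul_eq_mul] at h4
    have : (1 : ℝ) ≤ m := by exact_mod_cast hm
    nlinarith
  have hroot : ∀ α ∈ S, ‖α‖ ≤ Real.sqrt 2 := by
    intro α hα
    by_contra hlt
    push Not at hlt
    let S' := S.map (fun α => α ^ (2 * r))
    let Z : Finset ℂ := insert ((4 : ℂ) ^ r) S'.toFinset
    have hsum : ∀ j, j0 + 1 ≤ j → ‖∑ z ∈ Z, ((S'.count z : ℂ) + if z = (4 : ℂ) ^ r then T else 0) * z ^ j‖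
        ≤ K * ((2 : ℝ) ^ r) ^ j := by
      intro j hj
      have e1 : ∑ z ∈ Z, ((S'.count z : ℂ) + if z = (4 : ℂ) ^ r then T else 0) * z ^ j =
          (S'.map (fun z => z ^ j)).sum + T * ((4 : ℂ) ^ r) ^ j := by
        simp only [add_mul]
        rw [Finset.sum_add_distrib]
        congr 1
        · rw [Finset.sum_multiset_map_count]
          symm
          apply Finset.sum_subset_zero_on_sdiff (Finset.subset_insert _ _)
          · intro z hz
            have : z ∉ S' := by
              have := (Finset.mem_sdiff.1 hz).2
              rwa [Multiset.mem_toFinset] at this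
            rw [Multiset.count_eq_zero_of_notMem this]; simp
          · intro z _
            rw [nsmul_eq_mul]
        · simp only [ite_mul, zero_mul]
          rw [Finset.sum_ite_eq', if_pos (Finset.mem_insert_self _ _)]
      have e2 : (S'.map (fun z => z ^ j)).sum = - psi Ω χ (r * j + r * j) := by
        have : 0 < r * j := Nat.mul_pos hr (by omega)
        rw [hψ _ (by omega), neg_neg]
        simp only [S', Multiset.map_map, Function.comp]
        congr 1
        apply Multiset.map_congr rfl
        intro x _
        rw [← pow_mul]; congr 1; ring
      have e3 := hT j (by omega)
      have e4 : psi Ω χ (r * j + r * j) = ∑ z ∈ fixQ Ω (2 ^ (r * j) * 2 ^ (r * j)), χ (Fc (r * j + r * j) z) := by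
        rw [psi, pow_add]
      rw [← e4] at e3
      rw [e1, e2, ← norm_neg]
      refine le_trans (le_of_eq ?_) (e3.trans (le_of_eq ?_))
      · congr 1
        have : ((4 : ℂ) ^ r) ^ j = 2 ^ (r * j) * 2 ^ (r * j) := by
          rw [← pow_mul, ← mul_pow]; norm_num
        rw [this]; ring
      · rw [← pow_mul]
    have hmem : α ^ (2 * r) ∈ S' := Multiset.mem_map_of_mem _ hα
    have hq : (2 : ℝ) ^ r < ‖α ^ (2 * r)‖ := by
      rw [norm_pow, pow_mul]
      apply pow_lt_pow_left₀ _ (by norm_num) (by omega)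
      have := pow_lt_pow_left₀ hlt (Real.sqrt_nonneg 2) (by norm_num : 2 ≠ 0)
      rwa [Real.sq_sqrt (by norm_num)] at this
    have hz := exp_vanish Z _ (2 ^ r) K (by positivity) (j0 + 1) hsum (α ^ (2 * r))
      (Finset.mem_insert_of_mem (Multiset.mem_toFinset.2 hmem)) hq
    have hcnt := Multiset.one_le_count_iff_mem.2 hmem
    split_ifs at hz
    · exact hTn _ hcnt hz
    · rw [add_zero, Nat.cast_eq_zero] at hz
      omega
  rw [hψ n hn, norm_neg]
  calc ‖(S.map (fun α => α ^ n)).sum‖ ≤ ((S.map (fun α => α ^ n)).map (fun z => ‖z‖)).sum :=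
        norm_multiset_sum_le _
    _ ≤ ((S.map (fun α => α ^ n)).map (fun z => ‖z‖)).card • (Real.sqrt 2) ^ n := by
        apply Multiset.sum_le_card_nsmul
        intro x hx
        rw [Multiset.map_map] at hx
        obtain ⟨α, hα, rfl⟩ := Multiset.mem_map.1 hx
        simp only [Function.comp, norm_pow]
        exact pow_le_pow_left₀ (norm_nonneg _) (hroot α hα) n
    _ ≤ D * (Real.sqrt 2) ^ n := by
        rw [nsmul_eq_mul]
        simp only [Multiset.card_map]
        apply mul_le_mul_of_nonneg_right _ (by positivity)
        exact_mod_cast hS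

lemma card_GN (n : ℕ) : (GN n).card = 2 ^ n := by
  have h1 : ∀ f, f ∈ GN n ↔ f ∈ degreeLT F2 n := by
    intro f; rw [mem_GN, mem_degreeLT]
  have e : (GN n) ≃ (Fin n → F2) :=
    (Equiv.subtypeEquivRight h1).trans (degreeLTEquiv F2 n).toEquiv
  have := Fintype.card_congr e
  rw [Fintype.card_coe] at this
  rw [this, Fintype.card_fun, ZMod.card, Fintype.card_fin]

/-- Parseval bound -/
lemma parseval_bound {A ι : Type} [AddCommGroup A] [Fintype A] (J : Finset ι) (x : ι → A) (F : A → ℂ)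
    (hF : ∀ a, ‖F a‖ ≤ 1) (B : ℝ) (hB0 : 0 ≤ B) (hB : ∀ ψ : AddChar A ℂ, ψ ≠ 0 → ‖∑ i ∈ J, ψ (x i)‖ ≤ B) :
    ‖∑ i ∈ J, F (x i) - (J.card : ℂ) / Fintype.card A * ∑ a, F a‖ ≤ Real.sqrt (Fintype.card A) * B := by
  have hA : (0 : ℝ) < Fintype.card A := by exact_mod_cast Fintype.card_pos
  have hAc : (Fintype.card A : ℂ) ≠ 0 := by exact_mod_cast hA.ne'
  let Fh : AddChar A ℂ → ℂ := fun ψ => ∑ b, F b * ψ (-b)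
  have inv : ∀ a, F a = (∑ ψ : AddChar A ℂ, Fh ψ * ψ a) / Fintype.card A := by
    intro a
    rw [eq_div_iff hAc]
    simp only [Fh, Finset.sum_mul]
    rw [Finset.sum_comm]
    have : ∀ b, ∑ ψ : AddChar A ℂ, F b * ψ (-b) * ψ a = F b * if a - b = 0 then (Fintype.card A : ℂ) else 0 := by
      intro b
      rw [← AddChar.sum_apply_eq_ite, Finset.mul_sum]
      refine Finset.sum_congr rfl fun ψ _ => ?_
      rw [mul_assoc, ← AddChar.map_add_eq_mul]
      congr 2; abel
    simp only [this, sub_eq_zero]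
    simp
  have pars : ∑ ψ : AddChar A ℂ, ‖Fh ψ‖ ^ 2 = Fintype.card A * ∑ b, ‖F b‖ ^ 2 := by
    have hc : ((∑ ψ : AddChar A ℂ, ‖Fh ψ‖ ^ 2 : ℝ) : ℂ) = ((Fintype.card A * ∑ b, ‖F b‖ ^ 2 : ℝ) : ℂ) := by
      push_cast
      have h1 : ∀ ψ : AddChar A ℂ, ((‖Fh ψ‖ : ℂ) ^ 2) =
          ∑ b, ∑ b', F b * (starRingEnd ℂ) (F b') * ψ (b' - b) := by
        intro ψ
        rw [← Complex.mul_conj']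
        simp only [Fh, map_sum, map_mul]
        rw [Finset.sum_mul_sum]
        refine Finset.sum_congr rfl fun b _ => Finset.sum_congr rfl fun b' _ => ?_
        rw [← AddChar.map_neg_eq_conj, neg_neg, sub_eq_add_neg, AddChar.map_add_eq_mul]; ring
      simp only [h1]
      rw [Finset.sum_comm, Finset.mul_sum]
      refine Finset.sum_congr rfl fun b _ => ?_
      rw [Finset.sum_comm]
      have : ∀ b', ∑ ψ : AddChar A ℂ, F b * (starRingEnd ℂ) (F b') * ψ (b' - b) =
          F b * (starRingEnd ℂ) (F b') * if b' - b = 0 then (Fintype.card A : ℂ) else 0 := by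
        intro b'
        rw [← AddChar.sum_apply_eq_ite, Finset.mul_sum]
      simp only [this, sub_eq_zero]
      simp only [mul_ite, mul_zero, Finset.sum_ite_eq', Finset.mem_univ, if_true]
      rw [Complex.mul_conj']; ring
    exact_mod_cast hc
  have hsum : ∑ ψ : AddChar A ℂ, ‖Fh ψ‖ ≤ Fintype.card A * Real.sqrt (Fintype.card A) := by
    have h1 : (∑ ψ : AddChar A ℂ, ‖Fh ψ‖) ^ 2 ≤ (Fintype.card A : ℝ) ^ 2 * Fintype.card A := by
      have h2 := sq_sum_le_card_mul_sum_sq (s := (Finset.univ : Finset (AddChar A ℂ))) (f := fun ψ => ‖Fh ψ‖)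
      rw [pars, Finset.card_univ, AddChar.card_eq] at h2
      have h3 : ∑ b, ‖F b‖ ^ 2 ≤ Fintype.card A := by
        calc ∑ b, ‖F b‖ ^ 2 ≤ ∑ b : A, (1 : ℝ) :=
              Finset.sum_le_sum fun b _ => pow_le_one₀ (norm_nonneg _) (hF b)
          _ = _ := by simp
      refine h2.trans ?_
      have : (Fintype.card A : ℝ) * (Fintype.card A * ∑ b, ‖F b‖ ^ 2) ≤ Fintype.card A * (Fintype.card A * Fintype.card A) := by
        gcongr
      linarith [this]
    have h4 := Real.sqrt_le_sqrt h1
    rw [Real.sqrt_sq (by positivity), Real.sqrt_mul (by positivity), Real.sqrt_sq (by positivity)] at h4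
    exact h4
  have hmain : ∑ i ∈ J, F (x i) - (J.card : ℂ) / Fintype.card A * ∑ a, F a =
      (∑ ψ ∈ Finset.univ.erase (0 : AddChar A ℂ), Fh ψ * ∑ i ∈ J, ψ (x i)) / Fintype.card A := by
    have h1 : ∑ i ∈ J, F (x i) = (∑ ψ : AddChar A ℂ, Fh ψ * ∑ i ∈ J, ψ (x i)) / Fintype.card A := by
      rw [Finset.sum_congr rfl (fun i _ => inv (x i)), ← Finset.sum_div, Finset.sum_comm]
      simp only [Finset.mul_sum]
    rw [h1, ← Finset.add_sum_erase _ _ (Finset.mem_univ (0 : AddChar A ℂ))]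
    have h2 : Fh 0 = ∑ a, F a := by simp [Fh]
    rw [h2]
    simp only [AddChar.zero_apply, Finset.sum_const, nsmul_eq_mul, mul_one]
    ring
  rw [hmain, norm_div, Complex.norm_natCast, div_le_iff₀ hA]
  calc _ ≤ ∑ ψ ∈ Finset.univ.erase (0 : AddChar A ℂ), ‖Fh ψ * ∑ i ∈ J, ψ (x i)‖ := norm_sum_le _ _
    _ ≤ ∑ ψ ∈ Finset.univ.erase (0 : AddChar A ℂ), ‖Fh ψ‖ * B := by
        refine Finset.sum_le_sum fun ψ hψ => ?_
        rw [norm_mul]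
        exact mul_le_mul_of_nonneg_left (hB ψ (Finset.mem_erase.1 hψ).1) (norm_nonneg _)
    _ ≤ ∑ ψ : AddChar A ℂ, ‖Fh ψ‖ * B :=
        Finset.sum_le_sum_of_subset_of_nonneg (Finset.erase_subset _ _) (fun _ _ _ => by positivity)
    _ = (∑ ψ : AddChar A ℂ, ‖Fh ψ‖) * B := by rw [Finset.sum_mul]
    _ ≤ (Fintype.card A * Real.sqrt (Fintype.card A)) * B := mul_le_mul_of_nonneg_right hsum hB0
    _ = _ := by ring

section Cls
variable (s : F2[X]) (κ : ℕ)

abbrev Rg : Type := (F2[X] ⧸ Ideal.span {s}) × (F2[X] ⧸ Ideal.span {(X : F2[X]) ^ (κ + 1)})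

/-- class of a polynomial -/
def cls (f : F2[X]) : Rg s κ := (Ideal.Quotient.mk _ f, Ideal.Quotient.mk _ f.reverse)

lemma rev_one : (1 : F2[X]).reverse = 1 := by
  have := Polynomial.reverse_C (1 : F2)
  simpa using this

lemma cls_one : cls s κ 1 = 1 := by
  rw [cls, rev_one]; rfl

lemma cls_mul (f g : F2[X]) : cls s κ (f * g) = cls s κ f * cls s κ g := by
  rw [cls, reverse_mul_of_domain, map_mul, map_mul]; rfl

lemma cls_eq (f g : F2[X]) : cls s κ f = cls s κ g ↔ s ∣ f - g ∧ X ^ (κ + 1) ∣ f.reverse - g.reverse := by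
  rw [cls, cls, Prod.mk.injEq, Ideal.Quotient.eq, Ideal.Quotient.eq, Ideal.mem_span_singleton, Ideal.mem_span_singleton]

lemma isUnit_mk_iff (f m : F2[X]) : IsUnit (Ideal.Quotient.mk (Ideal.span {m}) f) ↔ IsCoprime f m := by
  constructor
  · rintro h
    obtain ⟨g, hg⟩ := h.exists_right_inv
    obtain ⟨g, rfl⟩ := Ideal.Quotient.mk_surjective g
    rw [← map_mul, ← map_one (Ideal.Quotient.mk _), Ideal.Quotient.eq, Ideal.mem_span_singleton] at hg
    obtain ⟨q, hq⟩ := hg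
    exact ⟨g, -q, by linear_combination hq⟩
  · rintro ⟨a, b, h⟩
    refine IsUnit.of_mul_eq_one (Ideal.Quotient.mk _ a) ?_
    rw [← map_mul, ← map_one (Ideal.Quotient.mk _), Ideal.Quotient.eq, Ideal.mem_span_singleton]
    exact ⟨-b, by linear_combination h⟩

lemma isUnit_cls (f : F2[X]) (hf : f ≠ 0) : IsUnit (cls s κ f) ↔ IsCoprime f s := by
  rw [cls, Prod.isUnit_iff]
  simp only [isUnit_mk_iff]
  constructor
  · exact fun h => h.1
  · intro h
    refine ⟨h, ?_⟩
    apply IsCoprime.pow_right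
    have h1 : f.reverse.coeff 0 = 1 := by
      rw [coeff_zero_reverse]; exact monic_F2 hf
    obtain ⟨q, hq⟩ : (X : F2[X]) ∣ f.reverse - 1 := by
      rw [X_dvd_iff]; simp [h1]
    exact ⟨1, -q, by linear_combination hq⟩

variable {s} in
lemma finite_quot (hs : s ≠ 0) : Finite (F2[X] ⧸ Ideal.span {s}) := by
  have := (monic_F2 hs).finite_quotient
  exact Module.finite_of_finite F2

lemma rev_eq_reflect {n : ℕ} {f : F2[X]} (hf : f ∈ Mon n) : f.reverse = reflect n f := by
  rw [reverse, (mem_Mon'.1 hf).2]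

lemma reflect_dvd (n : ℕ) (hκ : κ ≤ n) (p : F2[X]) (hp : p.degree < (n + 1 : ℕ)) :
    X ^ (κ + 1) ∣ reflect n p ↔ p.degree < (n - κ : ℕ) := by
  rw [X_pow_dvd_iff, degree_lt_iff_coeff_zero]
  rw [degree_lt_iff_coeff_zero] at hp
  constructor
  · intro h m hm
    rcases Nat.lt_or_ge n m with h1 | h1
    · exact hp m h1
    · have := h (n - m) (by omega)
      rw [coeff_reflect, revAt_le (by omega), Nat.sub_sub_self h1] at this
      exact this
  · intro h i hi
    rw [coeff_reflect, revAt_le (by omega)]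
    exact h _ (by omega)

lemma reflect_sub' (n : ℕ) (p q : F2[X]) : reflect n (p - q) = reflect n p - reflect n q := by
  ext i; simp [coeff_reflect]

lemma Mon_deg {n : ℕ} {f : F2[X]} (hf : f ∈ Mon n) : f.degree < (n + 1 : ℕ) := by
  rw [mem_Mon.1 hf]; exact_mod_cast Nat.lt_succ_self n

lemma rev_dvd_iff (n : ℕ) (hκ : κ ≤ n) {f g : F2[X]} (hf : f ∈ Mon n) (hg : g ∈ Mon n) :
    X ^ (κ + 1) ∣ f.reverse - g.reverse ↔ (f - g).degree < (n - κ : ℕ) := by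
  rw [rev_eq_reflect hf, rev_eq_reflect hg, ← reflect_sub', reflect_dvd κ n hκ]
  exact (degree_sub_le _ _).trans_lt (max_lt (Mon_deg hf) (Mon_deg hg))

lemma fiber_nonempty (hs : s ≠ 0) (n : ℕ) (hn : s.natDegree + κ ≤ n) (u : (Rg s κ)ˣ) :
    ∃ f ∈ Mon n, cls s κ f = u := by
  obtain ⟨a, ha⟩ := Ideal.Quotient.mk_surjective (u : Rg s κ).1
  obtain ⟨b, hb⟩ := Ideal.Quotient.mk_surjective (u : Rg s κ).2
  have hXm : ((X : F2[X]) ^ (κ + 1)).Monic := monic_X_pow _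
  have hbu : IsCoprime b (X ^ (κ + 1)) := by
    rw [← isUnit_mk_iff, hb]
    exact (Prod.isUnit_iff.1 u.isUnit).2
  let b' := b %ₘ X ^ (κ + 1)
  have hb'd : b'.degree < (κ + 1 : ℕ) := by
    have := degree_modByMonic_lt b hXm
    rwa [degree_X_pow] at this
  have hbb : X ^ (κ + 1) ∣ b' - b := by
    have := modByMonic_add_div b (X ^ (κ + 1))
    exact ⟨- (b /ₘ X ^ (κ + 1)), by simp only [b']; linear_combination this⟩
  have hb0 : b'.coeff 0 = 1 := by
    have h1 : b'.coeff 0 = b.coeff 0 := by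
      have := X_pow_dvd_iff.1 hbb 0 (by omega)
      rw [coeff_sub, sub_eq_zero] at this; exact this
    rw [h1]
    have h2 : b.coeff 0 ≠ 0 := by
      intro h
      rw [← X_dvd_iff] at h
      have := hbu.isUnit_of_dvd' h (dvd_pow_self X (by omega))
      exact not_isUnit_X this
    generalize b.coeff 0 = z at h2
    revert z; decide
  rw [degree_lt_iff_coeff_zero] at hb'd
  let t := reflect n b'
  have ht : ∀ m, n < m → t.coeff m = 0 := by
    intro m hm
    simp only [t]
    rw [coeff_reflect, revAt_eq_self_of_lt hm]
    exact hb'd _ (by omega)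
  have hsm := monic_F2 hs
  let g := (a - t) %ₘ s
  have hgd : g.degree < (n - κ : ℕ) := by
    refine (degree_modByMonic_lt _ hsm).trans_le ?_
    rw [degree_eq_natDegree hs]
    exact_mod_cast (by omega : s.natDegree ≤ n - κ)
  have hgd' : g.degree < (n + 1 : ℕ) := hgd.trans (by exact_mod_cast (by omega : n - κ < n + 1))
  have hmon : t + g ∈ Mon n := by
    rw [mem_Mon']
    have hcn : (t + g).coeff n = 1 := by
      rw [coeff_add]
      have h1 : t.coeff n = 1 := by
        simp only [t]
        rw [coeff_reflect, revAt_le le_rfl, Nat.sub_self, hb0]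
      by_cases hκ0 : n - κ ≤ n
      · rw [h1, (degree_lt_iff_coeff_zero _ _).1 hgd n hκ0, add_zero]
      · omega
    have hne : t + g ≠ 0 := by
      intro h; rw [h] at hcn; simp at hcn
    refine ⟨hne, le_antisymm ?_ ?_⟩
    · rw [natDegree_le_iff_coeff_eq_zero]
      intro m hm
      rw [coeff_add, ht m hm, (degree_lt_iff_coeff_zero _ _).1 hgd' m (by omega), add_zero]
    · apply le_natDegree_of_ne_zero
      rw [hcn]; exact one_ne_zero
  refine ⟨t + g, hmon, ?_⟩
  have e1 : Ideal.Quotient.mk (Ideal.span {s}) (t + g) = (u : Rg s κ).1 := by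
    rw [← ha, Ideal.Quotient.eq, Ideal.mem_span_singleton]
    have := modByMonic_add_div (a - t) s
    exact ⟨- ((a - t) /ₘ s), by simp only [g]; linear_combination this⟩
  have e2 : Ideal.Quotient.mk (Ideal.span {(X : F2[X]) ^ (κ + 1)}) (t + g).reverse = (u : Rg s κ).2 := by
    rw [← hb, Ideal.Quotient.eq, Ideal.mem_span_singleton, rev_eq_reflect hmon]
    have h1 : reflect n (t + g) = b' + reflect n g := by
      ext i
      simp [t, coeff_reflect, revAt_invol]
    have h2 := (reflect_dvd κ n (by omega) g hgd').2 hgd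
    rw [h1]
    have : b' + reflect n g - b = (b' - b) + reflect n g := by ring
    rw [this]
    exact dvd_add hbb h2
  exact Prod.ext e1 e2

lemma fiber_card (hs : s ≠ 0) (n : ℕ) (hn : s.natDegree + κ ≤ n) (u : (Rg s κ)ˣ) :
    ((Mon n).filter (fun f => cls s κ f = u)).card = 2 ^ (n - κ - s.natDegree) := by
  obtain ⟨f0, hf0, hu⟩ := fiber_nonempty s κ hs n hn u
  rw [← card_GN, ← hu]
  symm
  apply Finset.card_bij (fun q _ => f0 + s * q)
  · intro q hq
    rw [mem_GN] at hq
    have hd : (s * q).degree < (n - κ : ℕ) := by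
      by_cases hq0 : q = 0
      · rw [hq0, mul_zero, degree_zero]; exact WithBot.bot_lt_coe _
      rw [degree_mul, degree_eq_natDegree hs, degree_eq_natDegree hq0]
      rw [degree_eq_natDegree hq0] at hq
      have : q.natDegree < n - κ - s.natDegree := by exact_mod_cast hq
      exact_mod_cast (by omega : s.natDegree + q.natDegree < n - κ)
    have hmon : f0 + s * q ∈ Mon n := by
      rw [mem_Mon, degree_add_eq_left_of_degree_lt]
      · exact mem_Mon.1 hf0
      · rw [mem_Mon.1 hf0]
        exact hd.trans_le (by exact_mod_cast (by omega : n - κ ≤ n))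
    rw [Finset.mem_filter, cls_eq, rev_dvd_iff κ n (by omega) hmon hf0]
    refine ⟨hmon, ?_, ?_⟩
    · rw [add_sub_cancel_left]; exact dvd_mul_right _ _
    · rw [add_sub_cancel_left]; exact hd
  · intro a _ b _ h
    exact mul_left_cancel₀ hs (add_left_cancel h)
  · intro f hf
    rw [Finset.mem_filter, cls_eq] at hf
    obtain ⟨hf, ⟨q, hq⟩, h2⟩ := hf
    rw [rev_dvd_iff κ n (by omega) hf hf0, hq] at h2
    refine ⟨q, ?_, by rw [← hq]; ring⟩
    rw [mem_GN]
    by_cases hq0 : q = 0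
    · rw [hq0, degree_zero]; exact WithBot.bot_lt_coe _
    rw [degree_mul, degree_eq_natDegree hs, degree_eq_natDegree hq0] at h2
    rw [degree_eq_natDegree hq0]
    have : s.natDegree + q.natDegree < n - κ := by exact_mod_cast h2
    exact_mod_cast (by omega : q.natDegree < n - κ - s.natDegree)
end Cls

section Chi
variable (s : F2[X]) (κ : ℕ)

abbrev UA : Type := Additive (Rg s κ)ˣ

/-- the character of polynomials attached to a character of the class group -/
def chi (ψ : AddChar (UA s κ) ℂ) (f : F2[X]) : ℂ :=
  if h : IsUnit (cls s κ f) then ψ (Additive.ofMul h.unit) else 0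

variable {s κ}

lemma chi_of (ψ : AddChar (UA s κ) ℂ) (f : F2[X]) (u : (Rg s κ)ˣ) (h : cls s κ f = u) :
    chi s κ ψ f = ψ (Additive.ofMul u) := by
  have h1 : IsUnit (cls s κ f) := h ▸ u.isUnit
  rw [chi, dif_pos h1]
  congr 2
  exact Units.ext (by rw [IsUnit.unit_spec, h])

lemma chi_mul (ψ : AddChar (UA s κ) ℂ) (f g : F2[X]) : chi s κ ψ (f * g) = chi s κ ψ f * chi s κ ψ g := by
  by_cases hf : IsUnit (cls s κ f)
  · by_cases hg : IsUnit (cls s κ g)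
    · rw [chi_of ψ f hf.unit (by simp), chi_of ψ g hg.unit (by simp),
        chi_of ψ (f * g) (hf.unit * hg.unit) (by rw [cls_mul]; simp), ofMul_mul, AddChar.map_add_eq_mul]
    · rw [chi, dif_neg, chi, chi, dif_neg hg, mul_zero]
      rw [cls_mul]; exact fun h => hg (isUnit_of_mul_isUnit_right h)
  · rw [chi, dif_neg, chi, dif_neg hf, zero_mul]
    rw [cls_mul]; exact fun h => hf (isUnit_of_mul_isUnit_left h)

lemma chi_one (ψ : AddChar (UA s κ) ℂ) : chi s κ ψ 1 = 1 := by
  rw [chi_of ψ 1 1 (by rw [cls_one]; rfl)]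
  exact AddChar.map_zero_eq_one ψ

lemma finite_Rg (hs : s ≠ 0) : Finite (Rg s κ) := by
  have := finite_quot hs
  have := finite_quot (s := (X : F2[X]) ^ (κ + 1)) (pow_ne_zero _ X_ne_zero)
  infer_instance

lemma finite_UA (hs : s ≠ 0) : Finite (UA s κ) := by
  have := finite_Rg (κ := κ) hs
  have : Finite (Rg s κ)ˣ := inferInstance
  exact this

lemma chi_norm (hs : s ≠ 0) (ψ : AddChar (UA s κ) ℂ) (f : F2[X]) : ‖chi s κ ψ f‖ ≤ 1 := by
  have := finite_UA (κ := κ) hs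
  rw [chi]
  split_ifs with h
  · rw [AddChar.norm_apply]
  · simp

lemma chi_cl (ψ : AddChar (UA s κ) ℂ) (f g : F2[X]) (h1 : s ∣ f - g) (h2 : X ^ (κ + 1) ∣ f.reverse - g.reverse) :
    chi s κ ψ f = chi s κ ψ g := by
  have := (cls_eq s κ f g).2 ⟨h1, h2⟩
  simp only [chi, this]

/-- sum over `Mon n` by fibers -/
lemma sum_fiber [Fintype (UA s κ)] (hs : s ≠ 0) (n : ℕ) (hn : s.natDegree + κ ≤ n) (G : UA s κ → ℂ) (F : F2[X] → ℂ)
    (hFG : ∀ f ∈ Mon n, ∀ u : (Rg s κ)ˣ, cls s κ f = u → F f = G (Additive.ofMul u)) :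
    ∑ f ∈ (Mon n).filter (fun f => IsCoprime f s), F f = 2 ^ (n - κ - s.natDegree) * ∑ a, G a := by
  let g : F2[X] → UA s κ := fun f => if h : IsUnit (cls s κ f) then Additive.ofMul h.unit else 0
  rw [← Finset.sum_fiberwise _ g, Finset.mul_sum]
  refine Finset.sum_congr rfl fun a _ => ?_
  have h1 : ((Mon n).filter (fun f => IsCoprime f s)).filter (fun f => g f = a) =
      (Mon n).filter (fun f => cls s κ f = (Additive.toMul a : (Rg s κ)ˣ)) := by
    ext f
    simp only [Finset.mem_filter]
    constructor
    · rintro ⟨⟨hf, hc⟩, hg⟩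
      refine ⟨hf, ?_⟩
      have hu := (isUnit_cls s κ f (mem_Mon'.1 hf).1).2 hc
      rw [← hg]
      simp only [g, dif_pos hu]
      simp
    · rintro ⟨hf, hc⟩
      have hu : IsUnit (cls s κ f) := hc ▸ Units.isUnit _
      refine ⟨⟨hf, (isUnit_cls s κ f (mem_Mon'.1 hf).1).1 hu⟩, ?_⟩
      simp only [g, dif_pos hu]
      apply Additive.toMul.injective
      apply Units.ext
      simp [hc]
  rw [h1]
  have h2 : ∀ f ∈ (Mon n).filter (fun f => cls s κ f = (Additive.toMul a : (Rg s κ)ˣ)), F f = G a := by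
    intro f hf
    rw [Finset.mem_filter] at hf
    rw [hFG f hf.1 _ hf.2]; rfl
  rw [Finset.sum_congr rfl h2, Finset.sum_const, fiber_card s κ hs n hn, nsmul_eq_mul]
  push_cast; ring

lemma chi_Asum (hs : s ≠ 0) (ψ : AddChar (UA s κ) ℂ) (hψ : ψ ≠ 0) (n : ℕ) (hn : s.natDegree + κ ≤ n) :
    Asum (chi s κ ψ) n = 0 := by
  have := finite_UA (κ := κ) hs
  let _ := Fintype.ofFinite (UA s κ)
  rw [Asum]
  have h1 : ∑ f ∈ Mon n, chi s κ ψ f = ∑ f ∈ (Mon n).filter (fun f => IsCoprime f s), chi s κ ψ f := by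
    symm
    apply Finset.sum_subset (Finset.filter_subset _ _)
    intro f hf hn
    rw [Finset.mem_filter, not_and] at hn
    rw [chi, dif_neg]
    rw [isUnit_cls s κ f (mem_Mon'.1 hf).1]
    exact hn hf
  rw [h1, sum_fiber hs n hn (fun a => ψ a) _ (fun f _ u hu => chi_of ψ f u hu),
    AddChar.sum_eq_zero_iff_ne_zero.2 hψ, mul_zero]

variable (Ω : Type) [Field Ω] [IsAlgClosed Ω] [Algebra F2 Ω] [Algebra.IsAlgebraic F2 Ω]

lemma chi_psi (hs : s ≠ 0) (ψ : AddChar (UA s κ) ℂ) (hψ : ψ ≠ 0) (n : ℕ) (hn : 1 ≤ n) :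
    ‖psi Ω (chi s κ ψ) n‖ ≤ (s.natDegree + κ : ℕ) * (Real.sqrt 2) ^ n :=
  weil (chi s κ ψ) (chi_mul ψ) (chi_one ψ) (chi_norm hs ψ) s hs (κ + 1) (chi_cl ψ) (s.natDegree + κ)
    (fun m hm => chi_Asum hs ψ hψ m hm.le) n hn

lemma Fc_mem {n : ℕ} (hn : 1 ≤ n) (c : Ω) (hc : c ∈ fixQ Ω (2 ^ n)) : Fc n c ∈ Mon n := by
  rw [mem_fixQ _ (Nat.one_lt_two_pow (by omega))] at hc
  rw [mem_Mon']
  exact ⟨(Fc_monic n c).ne_zero, Fc_natDegree n c hc⟩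

lemma hayes1 (hs : s ≠ 0) (n : ℕ) (hn1 : 1 ≤ n) (hn : s.natDegree + κ ≤ n) (F : F2[X] → ℂ) (hF : ∀ f, ‖F f‖ ≤ 1)
    (hinv : ∀ f ∈ Mon n, ∀ g ∈ Mon n, s ∣ f - g → (f - g).degree < (n - κ : ℕ) → F f = F g) :
    ‖∑ c ∈ (fixQ Ω (2 ^ n)).filter (fun c => IsCoprime (Fc n c) s), F (Fc n c) -
      (((fixQ Ω (2 ^ n)).filter (fun c => IsCoprime (Fc n c) s)).card : ℂ) /
        ((Mon n).filter (fun f => IsCoprime f s)).card * ∑ f ∈ (Mon n).filter (fun f => IsCoprime f s), F f‖ ≤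
      Real.sqrt (2 ^ (s.natDegree + κ)) * ((s.natDegree + κ : ℕ) * (Real.sqrt 2) ^ n) := by
  have := finite_UA (κ := κ) hs
  let _ := Fintype.ofFinite (UA s κ)
  set J := (fixQ Ω (2 ^ n)).filter (fun c => IsCoprime (Fc n c) s) with hJ
  let x : Ω → UA s κ := fun c => if h : IsUnit (cls s κ (Fc n c)) then Additive.ofMul h.unit else 0
  choose rep hrep1 hrep2 using fun u : (Rg s κ)ˣ => fiber_nonempty s κ hs n hn u
  let G : UA s κ → ℂ := fun a => F (rep a.toMul)
  have hFG : ∀ f ∈ Mon n, ∀ u : (Rg s κ)ˣ, cls s κ f = u → F f = G (Additive.ofMul u) := by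
    intro f hf u hu
    have h1 : cls s κ f = cls s κ (rep u) := by rw [hu, hrep2]
    rw [cls_eq, rev_dvd_iff κ n (by omega) hf (hrep1 u)] at h1
    exact hinv f hf _ (hrep1 u) h1.1 h1.2
  have hxF : ∀ c ∈ J, ∃ u : (Rg s κ)ˣ, cls s κ (Fc n c) = u ∧ x c = Additive.ofMul u := by
    intro c hc
    rw [hJ, Finset.mem_filter] at hc
    have hu := (isUnit_cls s κ (Fc n c) (Fc_monic n c).ne_zero).2 hc.2
    exact ⟨hu.unit, by simp, by simp only [x, dif_pos hu]⟩
  have hcard : (((Mon n).filter (fun f => IsCoprime f s)).card : ℂ) = 2 ^ (n - κ - s.natDegree) * Fintype.card (UA s κ) := by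
    have := sum_fiber hs n hn (fun _ => 1) (fun _ => 1) (fun _ _ _ _ => rfl)
    simpa using this
  have hsumF := sum_fiber hs n hn G F hFG
  have hA : (0 : ℝ) < Fintype.card (UA s κ) := by exact_mod_cast Fintype.card_pos
  have hAc : (Fintype.card (UA s κ) : ℂ) ≠ 0 := by exact_mod_cast hA.ne'
  have hle : Fintype.card (UA s κ) ≤ 2 ^ (s.natDegree + κ) := by
    have h1 : ((Mon n).filter (fun f => IsCoprime f s)).card = 2 ^ (n - κ - s.natDegree) * Fintype.card (UA s κ) := by
      exact_mod_cast hcard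
    have h2 : ((Mon n).filter (fun f => IsCoprime f s)).card ≤ 2 ^ n := by
      have h3 : ((GN n).image (fun g => X ^ n + g)).card = 2 ^ n := by
        rw [Finset.card_image_of_injective _ (add_right_injective _), card_GN]
      rw [← h3]
      apply Finset.card_le_card
      intro f hf
      have hf := (Finset.mem_filter.1 hf).1
      rw [Finset.mem_image]
      refine ⟨f - X ^ n, ?_, by ring⟩
      rw [mem_GN]
      have hd := mem_Mon.1 hf
      rw [← hd]
      apply degree_sub_lt
      · rw [hd, degree_X_pow]
      · exact (mem_Mon'.1 hf).1
      · rw [leadingCoeff_X_pow]; exact monic_F2 (mem_Mon'.1 hf).1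
    rw [h1] at h2
    have h4 : 2 ^ n = 2 ^ (n - κ - s.natDegree) * 2 ^ (s.natDegree + κ) := by
      rw [← pow_add]; congr 1; omega
    rw [h4] at h2
    exact Nat.le_of_mul_le_mul_left h2 (by positivity)
  have key := parseval_bound J x G (fun a => hF _) ((s.natDegree + κ : ℕ) * (Real.sqrt 2) ^ n) (by positivity) (by
    intro ψ hψ
    have h1 := chi_psi Ω hs ψ hψ n hn1
    have h2 : psi Ω (chi s κ ψ) n = ∑ i ∈ J, ψ (x i) := by
      rw [psi, hJ, ← Finset.sum_filter_add_sum_filter_not _ (fun c => IsCoprime (Fc n c) s)]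
      rw [Finset.sum_eq_zero (s := Finset.filter (fun c => ¬ IsCoprime (Fc n c) s) _), add_zero]
      · refine Finset.sum_congr rfl fun c hc => ?_
        obtain ⟨u, hu1, hu2⟩ := hxF c hc
        rw [hu2, chi_of ψ _ u hu1]
      · intro c hc
        rw [chi, dif_neg]
        rw [isUnit_cls s κ _ (Fc_monic n c).ne_zero]
        exact (Finset.mem_filter.1 hc).2
    rwa [h2] at h1)
  have e1 : ∑ c ∈ J, F (Fc n c) = ∑ c ∈ J, G (x c) := by
    refine Finset.sum_congr rfl fun c hc => ?_
    obtain ⟨u, hu1, hu2⟩ := hxF c hc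
    rw [hu2]
    exact hFG _ (Fc_mem Ω hn1 c (Finset.mem_filter.1 hc).1) u hu1
  have e2 : (J.card : ℂ) / ((Mon n).filter (fun f => IsCoprime f s)).card * ∑ f ∈ (Mon n).filter (fun f => IsCoprime f s), F f
      = (J.card : ℂ) / Fintype.card (UA s κ) * ∑ a, G a := by
    rw [hcard, hsumF]
    field_simp
  rw [e1, e2]
  refine key.trans ?_
  gcongr
  exact_mod_cast hle

lemma card_noncop (hs : s ≠ 0) (n : ℕ) :
    ((fixQ Ω (2 ^ n)).filter (fun c => ¬ IsCoprime (Fc n c) s)).card ≤ s.natDegree := by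
  have hm0 : s.map (algebraMap F2 Ω) ≠ 0 := by rwa [Ne, Polynomial.map_eq_zero]
  calc _ ≤ (s.map (algebraMap F2 Ω)).roots.toFinset.card := by
        apply Finset.card_le_card
        intro c hc
        have hc := (Finset.mem_filter.1 hc).2
        rw [Multiset.mem_toFinset, mem_roots hm0, IsRoot, eval_map_algebraMap, ← minpoly.dvd_iff]
        by_contra h
        apply hc
        exact (((minpoly.irreducible (isInt c)).coprime_iff_not_dvd).2 h).pow_left
    _ ≤ _ := Multiset.toFinset_card_le _
    _ ≤ _ := card_roots' _
    _ = _ := natDegree_map _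

lemma card_nonprim (n : ℕ) (hn : 1 ≤ n) :
    ((fixQ Ω (2 ^ n)).filter (fun c => ¬ dg c = n)).card ≤ n * 2 ^ (n / 2) := by
  have := charP_of_F2 (Ω := Ω)
  calc _ ≤ ((Finset.Icc 1 (n / 2)).biUnion (fun j => fixQ Ω (2 ^ j))).card := by
        apply Finset.card_le_card
        intro c hc
        rw [Finset.mem_filter, mem_fixQ _ (Nat.one_lt_two_pow (by omega)), ← dg_dvd_iff] at hc
        obtain ⟨⟨k, hk⟩, h2⟩ := hc
        have hd := dg_pos c
        rw [Finset.mem_biUnion]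
        refine ⟨dg c, ?_, ?_⟩
        · rw [Finset.mem_Icc]
          refine ⟨hd, ?_⟩
          rw [Nat.le_div_iff_mul_le (by norm_num)]
          have : k ≠ 0 := by rintro rfl; omega
          have : k ≠ 1 := by rintro rfl; omega
          rw [hk]; exact Nat.mul_le_mul_left _ (by omega)
        · rw [mem_fixQ _ (Nat.one_lt_two_pow (by omega)), ← dg_dvd_iff]
    _ ≤ ∑ j ∈ Finset.Icc 1 (n / 2), (fixQ Ω (2 ^ j)).card := Finset.card_biUnion_le
    _ ≤ ∑ j ∈ Finset.Icc 1 (n / 2), 2 ^ (n / 2) := by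
        refine Finset.sum_le_sum fun j hj => ?_
        rw [Finset.mem_Icc] at hj
        rw [card_fixQ _ (Nat.one_lt_two_pow (by omega)) (dvd_pow_self 2 (by omega))]
        exact Nat.pow_le_pow_right (by norm_num) hj.2
    _ = (n / 2) * 2 ^ (n / 2) := by simp
    _ ≤ _ := Nat.mul_le_mul_right _ (Nat.div_le_self _ _)

lemma sum_prim (n : ℕ) (hn : 1 ≤ n) (F : F2[X] → ℂ) :
    ∑ c ∈ (fixQ Ω (2 ^ n)).filter (fun c => dg c = n), F (Fc n c) =
      ∑ r ∈ (Mon n).filter Irreducible, (n : ℂ) * F r := by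
  have hmap : ∀ c ∈ (fixQ Ω (2 ^ n)).filter (fun c => dg c = n), Fc n c ∈ (Mon n).filter Irreducible := by
    intro c hc
    rw [Finset.mem_filter] at hc ⊢
    refine ⟨Fc_mem Ω hn c hc.1, ?_⟩
    rw [Fc, hc.2, Nat.div_self (by omega), pow_one]
    exact minpoly.irreducible (isInt c)
  rw [← Finset.sum_fiberwise_of_maps_to hmap]
  refine Finset.sum_congr rfl fun r hr => ?_
  rw [Finset.mem_filter, mem_Mon'] at hr
  obtain ⟨⟨hr0, hrn⟩, hirr⟩ := hr
  rw [Finset.sum_congr rfl (fun c hc => by rw [(Finset.mem_filter.1 hc).2] : ∀ c ∈ _, F (Fc n c) = F r),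
    Finset.sum_const, nsmul_eq_mul]
  congr 2
  have hm0 : r.map (algebraMap F2 Ω) ≠ 0 := by rwa [Ne, Polynomial.map_eq_zero]
  have h1 : ((fixQ Ω (2 ^ n)).filter (fun c => dg c = n)).filter (fun c => Fc n c = r) =
      (r.map (algebraMap F2 Ω)).roots.toFinset := by
    ext c
    rw [Multiset.mem_toFinset, mem_roots hm0, IsRoot, eval_map_algebraMap, ← minpoly.dvd_iff, Finset.mem_filter,
      Finset.mem_filter, mem_fixQ _ (Nat.one_lt_two_pow (by omega)), ← dg_dvd_iff]
    constructor
    · rintro ⟨⟨_, h⟩, h3⟩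
      rw [Fc, h, Nat.div_self (by omega), pow_one] at h3
      rw [h3]
    · intro h
      have h2 : minpoly F2 c = r :=
        eq_of_monic_of_associated (minpoly.monic (isInt c)) (monic_F2 hr0)
          ((minpoly.irreducible (isInt c)).associated_of_dvd hirr h)
      have h3 : dg c = n := by rw [dg, h2, hrn]
      refine ⟨⟨h3 ▸ dvd_rfl, h3⟩, ?_⟩
      rw [Fc, h3, Nat.div_self (by omega), pow_one, h2]
  have hsep : (r.map (algebraMap F2 Ω)).Separable := (PerfectField.separable_of_irreducible hirr).map
  rw [h1, Multiset.toFinset_card_of_nodup (nodup_roots hsep), ← hrn, ← natDegree_map (algebraMap F2 Ω)]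
  exact (IsAlgClosed.splits _).natDegree_eq_card_roots.symm

lemma sum_diff_filter {ι : Type} (S : Finset ι) (p : ι → Prop) (G : ι → ℂ) (hG : ∀ i, ‖G i‖ ≤ 1) (b : ℕ)
    (hb : (S.filter (fun i => ¬ p i)).card ≤ b) : ‖∑ i ∈ S, G i - ∑ i ∈ S.filter p, G i‖ ≤ b := by
  rw [← Finset.sum_filter_add_sum_filter_not S p, add_sub_cancel_left]
  refine (norm_sum_le_of_le _ (fun i _ => hG i)).trans ?_
  simpa using hb

theorem hayes0 (Ω : Type) [Field Ω] [IsAlgClosed Ω] [Algebra F2 Ω] [Algebra.IsAlgebraic F2 Ω] (hs : s ≠ 0) (n : ℕ) (hn1 : 1 ≤ n) (hn : s.natDegree + κ ≤ n) (F : F2[X] → ℂ) (hF : ∀ f, ‖F f‖ ≤ 1)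
    (hinv : ∀ f ∈ Mon n, ∀ g ∈ Mon n, s ∣ f - g → (f - g).degree < (n - κ : ℕ) → F f = F g) :
    ‖∑ r ∈ (Mon n).filter Irreducible, (n : ℂ) * F r -
      (2 : ℂ) ^ n / ((Mon n).filter (fun f => IsCoprime f s)).card * ∑ f ∈ (Mon n).filter (fun f => IsCoprime f s), F f‖ ≤
      Real.sqrt (2 ^ (s.natDegree + κ)) * ((s.natDegree + κ : ℕ) * (Real.sqrt 2) ^ n) + 2 * s.natDegree + n * 2 ^ (n / 2) := by
  have := charP_of_F2 (Ω := Ω)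
  have k1 := hayes1 Ω hs n hn1 hn F hF hinv
  set J := (fixQ Ω (2 ^ n)).filter (fun c => IsCoprime (Fc n c) s) with hJ
  set M := ∑ f ∈ (Mon n).filter (fun f => IsCoprime f s), F f with hM
  set q := ((Mon n).filter (fun f => IsCoprime f s)).card with hq
  have k2 := sum_diff_filter (fixQ Ω (2 ^ n)) (fun c => IsCoprime (Fc n c) s) (fun c => F (Fc n c)) (fun _ => hF _)
    _ (card_noncop Ω hs n)
  have k3 : ‖∑ c ∈ fixQ Ω (2 ^ n), F (Fc n c) - ∑ r ∈ (Mon n).filter Irreducible, (n : ℂ) * F r‖ ≤ (n * 2 ^ (n / 2) : ℕ) := by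
    rw [← sum_prim Ω n hn1 F]
    have h := card_nonprim Ω n hn1
    have := sum_diff_filter (fixQ Ω (2 ^ n)) (fun c => dg c = n) (fun c => F (Fc n c)) (fun _ => hF _)
      (n * 2 ^ (n / 2)) (by convert h)
    convert this
  have k4 : ‖((2 : ℂ) ^ n - J.card) * (M / q)‖ ≤ s.natDegree := by
    have h1 : ‖M / q‖ ≤ 1 := by
      rw [norm_div, Complex.norm_natCast]
      apply div_le_one_of_le₀ _ (by positivity)
      refine (norm_sum_le_of_le _ (fun i _ => hF i)).trans ?_
      simp [hq]
    have h2 : ‖((2 : ℂ) ^ n - J.card)‖ ≤ s.natDegree := by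
      have h3 := sum_diff_filter (fixQ Ω (2 ^ n)) (fun c => IsCoprime (Fc n c) s) (fun c => 1) (fun _ => by simp)
        _ (card_noncop Ω hs n)
      rw [Finset.sum_const, Finset.sum_const, card_fixQ _ (Nat.one_lt_two_pow (by omega)) (dvd_pow_self 2 (by omega))] at h3
      simpa using h3
    rw [norm_mul]
    calc _ ≤ (s.natDegree : ℝ) * 1 := mul_le_mul h2 h1 (norm_nonneg _) (by positivity)
      _ = _ := mul_one _
  set P := ∑ r ∈ (Mon n).filter Irreducible, (n : ℂ) * F r
  set T := ∑ c ∈ fixQ Ω (2 ^ n), F (Fc n c)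
  set T' := ∑ c ∈ J, F (Fc n c)
  have e : P - 2 ^ n / q * M = (T' - J.card / q * M) + (T - T') - (T - P) - (2 ^ n - J.card) * (M / q) := by ring
  rw [e]
  have b1 := norm_sub_le ((T' - J.card / q * M) + (T - T') - (T - P)) ((2 ^ n - J.card) * (M / q))
  have b2 := norm_sub_le ((T' - J.card / q * M) + (T - T')) (T - P)
  have b3 := norm_add_le (T' - J.card / q * M) (T - T')
  push_cast at k3
  linarith
end Chi

theorem hayes {s : F2[X]} {κ : ℕ} (hs : s ≠ 0) (n : ℕ) (hn1 : 1 ≤ n) (hn : s.natDegree + κ ≤ n) (F : F2[X] → ℂ) (hF : ∀ f, ‖F f‖ ≤ 1)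
    (hinv : ∀ f ∈ Mon n, ∀ g ∈ Mon n, s ∣ f - g → (f - g).degree < (n - κ : ℕ) → F f = F g) :
    ‖∑ r ∈ (Mon n).filter Irreducible, (n : ℂ) * F r -
      (2 : ℂ) ^ n / ((Mon n).filter (fun f => IsCoprime f s)).card * ∑ f ∈ (Mon n).filter (fun f => IsCoprime f s), F f‖ ≤
      Real.sqrt (2 ^ (s.natDegree + κ)) * ((s.natDegree + κ : ℕ) * (Real.sqrt 2) ^ n) + 2 * s.natDegree + n * 2 ^ (n / 2) :=
  hayes0 (AlgebraicClosure F2) hs n hn1 hn F hF hinv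

lemma GN_succ_sum (n : ℕ) (G : F2[X] → ℝ) : ∑ f ∈ GN (n + 1), G f = ∑ f ∈ GN n, G f + ∑ f ∈ Mon n, G f := by
  rw [← Finset.sum_union]
  · refine Finset.sum_congr ?_ fun _ _ => rfl
    ext f
    rw [Finset.mem_union, mem_GN, mem_GN, mem_Mon]
    have : ((n + 1 : ℕ) : WithBot ℕ) = (n : WithBot ℕ) + 1 := by push_cast; rfl
    by_cases hf : f = 0
    · subst hf; simp [WithBot.bot_lt_coe]
    rw [degree_eq_natDegree hf]
    norm_cast
    omega
  · rw [Finset.disjoint_left]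
    intro f h1 h2
    rw [mem_GN] at h1
    rw [mem_Mon.1 h2] at h1
    exact lt_irrefl _ h1

lemma GN_split_sum (d N : ℕ) (h : d ≤ N) (G : F2[X] → ℝ) :
    ∑ f ∈ GN N, G f = ∑ f ∈ GN d, G f + ∑ n ∈ Finset.Ico d N, ∑ f ∈ Mon n, G f := by
  induction N, h using Nat.le_induction with
  | base => simp
  | succ n hn ih => rw [GN_succ_sum, ih, Finset.sum_Ico_succ_top hn]; ring

lemma mem_GN_mul {s : F2[X]} (hs : s ≠ 0) (N : ℕ) (q : F2[X]) (hN : s.natDegree ≤ N) : s * q ∈ GN N ↔ q ∈ GN (N - s.natDegree) := by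
  rw [mem_GN, mem_GN]
  by_cases hq0 : q = 0
  · simp [hq0, WithBot.bot_lt_coe]
  rw [degree_mul, degree_eq_natDegree hs, degree_eq_natDegree hq0]
  norm_cast
  omega

lemma GN_add {N : ℕ} {f g : F2[X]} (hf : f ∈ GN N) (hg : g ∈ GN N) : f + g ∈ GN N := by
  rw [mem_GN] at *
  exact (degree_add_le _ _).trans_lt (max_lt hf hg)

lemma GN_mono {M N : ℕ} (h : M ≤ N) {f : F2[X]} (hf : f ∈ GN M) : f ∈ GN N := by
  rw [mem_GN] at *
  exact hf.trans_le (by exact_mod_cast h)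

lemma mod_mem {s : F2[X]} (hs : s ≠ 0) (f : F2[X]) : f %ₘ s ∈ GN s.natDegree := by
  rw [mem_GN, ← degree_eq_natDegree hs]
  exact degree_modByMonic_lt _ (monic_F2 hs)

lemma periodic_GN {s : F2[X]} (hs : s ≠ 0) (N : ℕ) (hN : s.natDegree ≤ N) (G : F2[X] → ℝ)
    (hG : ∀ f g, s ∣ f - g → G f = G g) :
    ∑ f ∈ GN N, G f = 2 ^ (N - s.natDegree) * ∑ a ∈ GN s.natDegree, G a := by
  have h1 : ∑ f ∈ GN N, G f = ∑ p ∈ GN (N - s.natDegree) ×ˢ GN s.natDegree, G p.2 := by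
    symm
    apply Finset.sum_bij (fun p _ => s * p.1 + p.2)
    · intro p hp
      rw [Finset.mem_product] at hp
      exact GN_add ((mem_GN_mul hs N _ hN).2 hp.1) (GN_mono hN hp.2)
    · rintro ⟨q, a⟩ hp ⟨q', a'⟩ hp' h
      rw [Finset.mem_product, mem_GN] at hp hp'
      simp only at h hp hp'
      rw [mem_GN, ← degree_eq_natDegree hs] at hp hp'
      have e1 := div_modByMonic_unique q a (monic_F2 hs) ⟨by rw [add_comm], hp.2⟩
      have e2 := div_modByMonic_unique q' a' (monic_F2 hs) ⟨by rw [add_comm], hp'.2⟩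
      rw [h] at e1
      rw [Prod.mk.injEq]
      exact ⟨e1.1.symm.trans e2.1, e1.2.symm.trans e2.2⟩
    · intro f hf
      have h := modByMonic_add_div f s
      refine ⟨(f /ₘ s, f %ₘ s), ?_, by simp only; rw [add_comm]; exact h⟩
      rw [Finset.mem_product]
      refine ⟨?_, mod_mem hs f⟩
      simp only
      rw [← mem_GN_mul hs N _ hN]
      have : s * (f /ₘ s) = f + (-(f %ₘ s)) := by linear_combination h
      rw [this]
      apply GN_add hf
      have := GN_mono hN (mod_mem hs f)
      rw [mem_GN] at this ⊢
      rwa [degree_neg]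
    · intro p hp
      apply hG
      exact ⟨-p.1, by ring⟩
  rw [h1, Finset.sum_product]
  simp only
  rw [Finset.sum_const, card_GN, nsmul_eq_mul]; push_cast; rfl

lemma periodic_Mon {s : F2[X]} (hs : s ≠ 0) (n : ℕ) (hn : s.natDegree ≤ n) (G : F2[X] → ℝ)
    (hG : ∀ f g, s ∣ f - g → G f = G g) :
    ∑ f ∈ Mon n, G f = 2 ^ (n - s.natDegree) * ∑ a ∈ GN s.natDegree, G a := by
  have h1 := GN_succ_sum n G
  rw [periodic_GN hs n hn G hG, periodic_GN hs (n + 1) (by omega) G hG,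
    show n + 1 - s.natDegree = n - s.natDegree + 1 by omega, pow_succ] at h1
  linarith

lemma coprime_congr {s f g : F2[X]} (h : s ∣ f - g) : IsCoprime f s ↔ IsCoprime g s := by
  obtain ⟨q, hq⟩ := h
  have : f = g + s * q := by linear_combination hq
  rw [this, IsCoprime.add_mul_left_left_iff]

lemma card_cop_Mon {s : F2[X]} (hs : s ≠ 0) (n : ℕ) (hn : s.natDegree ≤ n) :
    (((Mon n).filter (fun f => IsCoprime f s)).card : ℝ) = 2 ^ (n - s.natDegree) * phi s := by
  have h := periodic_Mon hs n hn (fun f => if IsCoprime f s then 1 else 0) (by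
    intro f g h; simp only [coprime_congr h])
  rw [Finset.sum_boole, Finset.sum_boole] at h
  rw [h, phi]

lemma phi_pos {s : F2[X]} (hs : s ≠ 0) : 0 < phi s := by
  rw [phi, Finset.card_pos]
  by_cases h : s.natDegree = 0
  · refine ⟨0, ?_⟩
    rw [Finset.mem_filter]
    refine ⟨by rw [mem_GN]; simp [WithBot.bot_lt_coe], ?_⟩
    rw [isCoprime_zero_left]
    rw [(Polynomial.Monic.natDegree_eq_zero (monic_F2 hs)).1 h]; exact isUnit_one
  · refine ⟨1, ?_⟩
    rw [Finset.mem_filter]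
    refine ⟨?_, isCoprime_one_left⟩
    rw [mem_GN, degree_one]
    exact_mod_cast Nat.pos_of_ne_zero h

/-- weight on primes -/
def lam (f : F2[X]) : ℝ := if Irreducible f then (f.natDegree : ℝ) else 0

lemma lam_nonneg (f : F2[X]) : 0 ≤ lam f := by
  rw [lam]; split_ifs <;> positivity

def E0 (N : ℕ) : ℝ := 8 * (N + 1) ^ 2 * (2 : ℝ) ^ ((3 / 4 : ℝ) * N)

lemma pnt_Mon (N n : ℕ) (hnN : n < N) {s : F2[X]} (hs : s ≠ 0) (hd : s.natDegree ≤ N / 2) (hdn : s.natDegree ≤ n)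
    (F : F2[X] → ℝ) (hF : ∀ f, |F f| ≤ 1) (hper : ∀ f, ∀ q ∈ GN (N / 2), F (f + s * q) = F f) :
    |∑ f ∈ Mon n, lam f * F f - 2 ^ s.natDegree / phi s * ∑ f ∈ (Mon n).filter (fun f => IsCoprime f s), F f| ≤
      4 * N * (2 : ℝ) ^ ((3 / 4 : ℝ) * N) := by
  have hφ : (0 : ℝ) < phi s := by exact_mod_cast phi_pos hs
  set d := s.natDegree with hd'
  have hcop := card_cop_Mon hs n hdn
  rw [← hd'] at hcop
  have hN1 : (1 : ℝ) ≤ N := by exact_mod_cast (by omega : 1 ≤ N)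
  have hone : (1 : ℝ) ≤ (2 : ℝ) ^ ((3 / 4 : ℝ) * N) := Real.one_le_rpow (by norm_num) (by positivity)
  rcases Nat.eq_zero_or_pos n with rfl | hn1
  · have h0 : ∑ f ∈ Mon 0, lam f * F f = 0 := by
      rw [Mon_zero, Finset.sum_singleton, lam, if_neg not_irreducible_one, zero_mul]
    rw [h0, zero_sub, abs_neg, abs_mul]
    have h1 : |∑ f ∈ (Mon 0).filter (fun f => IsCoprime f s), F f| ≤ phi s := by
      refine (Finset.abs_sum_le_sum_abs _ _).trans ((Finset.sum_le_sum fun i _ => hF i).trans ?_)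
      rw [Finset.sum_const, nsmul_eq_mul, hcop, show d = 0 by omega]; simp
    calc _ ≤ |(2 : ℝ) ^ d / phi s| * phi s := by gcongr
      _ = 1 := by rw [abs_of_nonneg (by positivity), show d = 0 by omega]; field_simp
      _ ≤ _ := by nlinarith
  let κ := n - (d + N / 2)
  have h := hayes (κ := κ) hs n hn1 (by omega) (fun f => (F f : ℂ)) (fun f => by
      rw [Complex.norm_real]; exact hF f) (by
    intro f _ g _ hsd hdeg
    obtain ⟨q, hq⟩ := hsd
    have : f = g + s * q := by linear_combination hq
    congr 1
    rw [this]
    apply hper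
    rw [hq] at hdeg
    have h2 := (mem_GN_mul hs (n - κ) q (by omega)).1 (mem_GN.2 hdeg)
    exact GN_mono (by omega) h2)
  have e1 : ((∑ f ∈ Mon n, lam f * F f : ℝ) : ℂ) = ∑ r ∈ (Mon n).filter Irreducible, (n : ℂ) * (F r : ℂ) := by
    rw [Finset.sum_filter]
    push_cast
    refine Finset.sum_congr rfl fun f hf => ?_
    rw [lam]
    split_ifs
    · rw [(mem_Mon'.1 hf).2]; push_cast; rfl
    · simp
  have e2 : (2 : ℂ) ^ n / (((Mon n).filter (fun f => IsCoprime f s)).card : ℂ) = ((2 ^ d / phi s : ℝ) : ℂ) := by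
    have : ((((Mon n).filter (fun f => IsCoprime f s)).card : ℝ) : ℂ) = ((2 ^ (n - d) * phi s : ℝ) : ℂ) := by rw [hcop]
    rw [Complex.ofReal_natCast] at this
    rw [this, ← Nat.sub_add_cancel hdn, pow_add]
    have h2 : (phi s : ℂ) ≠ 0 := by exact_mod_cast hφ.ne'
    push_cast
    rw [Nat.sub_add_cancel hdn]
    field_simp
    try simp
  rw [← e1, e2] at h
  have h3 : ‖((∑ f ∈ Mon n, lam f * F f - 2 ^ d / phi s * ∑ f ∈ (Mon n).filter (fun f => IsCoprime f s), F f : ℝ) : ℂ)‖ ≤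
      Real.sqrt (2 ^ (d + κ)) * ((d + κ : ℕ) * (Real.sqrt 2) ^ n) + 2 * d + n * 2 ^ (n / 2) := by
    push_cast at h ⊢
    exact h
  rw [Complex.norm_real, Real.norm_eq_abs] at h3
  refine h3.trans ?_
  have hsq2 : Real.sqrt 2 = (2 : ℝ) ^ (1 / 2 : ℝ) := Real.sqrt_eq_rpow 2
  have b1 : Real.sqrt (2 ^ (d + κ)) * (Real.sqrt 2) ^ n ≤ 2 * (2 : ℝ) ^ ((3 / 4 : ℝ) * N) := by
    rw [Real.sqrt_eq_rpow, hsq2, ← Real.rpow_natCast, ← Real.rpow_natCast, ← Real.rpow_mul (by norm_num),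
      ← Real.rpow_mul (by norm_num), ← Real.rpow_add (by norm_num)]
    have h21 : 2 * (2 : ℝ) ^ ((3 / 4 : ℝ) * N) = (2 : ℝ) ^ (1 + (3 / 4 : ℝ) * N) := by
      rw [Real.rpow_add (by norm_num), Real.rpow_one]
    rw [h21]
    apply Real.rpow_le_rpow_of_exponent_le (by norm_num)
    have c1 : ((2 * (d + κ) : ℕ) : ℝ) ≤ ((N + 1 : ℕ) : ℝ) := by exact_mod_cast (by omega : 2 * (d + κ) ≤ N + 1)
    have c2 : (n : ℝ) ≤ N := by exact_mod_cast hnN.le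
    push_cast at c1 ⊢
    linarith
  have b2 : (2 * d : ℝ) ≤ N := by exact_mod_cast (by omega : 2 * d ≤ N)
  have b3 : ((2 : ℝ) ^ (n / 2)) ≤ (2 : ℝ) ^ ((3 / 4 : ℝ) * N) := by
    rw [← Real.rpow_natCast]
    apply Real.rpow_le_rpow_of_exponent_le (by norm_num)
    have c1 : ((2 * (n / 2) : ℕ) : ℝ) ≤ (N : ℝ) := by exact_mod_cast (by omega : 2 * (n / 2) ≤ N)
    push_cast at c1 ⊢
    linarith
  have b4 : ((d + κ : ℕ) : ℝ) ≤ N := by exact_mod_cast (by omega : d + κ ≤ N)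
  have b5 : (n : ℝ) ≤ N := by exact_mod_cast hnN.le
  set E := (2 : ℝ) ^ ((3 / 4 : ℝ) * N)
  have c1 : Real.sqrt (2 ^ (d + κ)) * (((d + κ : ℕ) : ℝ) * (Real.sqrt 2) ^ n) ≤ N * (2 * E) := by
    calc _ = ((d + κ : ℕ) : ℝ) * (Real.sqrt (2 ^ (d + κ)) * (Real.sqrt 2) ^ n) := by ring
      _ ≤ _ := by gcongr
  have c2 : (n : ℝ) * 2 ^ (n / 2) ≤ N * E := by gcongr
  have c3 : (N : ℝ) ≤ N * E := by nlinarith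
  linarith

theorem pnt (N : ℕ) {s : F2[X]} (hs : s ≠ 0) (hd : s.natDegree ≤ N / 2)
    (F : F2[X] → ℝ) (hF : ∀ f, |F f| ≤ 1) (hper : ∀ f, ∀ q ∈ GN (N / 2), F (f + s * q) = F f) :
    |∑ f ∈ GN N, lam f * F f - 2 ^ s.natDegree / phi s * ∑ f ∈ (GN N).filter (fun f => IsCoprime f s), F f| ≤ E0 N := by
  have hφ : (0 : ℝ) < phi s := by exact_mod_cast phi_pos hs
  have hdN : s.natDegree ≤ N := hd.trans (Nat.div_le_self _ _)
  set E := (2 : ℝ) ^ ((3 / 4 : ℝ) * N) with hE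
  have hone : (1 : ℝ) ≤ E := Real.one_le_rpow (by norm_num) (by positivity)
  have hpow : (2 : ℝ) ^ s.natDegree ≤ E := by
    rw [← Real.rpow_natCast]
    apply Real.rpow_le_rpow_of_exponent_le (by norm_num)
    have c1 : ((2 * s.natDegree : ℕ) : ℝ) ≤ (N : ℝ) := by exact_mod_cast (by omega : 2 * s.natDegree ≤ N)
    push_cast at c1 ⊢
    linarith
  have hb : (s.natDegree : ℝ) ≤ N := by exact_mod_cast hdN
  rw [Finset.sum_filter, GN_split_sum _ N hdN, GN_split_sum _ N hdN]
  have e : ∀ a b c d k : ℝ, a + b - k * (c + d) = a - k * c + (b - k * d) := by intros; ring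
  rw [e, Finset.mul_sum (s := Finset.Ico _ _), ← Finset.sum_sub_distrib (s := Finset.Ico _ _)]
  refine (abs_add_le _ _).trans ?_
  have k1 : |∑ f ∈ GN s.natDegree, lam f * F f - 2 ^ s.natDegree / phi s * ∑ f ∈ GN s.natDegree, if IsCoprime f s then F f else 0|
      ≤ (N + 1) * E := by
    refine (abs_sub _ _).trans ?_
    have l1 : |∑ f ∈ GN s.natDegree, lam f * F f| ≤ N * E := by
      refine (Finset.abs_sum_le_sum_abs _ _).trans ?_
      calc ∑ f ∈ GN s.natDegree, |lam f * F f| ≤ ∑ f ∈ GN s.natDegree, (N : ℝ) := by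
            refine Finset.sum_le_sum fun f hf => ?_
            rw [abs_mul, abs_of_nonneg (lam_nonneg f)]
            have : lam f ≤ N := by
              rw [lam]
              split_ifs with hi
              · rw [mem_GN, degree_eq_natDegree hi.ne_zero] at hf
                have : f.natDegree < s.natDegree := by exact_mod_cast hf
                exact_mod_cast (this.le.trans hdN)
              · positivity
            calc _ ≤ (N : ℝ) * 1 := mul_le_mul this (hF f) (abs_nonneg _) (by positivity)
              _ = _ := mul_one _
        _ = 2 ^ s.natDegree * N := by rw [Finset.sum_const, card_GN, nsmul_eq_mul]; push_cast; rfl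
        _ ≤ _ := by rw [mul_comm]; gcongr
    have l2 : |2 ^ s.natDegree / (phi s : ℝ) * ∑ f ∈ GN s.natDegree, if IsCoprime f s then F f else 0| ≤ E := by
      rw [← Finset.sum_filter, abs_mul, abs_of_nonneg (by positivity : (0 : ℝ) ≤ 2 ^ s.natDegree / (phi s : ℝ))]
      have : |∑ f ∈ (GN s.natDegree).filter (fun f => IsCoprime f s), F f| ≤ phi s := by
        refine (Finset.abs_sum_le_sum_abs _ _).trans ((Finset.sum_le_sum fun i _ => hF i).trans ?_)
        rw [Finset.sum_const, nsmul_eq_mul, phi]; simp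
      calc _ ≤ 2 ^ s.natDegree / (phi s : ℝ) * phi s := by gcongr
        _ = 2 ^ s.natDegree := by field_simp
        _ ≤ _ := hpow
    linarith
  have k2 : |∑ n ∈ Finset.Ico s.natDegree N, (∑ f ∈ Mon n, lam f * F f -
      2 ^ s.natDegree / phi s * ∑ f ∈ Mon n, if IsCoprime f s then F f else 0)| ≤ N * (4 * N * E) := by
    refine (Finset.abs_sum_le_sum_abs _ _).trans ?_
    calc _ ≤ ∑ n ∈ Finset.Ico s.natDegree N, 4 * N * E := by
          refine Finset.sum_le_sum fun n hn => ?_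
          rw [Finset.mem_Ico] at hn
          rw [← Finset.sum_filter]
          exact pnt_Mon N n hn.2 hs hd hn.1 F hF hper
      _ = (N - s.natDegree : ℕ) * (4 * N * E) := by rw [Finset.sum_const, Nat.card_Ico, nsmul_eq_mul]
      _ ≤ _ := by
          have : ((N - s.natDegree : ℕ) : ℝ) ≤ N := by exact_mod_cast Nat.sub_le _ _
          gcongr
  rw [E0, ← hE]
  have hN0 : (0 : ℝ) ≤ N := by positivity
  nlinarith [mul_nonneg hN0 (by linarith : 0 ≤ E), mul_nonneg (mul_nonneg hN0 hN0) (by linarith : 0 ≤ E)]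

/-- periodic version -/
theorem pnt_per (N : ℕ) {s : F2[X]} (hs : s ≠ 0) (hd : s.natDegree ≤ N / 2)
    (F : F2[X] → ℝ) (hF : ∀ f, |F f| ≤ 1) (hper : ∀ f g, s ∣ f - g → F f = F g) :
    |∑ f ∈ GN N, lam f * F f - 2 ^ N * ((∑ a ∈ residues s, F a) / phi s)| ≤ E0 N := by
  have h := pnt N hs hd F hF (fun f q _ => hper _ _ ⟨q, by ring⟩)
  have hdN : s.natDegree ≤ N := hd.trans (Nat.div_le_self _ _)
  rw [Finset.sum_filter, periodic_GN hs N hdN (fun f => if IsCoprime f s then F f else 0) (by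
    intro f g h; simp only [coprime_congr h, hper f g h])] at h
  convert h using 3
  rw [← Finset.sum_filter, residues]
  have : (2 : ℝ) ^ N = 2 ^ s.natDegree * 2 ^ (N - s.natDegree) := by rw [← pow_add]; congr 1; omega
  rw [this]; ring

lemma irr_coprime {r r' : F2[X]} (h : Irreducible r) (h' : Irreducible r') (hne : r ≠ r') : IsCoprime r r' := by
  rw [h.coprime_iff_not_dvd]
  intro hd
  exact hne (eq_of_monic_of_associated (monic_F2 h.ne_zero) (monic_F2 h'.ne_zero) (h.associated_of_dvd h' hd))

lemma prod_ne {w : Finset F2[X]} (hw : ∀ r ∈ w, Irreducible r) : ∏ r ∈ w, r ≠ 0 :=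
  Finset.prod_ne_zero_iff.2 fun r hr => (hw r hr).ne_zero

lemma prod_natDegree {w : Finset F2[X]} (hw : ∀ r ∈ w, Irreducible r) : (∏ r ∈ w, r).natDegree = ∑ r ∈ w, r.natDegree :=
  natDegree_prod _ _ fun r hr => (hw r hr).ne_zero

lemma coprime_prod {w : Finset F2[X]} (hw : ∀ r ∈ w, Irreducible r) {r : F2[X]} (hr : Irreducible r) (hn : r ∉ w) :
    IsCoprime r (∏ r ∈ w, r) :=
  IsCoprime.prod_right fun r' hr' => irr_coprime hr (hw r' hr') (fun h => hn (h ▸ hr'))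

lemma mem_residues {s a : F2[X]} : a ∈ residues s ↔ a ∈ GN s.natDegree ∧ IsCoprime a s := by
  rw [residues, Finset.mem_filter]

lemma mod_sub (f : F2[X]) (s : F2[X]) : s ∣ f %ₘ s - f :=
  ⟨-(f /ₘ s), by linear_combination modByMonic_add_div f s⟩

lemma mod_residues {s : F2[X]} (hs : s ≠ 0) {f : F2[X]} (h : IsCoprime f s) : f %ₘ s ∈ residues s := by
  rw [mem_residues]
  exact ⟨mod_mem hs f, (coprime_congr (mod_sub f s)).2 h⟩

lemma GN_sub {N : ℕ} {f g : F2[X]} (hf : f ∈ GN N) (hg : g ∈ GN N) : f - g ∈ GN N := by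
  rw [mem_GN] at *
  exact (degree_sub_le _ _).trans_lt (max_lt hf hg)

lemma eq_of_GN {s f g : F2[X]} (hs : s ≠ 0) (hf : f ∈ GN s.natDegree) (hg : g ∈ GN s.natDegree) (h : s ∣ f - g) : f = g := by
  have h1 := GN_sub hf hg
  rw [mem_GN, ← degree_eq_natDegree hs] at h1
  rw [← sub_eq_zero]
  exact eq_zero_of_dvd_of_degree_lt h h1

lemma crt_sum {r s : F2[X]} (hr : r ≠ 0) (hs : s ≠ 0) (hc : IsCoprime r s) (g1 g2 : F2[X] → ℝ)
    (h1 : ∀ f g, r ∣ f - g → g1 f = g1 g) (h2 : ∀ f g, s ∣ f - g → g2 f = g2 g) :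
    ∑ a ∈ residues (r * s), g1 a * g2 a = (∑ a ∈ residues r, g1 a) * ∑ a ∈ residues s, g2 a := by
  have hrs : r * s ≠ 0 := mul_ne_zero hr hs
  rw [Finset.sum_mul_sum, ← Finset.sum_product']
  apply Finset.sum_bij (fun a _ => (a %ₘ r, a %ₘ s))
  · intro a ha
    have ha2 := (mem_residues.1 ha).2
    rw [IsCoprime.mul_right_iff] at ha2
    rw [Finset.mem_product]
    exact ⟨mod_residues hr ha2.1, mod_residues hs ha2.2⟩
  · intro a ha b hb hab
    rw [Prod.mk.injEq] at hab
    apply eq_of_GN hrs (mem_residues.1 ha).1 (mem_residues.1 hb).1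
    apply hc.mul_dvd
    · have := dvd_sub (mod_sub b r) (mod_sub a r)
      rw [hab.1] at this
      convert this using 1; ring
    · have := dvd_sub (mod_sub b s) (mod_sub a s)
      rw [hab.2] at this
      convert this using 1; ring
  · rintro ⟨a, b⟩ hab
    rw [Finset.mem_product, mem_residues, mem_residues] at hab
    simp only at hab
    obtain ⟨⟨ha1, ha2⟩, hb1, hb2⟩ := hab
    obtain ⟨x, y, hxy⟩ := hc
    let f := a * (y * s) + b * (x * r)
    have hfr : r ∣ f - a := ⟨x * (b - a), by simp only [f]; linear_combination a * hxy⟩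
    have hfs : s ∣ f - b := ⟨y * (a - b), by simp only [f]; linear_combination b * hxy⟩
    have hm := mod_sub f (r * s)
    have hmr : r ∣ f %ₘ (r * s) - a := by
      have := dvd_add ((dvd_mul_right r s).trans hm) hfr
      convert this using 1; ring
    have hms : s ∣ f %ₘ (r * s) - b := by
      have := dvd_add ((dvd_mul_left s r).trans hm) hfs
      convert this using 1; ring
    refine ⟨f %ₘ (r * s), ?_, ?_⟩
    · apply mod_residues hrs
      rw [IsCoprime.mul_right_iff]
      exact ⟨(coprime_congr hfr).2 ha2, (coprime_congr hfs).2 hb2⟩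
    · rw [Prod.mk.injEq]
      constructor
      · apply eq_of_GN hr (mod_mem hr _) ha1
        have := dvd_add (mod_sub (f %ₘ (r * s)) r) hmr
        convert this using 1; ring
      · apply eq_of_GN hs (mod_mem hs _) hb1
        have := dvd_add (mod_sub (f %ₘ (r * s)) s) hms
        convert this using 1; ring
  · intro a ha
    simp only
    rw [h1 _ _ (mod_sub a r), h2 _ _ (mod_sub a s)]

lemma residues_one : residues (1 : F2[X]) = {0} := by
  ext a
  rw [mem_residues, mem_GN, natDegree_one, Finset.mem_singleton]
  constructor
  · rintro ⟨h, _⟩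
    have : a.degree < 0 := by exact_mod_cast h
    by_contra h0
    rw [degree_eq_natDegree h0] at this
    exact absurd this (by simp)
  · rintro rfl
    exact ⟨by rw [degree_zero]; exact WithBot.bot_lt_coe _, isCoprime_one_right⟩

lemma crt_prod {w : Finset F2[X]} (hw : ∀ r ∈ w, Irreducible r) (g : F2[X] → F2[X] → ℝ)
    (hg : ∀ r ∈ w, ∀ f f', r ∣ f - f' → g r f = g r f') :
    ∑ a ∈ residues (∏ r ∈ w, r), ∏ r ∈ w, g r a = ∏ r ∈ w, ∑ a ∈ residues r, g r a := by
  induction w using Finset.induction_on with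
  | empty => simp [residues_one]
  | insert r w hr ih =>
    have hw' : ∀ r ∈ w, Irreducible r := fun r' h => hw r' (Finset.mem_insert_of_mem h)
    have hrr := hw r (Finset.mem_insert_self _ _)
    have ih' := ih hw' (fun r' h => hg r' (Finset.mem_insert_of_mem h))
    have hper : ∀ f f' : F2[X], (∏ r ∈ w, r) ∣ f - f' → ∏ r ∈ w, g r f = ∏ r ∈ w, g r f' := by
      intro f f' h
      refine Finset.prod_congr rfl fun r' hr' => ?_
      exact hg r' (Finset.mem_insert_of_mem hr') f f' ((Finset.dvd_prod_of_mem (fun r => r) hr').trans h)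
    have key := crt_sum hrr.ne_zero (prod_ne hw') (coprime_prod hw' hrr hr) (g r) (fun a => ∏ r ∈ w, g r a)
      (hg r (Finset.mem_insert_self _ _)) hper
    rw [Finset.prod_insert hr, Finset.prod_insert hr, ← ih', ← key]
    refine Finset.sum_congr rfl fun a _ => ?_
    rw [Finset.prod_insert hr]

lemma phi_eq_card (s : F2[X]) : phi s = (residues s).card := rfl

lemma phi_prod {w : Finset F2[X]} (hw : ∀ r ∈ w, Irreducible r) : (phi (∏ r ∈ w, r) : ℝ) = ∏ r ∈ w, (phi r : ℝ) := by
  have := crt_prod hw (fun _ _ => 1) (fun _ _ _ _ _ => rfl)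
  simpa [phi_eq_card] using this

lemma residues_irr {r : F2[X]} (hr : Irreducible r) : residues r = (GN r.natDegree).erase 0 := by
  ext a
  rw [mem_residues, Finset.mem_erase]
  constructor
  · rintro ⟨h1, h2⟩
    refine ⟨?_, h1⟩
    rintro rfl
    rw [isCoprime_zero_left] at h2
    exact hr.not_isUnit h2
  · rintro ⟨h1, h2⟩
    refine ⟨h2, ?_⟩
    rw [isCoprime_comm, hr.coprime_iff_not_dvd]
    intro h
    apply h1
    rw [mem_GN, ← degree_eq_natDegree hr.ne_zero] at h2
    exact eq_zero_of_dvd_of_degree_lt h h2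

lemma zero_mem_GN (n : ℕ) : (0 : F2[X]) ∈ GN n := by
  rw [mem_GN, degree_zero]; exact WithBot.bot_lt_coe _

lemma phi_irr {r : F2[X]} (hr : Irreducible r) : (phi r : ℝ) = 2 ^ r.natDegree - 1 := by
  rw [phi_eq_card, residues_irr hr, Finset.card_erase_of_mem (zero_mem_GN _), card_GN,
    Nat.cast_sub Nat.one_le_two_pow]
  push_cast; rfl

lemma prod_bound (w : Finset F2[X]) (t : F2[X] → ℝ) (D : ℕ) (M : ℝ) (hM : 1 ≤ M) (h0 : ∀ r ∈ w, 0 ≤ t r)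
    (h1 : ∀ r ∈ w, t r ≤ M) (h2 : ∀ r ∈ w, D ≤ r.natDegree → t r ≤ 1) : ∏ r ∈ w, t r ≤ M ^ (2 ^ D) := by
  calc ∏ r ∈ w, t r ≤ ∏ r ∈ w, if r.natDegree < D then M else 1 := by
        refine Finset.prod_le_prod h0 fun r hr => ?_
        split_ifs with h
        · exact h1 r hr
        · exact h2 r hr (by omega)
    _ = M ^ (w.filter (fun r => r.natDegree < D)).card := by
        rw [Finset.prod_ite, Finset.prod_const, Finset.prod_const_one, mul_one]
    _ ≤ _ := by
        apply pow_le_pow_right₀ hM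
        rw [← card_GN]
        apply Finset.card_le_card
        intro r hr
        rw [mem_GN]
        have := (Finset.mem_filter.1 hr).2
        exact (degree_le_natDegree).trans_lt (by exact_mod_cast this)

lemma two_rpow_nat (n : ℕ) : (2 : ℝ) ^ (n : ℝ) = 2 ^ n := Real.rpow_natCast 2 n

lemma q_bound {δ : ℝ} (hδ : 0 < δ) (hδ1 : δ ≤ 1) {D : ℕ} (hD : 5 ≤ (2 : ℝ) ^ (δ * D)) {n : ℕ} (hn : D ≤ n) :
    5 * (2 : ℝ) ^ ((1 - δ) * n) ≤ 2 ^ n := by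
  have : (2 : ℝ) ^ n = (2 : ℝ) ^ (δ * n) * (2 : ℝ) ^ ((1 - δ) * n) := by
    rw [← Real.rpow_add (by norm_num), ← two_rpow_nat]; congr 1; ring
  rw [this]
  gcongr
  refine hD.trans (Real.rpow_le_rpow_of_exponent_le (by norm_num) ?_)
  gcongr

lemma q_one {δ : ℝ} (hδ1 : δ ≤ 1) (n : ℕ) : 1 ≤ (2 : ℝ) ^ ((1 - δ) * n) :=
  Real.one_le_rpow (by norm_num) (mul_nonneg (by linarith) (by positivity))

lemma q_le {δ : ℝ} (hδ : 0 < δ) (n : ℕ) : (2 : ℝ) ^ ((1 - δ) * n) ≤ 2 ^ n := by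
  rw [← two_rpow_nat]
  apply Real.rpow_le_rpow_of_exponent_le (by norm_num)
  have : (0 : ℝ) ≤ n := by positivity
  nlinarith

lemma phi_irr_ge {r : F2[X]} (hr : Irreducible r) : (2 : ℝ) ^ r.natDegree ≤ 2 * phi r ∧ 1 ≤ (phi r : ℝ) := by
  rw [phi_irr hr]
  have h1 : 1 ≤ r.natDegree := hr.natDegree_pos
  have : (2 : ℝ) ^ 1 ≤ 2 ^ r.natDegree := pow_le_pow_right₀ (by norm_num) h1
  constructor <;> linarith

lemma prod_rpow {w : Finset F2[X]} (a : ℝ) : (2 : ℝ) ^ (a * ((∑ r ∈ w, r.natDegree : ℕ) : ℝ)) = ∏ r ∈ w, (2 : ℝ) ^ (a * r.natDegree) := by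
  rw [← Real.rpow_sum_of_pos (by norm_num)]
  congr 1
  push_cast
  rw [Finset.mul_sum]

lemma phi_lower {δ : ℝ} (hδ : 0 < δ) (hδ1 : δ ≤ 1) {D : ℕ} (hD : 5 ≤ (2 : ℝ) ^ (δ * D)) {w : Finset F2[X]}
    (hw : ∀ r ∈ w, Irreducible r) :
    (2 : ℝ) ^ ((1 - δ) * ((∑ r ∈ w, r.natDegree : ℕ) : ℝ)) ≤ 8 ^ (2 ^ D) * phi (∏ r ∈ w, r) := by
  rw [prod_rpow, phi_prod hw, ← div_le_iff₀, ← Finset.prod_div_distrib]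
  · apply prod_bound
    · norm_num
    · intro r hr; positivity
    · intro r hr
      obtain ⟨h1, h2⟩ := phi_irr_ge (hw r hr)
      rw [div_le_iff₀ (by linarith)]
      have := q_le hδ r.natDegree
      linarith
    · intro r hr hd
      obtain ⟨h1, h2⟩ := phi_irr_ge (hw r hr)
      have h3 := q_bound hδ hδ1 hD hd
      have h4 := q_one hδ1 r.natDegree
      rw [div_le_iff₀ (by linarith)]
      rw [phi_irr (hw r hr)]
      linarith
  · apply Finset.prod_pos
    intro r hr
    linarith [(phi_irr_ge (hw r hr)).2]

/-- sign -/
def sg (z : F2) : ℝ := (-1) ^ z.val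

lemma sg_zero : sg 0 = 1 := by simp [sg]

lemma sg_ne {a : F2} (h : a ≠ 0) : sg a = -1 := by
  have : a = 1 := by revert a; decide
  subst this
  simp [sg, ZMod.val_one]

lemma sg_add (a b : F2) : sg (a + b) = sg a * sg b := by
  by_cases ha : a = 0
  · rw [ha, sg_zero, zero_add, one_mul]
  by_cases hb : b = 0
  · rw [hb, sg_zero, add_zero, mul_one]
  have : a + b = 0 := by revert a b; decide
  rw [this, sg_zero, sg_ne ha, sg_ne hb]; norm_num

lemma sg_abs (a : F2) : |sg a| = 1 := by
  by_cases h : a = 0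
  · rw [h, sg_zero]; simp
  · rw [sg_ne h]; simp

lemma sg_sq (a : F2) : sg a * sg a = 1 := by
  by_cases h : a = 0
  · rw [h, sg_zero]; simp
  · rw [sg_ne h]; simp

lemma sg_sum {ι : Type} (w : Finset ι) (f : ι → F2) : sg (∑ i ∈ w, f i) = ∏ i ∈ w, sg (f i) := by
  induction w using Finset.induction_on with
  | empty => simp [sg_zero]
  | insert i w hi ih => rw [Finset.sum_insert hi, Finset.prod_insert hi, sg_add, ih]

abbrev Lf : Type := F2[X] →ₗ[F2] F2

lemma lin_sum (l : Lf) (n : ℕ) (h : ∃ g ∈ GN n, l g ≠ 0) : ∑ g ∈ GN n, sg (l g) = 0 := by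
  obtain ⟨g0, hg0, hl⟩ := h
  have h1 : ∑ g ∈ GN n, sg (l g) = ∑ g ∈ GN n, sg (l (g + g0)) := by
    symm
    apply Finset.sum_bij (fun g _ => g + g0)
    · intro g hg; exact GN_add hg hg0
    · intro a _ b _ h; exact add_right_cancel h
    · intro b hb; exact ⟨b - g0, GN_sub hb hg0, by ring⟩
    · intro g _; rfl
  have h2 : ∑ g ∈ GN n, sg (l (g + g0)) = - ∑ g ∈ GN n, sg (l g) := by
    rw [← Finset.sum_neg_distrib]
    refine Finset.sum_congr rfl fun g _ => ?_
    rw [map_add, sg_add, sg_ne hl]; ring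
  linarith

lemma prod_sub_of_dvd {u v : Finset F2[X]} (hu : ∀ r ∈ u, Irreducible r) (hv : ∀ r ∈ v, Irreducible r)
    (h : (∏ r ∈ u, r) ∣ ∏ r ∈ v, r) : u ⊆ v := by
  intro r hr
  have h1 : r ∣ ∏ r ∈ v, r := (Finset.dvd_prod_of_mem (fun r => r) hr).trans h
  obtain ⟨r', hr', hd⟩ := ((hu r hr).prime.dvd_finset_prod_iff _).1 h1
  have : r = r' := eq_of_monic_of_associated (monic_F2 (hu r hr).ne_zero) (monic_F2 (hv r' hr').ne_zero)
    ((hu r hr).associated_of_dvd (hv r' hr') hd)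
  rwa [this]

lemma prod_inj {u v : Finset F2[X]} (hu : ∀ r ∈ u, Irreducible r) (hv : ∀ r ∈ v, Irreducible r)
    (h : (∏ r ∈ u, r) = ∏ r ∈ v, r) : u = v :=
  Finset.Subset.antisymm (prod_sub_of_dvd hu hv h.dvd) (prod_sub_of_dvd hv hu h.symm.dvd)

/-- prime divisors -/
def pd (s : F2[X]) : Finset F2[X] := (GN (s.natDegree + 1)).filter (fun r => Irreducible r ∧ r ∣ s)

lemma mem_pd {s : F2[X]} (hs : s ≠ 0) {r : F2[X]} : r ∈ pd s ↔ Irreducible r ∧ r ∣ s := by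
  rw [pd, Finset.mem_filter]
  refine ⟨fun h => h.2, fun h => ⟨?_, h⟩⟩
  rw [mem_GN]
  exact degree_le_natDegree.trans_lt (by exact_mod_cast Nat.lt_succ_of_le (natDegree_le_of_dvd h.2 hs))

lemma prod_dvd_iff {u : Finset F2[X]} (hu : ∀ r ∈ u, Irreducible r) (f : F2[X]) :
    (∏ r ∈ u, r) ∣ f ↔ ∀ r ∈ u, r ∣ f := by
  constructor
  · exact fun h r hr => (Finset.dvd_prod_of_mem (fun r => r) hr).trans h
  · intro h
    apply Finset.prod_dvd_of_coprime _ h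
    intro r hr r' hr' hne
    exact irr_coprime (hu r hr) (hu r' hr') hne

lemma cop_indicator {s : F2[X]} (hs : s ≠ 0) (f : F2[X]) :
    (if IsCoprime f s then (1 : ℝ) else 0) = ∑ u ∈ (pd s).powerset, (-1) ^ u.card * if (∏ r ∈ u, r) ∣ f then 1 else 0 := by
  have h1 : ∏ r ∈ pd s, ((-1) * (if r ∣ f then (1 : ℝ) else 0) + 1) = if IsCoprime f s then (1 : ℝ) else 0 := by
    split_ifs with h
    · apply Finset.prod_eq_one
      intro r hr
      rw [mem_pd hs] at hr
      rw [if_neg]; · simp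
      intro hd
      exact hr.1.not_isUnit (h.isUnit_of_dvd' hd hr.2)
    · have : ∃ r, Irreducible r ∧ r ∣ s ∧ r ∣ f := by
        by_contra hne
        push Not at hne
        apply h
        apply isCoprime_of_prime_dvd
        · rintro ⟨_, h⟩; exact hs h
        · intro r hr h1 h2; exact hne r hr.irreducible h2 h1
      obtain ⟨r, hr, h1, h2⟩ := this
      apply Finset.prod_eq_zero ((mem_pd hs).2 ⟨hr, h1⟩)
      simp [h2]
  rw [← h1, Finset.prod_add_one]
  refine Finset.sum_congr rfl fun u hu => ?_
  rw [Finset.mem_powerset] at hu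
  rw [Finset.prod_mul_distrib, Finset.prod_const]
  congr 1
  rw [Finset.prod_ite_zero, Finset.prod_const_one]
  simp only [prod_dvd_iff (fun r hr => ((mem_pd hs).1 (hu hr)).1)]

lemma dvd_sum {D : F2[X]} (hD : D ≠ 0) (N : ℕ) (hN : D.natDegree ≤ N) (G : F2[X] → ℝ) :
    ∑ f ∈ GN N, (if D ∣ f then G f else 0) = ∑ g ∈ GN (N - D.natDegree), G (D * g) := by
  rw [← Finset.sum_filter]
  symm
  apply Finset.sum_bij (fun g _ => D * g)
  · intro g hg
    rw [Finset.mem_filter]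
    exact ⟨(mem_GN_mul hD N g hN).2 hg, dvd_mul_right _ _⟩
  · intro a _ b _ h; exact mul_left_cancel₀ hD h
  · intro f hf
    rw [Finset.mem_filter] at hf
    obtain ⟨hf, g, rfl⟩ := hf
    exact ⟨g, (mem_GN_mul hD N g hN).1 hf, rfl⟩
  · intros; rfl

lemma main_sum (N : ℕ) (l : Lf) {s : F2[X]} (hs : s ≠ 0) (hd : s.natDegree ≤ N / 2)
    (hmin : ∀ s' : F2[X], s' ≠ 0 → (∀ f ∈ GN (N / 2), l (s' * f) = 0) → s.natDegree ≤ s'.natDegree)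
    (hM : ∑ f ∈ (GN N).filter (fun f => IsCoprime f s), sg (l f) ≠ 0) :
    ∃ P : Finset F2[X], (∀ r ∈ P, Irreducible r) ∧ (∏ r ∈ P, r) = s ∧ (∀ g ∈ GN (N - s.natDegree), l (s * g) = 0) ∧
      |∑ f ∈ (GN N).filter (fun f => IsCoprime f s), sg (l f)| ≤ 2 ^ (N - s.natDegree) := by
  let T : Finset F2[X] → ℝ := fun u => ∑ g ∈ GN (N - (∏ r ∈ u, r).natDegree), sg (l ((∏ r ∈ u, r) * g))
  have hirr : ∀ u ∈ (pd s).powerset, ∀ r ∈ u, Irreducible r := by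
    intro u hu r hr
    exact ((mem_pd hs).1 (Finset.mem_powerset.1 hu hr)).1
  have hdvd : ∀ u ∈ (pd s).powerset, (∏ r ∈ u, r) ∣ s := by
    intro u hu
    rw [prod_dvd_iff (hirr u hu)]
    intro r hr
    exact ((mem_pd hs).1 (Finset.mem_powerset.1 hu hr)).2
  have e1 : ∑ f ∈ (GN N).filter (fun f => IsCoprime f s), sg (l f) = ∑ u ∈ (pd s).powerset, (-1) ^ u.card * T u := by
    rw [Finset.sum_filter]
    have h1 : ∀ f ∈ GN N, (if IsCoprime f s then sg (l f) else 0) =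
        ∑ u ∈ (pd s).powerset, (-1) ^ u.card * if (∏ r ∈ u, r) ∣ f then sg (l f) else 0 := by
      intro f _
      have : (if IsCoprime f s then sg (l f) else 0) = (if IsCoprime f s then (1 : ℝ) else 0) * sg (l f) := by
        split_ifs <;> simp
      rw [this, cop_indicator hs, Finset.sum_mul]
      refine Finset.sum_congr rfl fun u _ => ?_
      split_ifs <;> simp
    rw [Finset.sum_congr rfl h1, Finset.sum_comm]
    refine Finset.sum_congr rfl fun u hu => ?_
    rw [← Finset.mul_sum, dvd_sum (prod_ne (hirr u hu))]
    exact (natDegree_le_of_dvd (hdvd u hu) hs).trans (hd.trans (Nat.div_le_self _ _))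
  have hT : ∀ u ∈ (pd s).powerset, T u ≠ 0 → (∏ r ∈ u, r) = s ∧ ∀ g ∈ GN (N - s.natDegree), l (s * g) = 0 := by
    intro u hu hT
    have hk : ∀ g ∈ GN (N - (∏ r ∈ u, r).natDegree), l ((∏ r ∈ u, r) * g) = 0 := by
      by_contra hne
      push Not at hne
      exact hT (lin_sum (l.comp (LinearMap.mulLeft F2 (∏ r ∈ u, r))) _ hne)
    have hdu := natDegree_le_of_dvd (hdvd u hu) hs
    have h2 : (∏ r ∈ u, r) = s := by
      have h3 := hmin _ (prod_ne (hirr u hu)) (fun f hf => hk f (GN_mono (by omega) hf))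
      exact eq_of_monic_of_associated (monic_F2 (prod_ne (hirr u hu))) (monic_F2 hs)
        (associated_of_dvd_of_natDegree_le (hdvd u hu) hs h3)
    rw [h2] at hk
    exact ⟨h2, hk⟩
  rw [e1] at hM ⊢
  obtain ⟨P, hP, hPT⟩ := Finset.exists_ne_zero_of_sum_ne_zero hM
  have hPT' : T P ≠ 0 := right_ne_zero_of_mul hPT
  obtain ⟨k1, k2⟩ := hT P hP hPT'
  refine ⟨P, hirr P hP, k1, k2, ?_⟩
  rw [Finset.sum_eq_single P]
  · rw [abs_mul, abs_pow, abs_neg, abs_one, one_pow, one_mul]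
    refine (Finset.abs_sum_le_sum_abs _ _).trans ?_
    simp only [sg_abs]
    rw [Finset.sum_const, card_GN, k1]; simp
  · intro u hu hne
    by_contra h
    have := (hT u hu (right_ne_zero_of_mul h)).1
    exact hne (prod_inj (hirr u hu) (hirr P hP) (this.trans k1.symm))
  · intro h; exact absurd hP h

lemma exists_min (N : ℕ) (l : Lf) : ∃ s : F2[X], s ≠ 0 ∧ s.natDegree ≤ N / 2 ∧ (∀ f ∈ GN (N / 2), l (s * f) = 0) ∧
    (∀ s' : F2[X], s' ≠ 0 → (∀ f ∈ GN (N / 2), l (s' * f) = 0) → s.natDegree ≤ s'.natDegree) := by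
  set m := N / 2
  have hex : ∃ s : F2[X], s ≠ 0 ∧ s.natDegree ≤ m ∧ (∀ f ∈ GN m, l (s * f) = 0) := by
    have hc : (Finset.univ : Finset (Fin m → F2)).card < (GN (m + 1)).card := by
      rw [card_GN, Finset.card_univ, Fintype.card_fun, ZMod.card, Fintype.card_fin]
      exact Nat.pow_lt_pow_right (by norm_num) (Nat.lt_succ_self _)
    obtain ⟨a, ha, b, hb, hne, hab⟩ := Finset.exists_ne_map_eq_of_card_lt_of_maps_to hc
      (f := fun s => fun i : Fin m => l (s * X ^ (i : ℕ))) (fun _ _ => Finset.mem_coe.2 (Finset.mem_univ _))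
    refine ⟨a - b, sub_ne_zero.2 hne, ?_, ?_⟩
    · have := GN_sub ha hb
      rw [mem_GN, degree_eq_natDegree (sub_ne_zero.2 hne)] at this
      have : (a - b).natDegree < m + 1 := by exact_mod_cast this
      omega
    · intro f hf
      have h1 : ∀ i < m, l ((a - b) * X ^ i) = 0 := by
        intro i hi
        have := congrFun hab ⟨i, hi⟩
        simp only at this
        rw [sub_mul, map_sub, this, sub_self]
      rw [mem_GN, degree_lt_iff_coeff_zero] at hf
      have h2 : f = ∑ i ∈ Finset.range m, f.coeff i • (X : F2[X]) ^ i := by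
        conv_lhs => rw [as_sum_range' f (max m (f.natDegree + 1)) (by omega)]
        symm
        rw [← Finset.sum_subset (Finset.range_mono (le_max_left m (f.natDegree + 1)))]
        · refine Finset.sum_congr rfl fun i _ => ?_
          rw [smul_X_eq_monomial]
        · intro i _ hi
          rw [hf i (by simpa using hi)]; simp
      rw [h2, Finset.mul_sum, map_sum]
      apply Finset.sum_eq_zero
      intro i hi
      rw [mul_smul_comm, map_smul, h1 i (Finset.mem_range.1 hi), smul_zero]
  have hex' : ∃ n, ∃ s : F2[X], s ≠ 0 ∧ s.natDegree = n ∧ (∀ f ∈ GN m, l (s * f) = 0) := by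
    obtain ⟨s, h1, h2, h3⟩ := hex
    exact ⟨_, s, h1, rfl, h3⟩
  obtain ⟨s, h1, h2, h3⟩ := Nat.find_spec hex'
  refine ⟨s, h1, ?_, h3, ?_⟩
  · obtain ⟨s', h1', h2', h3'⟩ := hex
    rw [h2]
    exact (Nat.find_min' hex' ⟨s', h1', rfl, h3'⟩).trans h2'
  · intro s' h1' h3'
    rw [h2]
    exact Nat.find_min' hex' ⟨s', h1', rfl, h3'⟩

def E1 (N : ℕ) (δ : ℝ) (D : ℕ) : ℝ := E0 N + 8 ^ (2 ^ D) * (2 : ℝ) ^ ((3 / 4 + δ / 4) * N)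

theorem large_struct {δ : ℝ} (hδ : 0 < δ) (hδ1 : δ ≤ 1) {D : ℕ} (hD : 5 ≤ (2 : ℝ) ^ (δ * D)) (N : ℕ) (l : Lf)
    (hbig : E1 N δ D < |∑ g ∈ GN N, lam g * sg (l g)|) :
    ∃ P : Finset F2[X], (∀ r ∈ P, Irreducible r) ∧ ((∑ r ∈ P, r.natDegree : ℕ) : ℝ) < N / 4 ∧
      ∃ ρ : Lf, (∀ f ∈ GN N, l f = ρ f) ∧ ∀ g, ρ ((∏ r ∈ P, r) * g) = 0 := by
  obtain ⟨s, hs, hd, hk, hmin⟩ := exists_min N l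
  have h1 := pnt N hs hd (fun f => sg (l f)) (fun f => (sg_abs _).le) (fun f q hq => by
    simp only [map_add, hk q hq, add_zero])
  set M := ∑ f ∈ (GN N).filter (fun f => IsCoprime f s), sg (l f) with hMdef
  have hφ : (0 : ℝ) < phi s := by exact_mod_cast phi_pos hs
  have hE : 0 < 8 ^ (2 ^ D) * (2 : ℝ) ^ ((3 / 4 + δ / 4) * N) := by positivity
  have h2 : 8 ^ (2 ^ D) * (2 : ℝ) ^ ((3 / 4 + δ / 4) * N) < |2 ^ s.natDegree / phi s * M| := by
    rw [E1] at hbig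
    have := abs_sub_abs_le_abs_sub (∑ g ∈ GN N, lam g * sg (l g)) (2 ^ s.natDegree / phi s * M)
    linarith
  have hM : M ≠ 0 := by
    rintro h; rw [h, mul_zero, abs_zero] at h2; linarith
  obtain ⟨P, hP, hPs, hkill, hMb⟩ := main_sum N l hs hd hmin hM
  have hdN : s.natDegree ≤ N := hd.trans (Nat.div_le_self _ _)
  have hdeg : (∑ r ∈ P, r.natDegree) = s.natDegree := by rw [← prod_natDegree hP, hPs]
  refine ⟨P, hP, ?_, ?_⟩
  · by_contra hge
    push Not at hge
    have h3 := phi_lower hδ hδ1 hD hP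
    rw [hPs] at h3
    have h4 : |2 ^ s.natDegree / phi s * M| ≤ 2 ^ N / phi s := by
      rw [abs_mul, abs_of_nonneg (by positivity : (0 : ℝ) ≤ 2 ^ s.natDegree / (phi s : ℝ))]
      calc _ ≤ 2 ^ s.natDegree / (phi s : ℝ) * 2 ^ (N - s.natDegree) := by gcongr
        _ = (2 ^ s.natDegree * 2 ^ (N - s.natDegree)) / phi s := by ring
        _ = _ := by rw [← pow_add, Nat.add_sub_cancel' hdN]
    have h5 := h2.trans_le h4
    rw [lt_div_iff₀ hφ] at h5
    have h6 : (2 : ℝ) ^ N ≤ (2 : ℝ) ^ ((3 / 4 + δ / 4) * N) * (2 : ℝ) ^ ((1 - δ) * ((∑ r ∈ P, r.natDegree : ℕ) : ℝ)) := by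
      rw [← Real.rpow_add (by norm_num), ← two_rpow_nat]
      apply Real.rpow_le_rpow_of_exponent_le (by norm_num)
      have := mul_le_mul_of_nonneg_left hge (by linarith : 0 ≤ 1 - δ)
      nlinarith
    have h7 := mul_le_mul_of_nonneg_left h3 (by positivity : 0 ≤ (2 : ℝ) ^ ((3 / 4 + δ / 4) * N))
    nlinarith
  · refine ⟨l.comp (modByMonicHom s), ?_, ?_⟩
    · intro f hf
      have h := modByMonic_add_div f s
      have h3 : s * (f /ₘ s) ∈ GN N := by
        have : s * (f /ₘ s) = f - f %ₘ s := by linear_combination h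
        rw [this]
        exact GN_sub hf (GN_mono hdN (mod_mem hs f))
      have h4 := hkill _ ((mem_GN_mul hs N _ hdN).1 h3)
      conv_lhs => rw [← h]
      rw [map_add, h4, add_zero]; rfl
    · intro g
      rw [hPs]
      simp [modByMonicHom, (modByMonic_eq_zero_iff_dvd (monic_F2 hs)).2 (dvd_mul_right s g)]

lemma sg_sub (a b : F2) : sg (a - b) = sg a * sg b := by
  have : sg a = sg (a - b) * sg b := by rw [← sg_add, sub_add_cancel]
  rw [this, mul_assoc, sg_sq, mul_one]

/-- local factor -/
def hh (r f : F2[X]) : ℝ := if r ∣ f then 1 else -1 / phi r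

lemma hh_abs {r : F2[X]} (hr : Irreducible r) (f : F2[X]) : |hh r f| ≤ 1 := by
  have h := (phi_irr_ge hr).2
  rw [hh]
  split_ifs
  · simp
  · rw [abs_div, abs_neg, abs_one, abs_of_nonneg (by linarith)]
    exact div_le_one_of_le₀ h (by linarith)

lemma hh_per {r f g : F2[X]} (h : r ∣ f - g) : hh r f = hh r g := by
  have : r ∣ f ↔ r ∣ g := by
    constructor
    · intro hf; have := dvd_sub hf h; rwa [sub_sub_cancel] at this
    · intro hg; have := dvd_add h hg; rwa [sub_add_cancel] at this
  simp only [hh, this]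

lemma hh_avg {r : F2[X]} (hr : Irreducible r) : ∃ (ι : Type) (_ : Fintype ι) (μ : ι → Lf),
    (∀ i g, μ i (r * g) = 0) ∧ Fintype.card ι = phi r ∧ ∀ f, phi r * hh r f = ∑ i, sg (μ i f) := by
  let V := F2[X] ⧸ Ideal.span {r}
  have hfin : Finite V := finite_quot hr.ne_zero
  have hmf : Module.Finite F2 V := (monic_F2 hr.ne_zero).finite_quotient
  have hDf : Finite (Module.Dual F2 V) := Module.finite_of_finite F2
  let _ : Fintype (Module.Dual F2 V) := Fintype.ofFinite _
  have hcard : Fintype.card (Module.Dual F2 V) = 2 ^ r.natDegree := by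
    rw [Module.card_eq_pow_finrank (K := F2), Subspace.dual_finrank_eq, ZMod.card]
    congr 1
    exact finrank_quotient_span_eq_natDegree
  let q : F2[X] →ₗ[F2] V := (Ideal.Quotient.mkₐ F2 (Ideal.span {r})).toLinearMap
  have hq : ∀ f, q f = 0 ↔ r ∣ f := by
    intro f
    have : q f = Ideal.Quotient.mk (Ideal.span {r}) f := rfl
    rw [this, Ideal.Quotient.eq_zero_iff_mem, Ideal.mem_span_singleton]
  have hphi : (phi r : ℝ) = 2 ^ r.natDegree - 1 := phi_irr hr
  refine ⟨{μ : Module.Dual F2 V // μ ≠ 0}, inferInstance, fun μ => μ.1.comp q, ?_, ?_, ?_⟩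
  · intro μ g
    rw [LinearMap.comp_apply, (hq _).2 (dvd_mul_right _ _), map_zero]
  · rw [Fintype.card_subtype_compl, hcard, Fintype.card_subtype_eq]
    have : ((2 ^ r.natDegree - 1 : ℕ) : ℝ) = phi r := by
      rw [hphi, Nat.cast_sub Nat.one_le_two_pow]; push_cast; rfl
    exact_mod_cast this
  · intro f
    have h1 : ∑ μ : Module.Dual F2 V, sg (μ (q f)) = if r ∣ f then 2 ^ r.natDegree else 0 := by
      split_ifs with h
      · simp only [(hq f).2 h, map_zero, sg_zero]
        rw [Finset.sum_const, Finset.card_univ, hcard]; simp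
      · have hv : q f ≠ 0 := fun h' => h ((hq f).1 h')
        obtain ⟨μ0, hμ0⟩ : ∃ μ0 : Module.Dual F2 V, μ0 (q f) ≠ 0 := by
          by_contra hne
          push Not at hne
          exact hv ((Module.forall_dual_apply_eq_zero_iff F2 _).1 hne)
        have h2 : ∑ μ : Module.Dual F2 V, sg (μ (q f)) = ∑ μ : Module.Dual F2 V, sg ((μ + μ0) (q f)) :=
          (Fintype.sum_equiv (Equiv.addRight μ0) _ _ (fun μ => rfl)).symm
        have h3 : ∑ μ : Module.Dual F2 V, sg ((μ + μ0) (q f)) = - ∑ μ : Module.Dual F2 V, sg (μ (q f)) := by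
          rw [← Finset.sum_neg_distrib]
          refine Finset.sum_congr rfl fun μ _ => ?_
          rw [LinearMap.add_apply, sg_add, sg_ne hμ0]; ring
        linarith
    have h4 : ∑ μ : {μ : Module.Dual F2 V // μ ≠ 0}, sg (μ.1 (q f)) = ∑ μ : Module.Dual F2 V, sg (μ (q f)) - 1 := by
      rw [← Finset.add_sum_erase _ _ (Finset.mem_univ (0 : Module.Dual F2 V)), LinearMap.zero_apply, sg_zero, add_sub_cancel_left]
      symm
      apply Finset.sum_subtype
      intro μ
      simp
    have h5 : ∑ μ : {μ : Module.Dual F2 V // μ ≠ 0}, sg ((μ.1.comp q) f) = ∑ μ : {μ : Module.Dual F2 V // μ ≠ 0}, sg (μ.1 (q f)) := rfl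
    rw [h5, h4, h1, hh]
    have hpos := (phi_irr_ge hr).2
    split_ifs
    · rw [hphi]; ring
    · field_simp; norm_num

/-- the exponential sums -/
def Su (N : ℕ) (u : Finset F2[X]) (l : Lf) : ℝ :=
  ∑ g ∈ GN N, lam g * ((∏ r ∈ u, hh r (g - 1)) * sg (l (g - 1)))

lemma Su_empty (N : ℕ) (l : Lf) : |Su N ∅ l| = |∑ g ∈ GN N, lam g * sg (l g)| := by
  have : Su N ∅ l = sg (l 1) * ∑ g ∈ GN N, lam g * sg (l g) := by
    rw [Su, Finset.mul_sum]
    refine Finset.sum_congr rfl fun g _ => ?_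
    rw [Finset.prod_empty, map_sub, sg_sub]; ring
  rw [this, abs_mul, sg_abs, one_mul]

lemma Su_bound (N : ℕ) (e : ℝ) (u : Finset F2[X]) : ∀ (hu : ∀ r ∈ u, Irreducible r) (l : Lf)
    (h : ∀ k : Lf, (∀ g, k ((∏ r ∈ u, r) * g) = 0) → |Su N ∅ (l + k)| ≤ e), |Su N u l| ≤ e := by
  induction u using Finset.induction_on with
  | empty =>
    intro _ l h
    have := h 0 (fun g => rfl)
    rwa [add_zero] at this
  | insert r u hr ih =>
    intro hu l h
    have hu' : ∀ r ∈ u, Irreducible r := fun r' h => hu r' (Finset.mem_insert_of_mem h)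
    have hrr := hu r (Finset.mem_insert_self _ _)
    obtain ⟨ι, _, μ, h1, h2, h3⟩ := hh_avg hrr
    have hpos := (phi_irr_ge hrr).2
    have key : phi r * Su N (insert r u) l = ∑ i, Su N u (l + μ i) := by
      simp only [Su]
      rw [Finset.mul_sum, Finset.sum_comm]
      refine Finset.sum_congr rfl fun g _ => ?_
      rw [Finset.prod_insert hr]
      have : ∀ i, lam g * ((∏ r ∈ u, hh r (g - 1)) * sg ((l + μ i) (g - 1))) =
          (lam g * ((∏ r ∈ u, hh r (g - 1)) * sg (l (g - 1)))) * sg (μ i (g - 1)) := by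
        intro i; rw [LinearMap.add_apply, sg_add]; ring
      simp only [this]
      rw [← Finset.mul_sum, ← h3]; ring
    have hb : |∑ i, Su N u (l + μ i)| ≤ phi r * e := by
      refine (Finset.abs_sum_le_sum_abs _ _).trans ?_
      calc _ ≤ ∑ i : ι, e := by
            refine Finset.sum_le_sum fun i _ => ?_
            apply ih hu'
            intro k hk
            rw [add_assoc]
            apply h
            intro g
            rw [Finset.prod_insert hr, LinearMap.add_apply]
            have e1 : r * (∏ r ∈ u, r) * g = r * ((∏ r ∈ u, r) * g) := by ring
            have e2 : r * (∏ r ∈ u, r) * g = (∏ r ∈ u, r) * (r * g) := by ring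
            rw [e1, h1, ← e1, e2, hk, add_zero]
        _ = _ := by rw [Finset.sum_const, Finset.card_univ, h2, nsmul_eq_mul]
    rw [← key, abs_mul, abs_of_nonneg (by linarith)] at hb
    exact le_of_mul_le_mul_left hb (by linarith)

lemma decomp (w : Finset F2[X]) : ∀ (hw : ∀ r ∈ w, Irreducible r) (ρ : Lf) (h : ∀ g, ρ ((∏ r ∈ w, r) * g) = 0),
    ∃ R : F2[X] → Lf, (∀ r g, R r (r * g) = 0) ∧ (∀ r, r ∉ w → R r = 0) ∧ ∀ f, ρ f = ∑ r ∈ w, R r f := by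
  induction w using Finset.induction_on with
  | empty =>
    intro _ ρ h
    refine ⟨fun _ => 0, fun _ _ => rfl, fun _ _ => rfl, fun f => ?_⟩
    have := h f
    simpa using this
  | insert r w hr ih =>
    intro hw ρ h
    have hw' : ∀ r ∈ w, Irreducible r := fun r' h => hw r' (Finset.mem_insert_of_mem h)
    have hrr := hw r (Finset.mem_insert_self _ _)
    obtain ⟨a, b, hab⟩ := coprime_prod hw' hrr hr
    rw [Finset.prod_insert hr] at h
    set Dw := ∏ r ∈ w, r
    obtain ⟨R, h1, h2, h3⟩ := ih hw' (ρ.comp (LinearMap.mulLeft F2 (a * r))) (fun g => by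
      rw [LinearMap.comp_apply, LinearMap.mulLeft_apply]
      rw [show a * r * (Dw * g) = r * Dw * (a * g) by ring, h])
    have hR : ∀ r' ∈ w, Function.update R r (ρ.comp (LinearMap.mulLeft F2 (b * Dw))) r' = R r' := by
      intro r' hr'
      rw [Function.update_of_ne]
      rintro rfl; exact hr hr'
    refine ⟨Function.update R r (ρ.comp (LinearMap.mulLeft F2 (b * Dw))), ?_, ?_, ?_⟩
    · intro r' g
      by_cases hrr' : r' = r
      · subst hrr'
        rw [Function.update_self, LinearMap.comp_apply, LinearMap.mulLeft_apply,
          show b * Dw * (r' * g) = r' * Dw * (b * g) by ring, h]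
      · rw [Function.update_of_ne hrr', h1]
    · intro r' hr'
      rw [Finset.mem_insert, not_or] at hr'
      rw [Function.update_of_ne hr'.1, h2 _ hr'.2]
    · intro f
      rw [Finset.sum_insert hr, Function.update_self, Finset.sum_congr rfl (fun r' hr' => by rw [hR r' hr']), ← h3]
      simp only [LinearMap.comp_apply, LinearMap.mulLeft_apply]
      rw [← map_add]
      congr 1
      linear_combination (-f) * hab

/-- local averages -/
def Am (ρ : Lf) (r : F2[X]) : ℝ := (∑ a ∈ residues r, hh r (a - 1) * sg (ρ (a - 1))) / phi r
def Bm (ρ : Lf) (r : F2[X]) : ℝ := (∑ a ∈ residues r, sg (ρ (a - 1))) / phi r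

lemma one_mem_res {r : F2[X]} (hr : Irreducible r) : (1 : F2[X]) ∈ residues r := by
  rw [residues_irr hr, Finset.mem_erase, mem_GN, degree_one]
  exact ⟨one_ne_zero, by exact_mod_cast hr.natDegree_pos⟩

lemma Am_eq {r : F2[X]} (hr : Irreducible r) (ρ : Lf) : Am ρ r = (1 / phi r) * (1 + 1 / phi r - Bm ρ r) := by
  have hpos := (phi_irr_ge hr).2
  have h1 := Finset.add_sum_erase (residues r) (fun a => hh r (a - 1) * sg (ρ (a - 1))) (one_mem_res hr)
  have h2 := Finset.add_sum_erase (residues r) (fun a => sg (ρ (a - 1))) (one_mem_res hr)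
  simp only [sub_self, map_zero, sg_zero] at h1 h2
  have h3 : ∑ a ∈ (residues r).erase 1, hh r (a - 1) * sg (ρ (a - 1)) =
      (-1 / phi r) * ∑ a ∈ (residues r).erase 1, sg (ρ (a - 1)) := by
    rw [Finset.mul_sum]
    refine Finset.sum_congr rfl fun a ha => ?_
    rw [Finset.mem_erase] at ha
    rw [hh, if_neg]
    intro h
    exact ha.1 (eq_of_GN hr.ne_zero (mem_residues.1 ha.2).1 (mem_residues.1 (one_mem_res hr)).1 h)
  have h4 : hh r 0 = 1 := by rw [hh, if_pos (dvd_zero _)]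
  rw [h4, h3] at h1
  rw [Am, Bm, ← h1, ← h2]
  field_simp
  ring

lemma Bm_zero {r : F2[X]} (hr : Irreducible r) : Bm 0 r = 1 := by
  have hpos := (phi_irr_ge hr).2
  rw [Bm]
  simp only [LinearMap.zero_apply, sg_zero]
  rw [Finset.sum_const, ← phi_eq_card]
  simp only [nsmul_eq_mul, mul_one]
  field_simp

lemma Bm_cases {r : F2[X]} (hr : Irreducible r) (ρ : Lf) (hρ : ∀ g, ρ (r * g) = 0) :
    Bm ρ r = 1 ∨ |Bm ρ r| ≤ 1 / phi r := by
  have hpos := (phi_irr_ge hr).2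
  by_cases h : ∃ g ∈ GN r.natDegree, ρ g ≠ 0
  · right
    have h1 := lin_sum ρ _ h
    have h2 : ∑ a ∈ GN r.natDegree, sg (ρ (a - 1)) = 0 := by
      have : ∑ a ∈ GN r.natDegree, sg (ρ (a - 1)) = sg (ρ 1) * ∑ a ∈ GN r.natDegree, sg (ρ a) := by
        rw [Finset.mul_sum]
        refine Finset.sum_congr rfl fun g _ => ?_
        rw [map_sub, sg_sub]; ring
      rw [this, h1, mul_zero]
    rw [← Finset.add_sum_erase _ _ (zero_mem_GN _), ← residues_irr hr] at h2
    have h3 : ∑ a ∈ residues r, sg (ρ (a - 1)) = - sg (ρ (0 - 1)) := by linarith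
    rw [Bm, h3, abs_div, abs_neg, sg_abs, abs_of_nonneg (by linarith)]
  · left
    push Not at h
    have : ρ = 0 := by
      refine LinearMap.ext fun f => ?_
      rw [← modByMonic_add_div f r, map_add, h _ (mod_mem hr.ne_zero f), hρ]
      simp
    rw [this, Bm_zero hr]

lemma Su_main (N : ℕ) (U u w : Finset F2[X]) (hU : ∀ r ∈ U, Irreducible r) (huU : u ⊆ U) (hwU : w ⊆ U)
    (hd : ∑ r ∈ u, r.natDegree + ∑ r ∈ w, r.natDegree ≤ N / 2) (ρ : Lf) (R : F2[X] → Lf)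
    (hR1 : ∀ r g, R r (r * g) = 0) (hR2 : ∀ r, r ∉ w → R r = 0) (hR3 : ∀ f, ρ f = ∑ r ∈ w, R r f) :
    |Su N u ρ - 2 ^ N * ((∏ r ∈ u, Am (R r) r) * ∏ r ∈ U \ u, Bm (R r) r)| ≤ E0 N := by
  set v := u ∪ w with hv
  have hvU : v ⊆ U := Finset.union_subset huU hwU
  have hvi : ∀ r ∈ v, Irreducible r := fun r h => hU r (hvU h)
  set G : F2[X] → F2[X] → ℝ := fun r g => (if r ∈ u then hh r (g - 1) else 1) * sg (R r (g - 1)) with hG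
  have hGper : ∀ r ∈ v, ∀ f f', r ∣ f - f' → G r f = G r f' := by
    intro r hr f f' h
    have h1 : r ∣ (f - 1) - (f' - 1) := by simpa using h
    have h2 : R r (f - 1) = R r (f' - 1) := by
      obtain ⟨q, hq⟩ := h1
      have := hR1 r q
      rw [← hq, map_sub] at this
      exact sub_eq_zero.1 this
    simp only [hG]
    rw [hh_per h1, h2]
  have hGabs : ∀ r ∈ v, ∀ f, |G r f| ≤ 1 := by
    intro r hr f
    simp only [hG]
    rw [abs_mul, sg_abs, mul_one]
    split_ifs
    · exact hh_abs (hvi r hr) _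
    · simp
  have hF : ∀ g, (∏ r ∈ u, hh r (g - 1)) * sg (ρ (g - 1)) = ∏ r ∈ v, G r g := by
    intro g
    simp only [hG]
    rw [Finset.prod_mul_distrib, Finset.prod_ite_mem]
    congr 1
    · rw [hv, Finset.union_inter_cancel_left]
    · rw [hR3, sg_sum]
      refine Finset.prod_subset Finset.subset_union_right fun r _ h => ?_
      rw [hR2 r h]; simp [sg_zero]
  have hdeg : (∏ r ∈ v, r).natDegree ≤ N / 2 := by
    rw [prod_natDegree hvi]
    refine le_trans ?_ hd
    rw [← Finset.sum_union_inter]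
    exact Nat.le_add_right _ _
  have key := pnt_per N (prod_ne hvi) hdeg (fun g => ∏ r ∈ v, G r g) (by
      intro f
      rw [Finset.abs_prod]
      exact Finset.prod_le_one (fun r _ => abs_nonneg _) (fun r hr => hGabs r hr f)) (by
      intro f g h
      refine Finset.prod_congr rfl fun r hr => hGper r hr f g ?_
      exact dvd_trans (Finset.dvd_prod_of_mem (fun r => r) hr) h)
  rw [crt_prod hvi G hGper, phi_prod hvi, ← Finset.prod_div_distrib] at key
  have h1 : ∏ r ∈ v, (∑ a ∈ residues r, G r a) / (phi r : ℝ) = (∏ r ∈ u, Am (R r) r) * ∏ r ∈ U \ u, Bm (R r) r := by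
    have e : ∀ r, (∑ a ∈ residues r, G r a) / (phi r : ℝ) = if r ∈ u then Am (R r) r else Bm (R r) r := by
      intro r
      simp only [hG]
      split_ifs
      · rfl
      · simp only [one_mul]; rfl
    simp only [e]
    rw [Finset.prod_subset hvU (fun r hrU hr => ?_)]
    · rw [← Finset.prod_sdiff huU, mul_comm]
      congr 1
      · exact Finset.prod_congr rfl fun r h => by rw [if_pos h]
      · exact Finset.prod_congr rfl fun r h => by rw [if_neg (Finset.mem_sdiff.1 h).2]
    · rw [hv, Finset.mem_union, not_or] at hr
      rw [if_neg hr.1, hR2 r hr.2, Bm_zero (hU r hrU)]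
  rw [h1] at key
  rw [Su]
  simp only [hF]
  exact key

/-- local factor bounds -/
lemma factor_bound {δ : ℝ} (hδ : 0 < δ) (hδ1 : δ ≤ 1) {D : ℕ} (hD : 5 ≤ (2 : ℝ) ^ (δ * D)) {r : F2[X]}
    (hr : Irreducible r) (ρ : Lf) (hρ : ∀ g, ρ (r * g) = 0) :
    0 ≤ Am ρ r ∧ 0 ≤ Am ρ r + Bm ρ r ∧
    Am ρ r * (2 : ℝ) ^ ((1 - δ) * r.natDegree) + |Bm ρ r| ≤
      (1 + 4 * (2 : ℝ) ^ (-(1 + δ) * r.natDegree)) * (if D ≤ r.natDegree then 1 else 8) := by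
  obtain ⟨h1, h2⟩ := phi_irr_ge hr
  have h0 := phi_irr hr
  rw [Am_eq hr]
  have hq1 := q_one hδ1 r.natDegree
  have hq2 := q_le hδ r.natDegree
  set p : ℝ := ((phi r : ℕ) : ℝ) with hp
  set n := r.natDegree with hn
  set q : ℝ := (2 : ℝ) ^ ((1 - δ) * n) with hq
  have hx : 0 < (2 : ℝ) ^ (-(1 + δ) * n) := by positivity
  have hxq : (2 : ℝ) ^ (-(1 + δ) * n) * ((2 : ℝ) ^ n * (2 : ℝ) ^ n) = q := by
    rw [hq, ← Real.rpow_natCast, ← Real.rpow_add two_pos, ← Real.rpow_add two_pos]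
    congr 1; ring
  set x : ℝ := (2 : ℝ) ^ (-(1 + δ) * n) with hxd
  have hp0 : 0 < p := by linarith
  set y : ℝ := 1 / p with hy
  have hy0 : 0 < y := by positivity
  have hy1 : y ≤ 1 := by rw [hy, div_le_one hp0]; exact h2
  have hyp : y * p = 1 := by rw [hy]; field_simp
  have h2n : y * 2 ^ n ≤ 2 := by nlinarith
  have h2n0 : (0:ℝ) < 2 ^ n := by positivity
  have hif : (1:ℝ) ≤ if D ≤ n then 1 else 8 := by split_ifs <;> norm_num
  rcases Bm_cases hr ρ hρ with hB | hB
  · rw [hB]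
    have e : y * (1 + y - 1) = y ^ 2 := by ring
    rw [e, abs_one]
    refine ⟨by positivity, by positivity, ?_⟩
    have : y ^ 2 * q ≤ 4 * x := by
      have h3 : (y * 2 ^ n) ^ 2 ≤ 4 := by nlinarith [mul_pos hy0 h2n0]
      calc y ^ 2 * q = x * (y * 2 ^ n) ^ 2 := by rw [← hxq]; ring
        _ ≤ x * 4 := by gcongr
        _ = 4 * x := by ring
    calc y ^ 2 * q + 1 ≤ (1 + 4 * x) * 1 := by linarith
      _ ≤ _ := by gcongr
  · rw [← hp, ← hy] at hB
    have hB' := abs_le.1 hB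
    set B := Bm ρ r
    have hA1 : 1 + y - B ≤ 1 + 2 * y := by linarith
    have hA0 : 0 ≤ 1 + y - B := by linarith
    refine ⟨by positivity, ?_, ?_⟩
    · nlinarith
    · have h3 : y * (1 + y - B) * q + |B| ≤ y * (3 * q + 1) := by
        have : y * (1 + y - B) * q ≤ y * 3 * q := by gcongr; linarith
        linarith
      split_ifs with hDn
      · have h5 := q_bound hδ hδ1 hD hDn
        have h6 : y * (3 * q + 1) ≤ 1 := by
          have : 3 * q + 1 ≤ p := by linarith
          calc y * (3 * q + 1) ≤ y * p := by gcongr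
            _ = 1 := hyp
        linarith
      · have h6 : y * (3 * q + 1) ≤ 8 := by
          have : y * (3 * q + 1) ≤ y * (4 * 2 ^ n) := by gcongr; linarith
          linarith
        nlinarith

lemma geo_sum {δ : ℝ} (hδ : 0 < δ) (U : Finset F2[X]) :
    ∑ r ∈ U, (2 : ℝ) ^ (-(1 + δ) * r.natDegree) ≤ 2 / (1 - (2 : ℝ) ^ (-δ)) := by
  set x : ℝ := (2 : ℝ) ^ (-δ) with hx
  have hx0 : 0 < x := by positivity
  have hx1 : x < 1 := Real.rpow_lt_one_of_one_lt_of_neg one_lt_two (by linarith)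
  obtain ⟨M, hM⟩ : ∃ M : ℕ, ∀ r ∈ U, r.natDegree ∈ Finset.range M := by
    refine ⟨U.sup (fun r => r.natDegree) + 1, fun r hr => ?_⟩
    rw [Finset.mem_range, Nat.lt_succ_iff]
    exact Finset.le_sup (f := fun r : F2[X] => r.natDegree) hr
  rw [← Finset.sum_fiberwise_of_maps_to hM]
  have h1 : ∀ n ∈ Finset.range M, ∑ r ∈ U with r.natDegree = n, (2 : ℝ) ^ (-(1 + δ) * r.natDegree) ≤ 2 * x ^ n := by
    intro n _
    have hc : (U.filter (fun r => r.natDegree = n)).card ≤ 2 ^ (n + 1) := by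
      rw [← card_GN]
      refine Finset.card_le_card fun r hr => ?_
      rw [Finset.mem_filter] at hr
      rw [mem_GN]
      refine lt_of_le_of_lt degree_le_natDegree ?_
      rw [hr.2]; exact_mod_cast Nat.lt_succ_self n
    have : ∑ r ∈ U with r.natDegree = n, (2 : ℝ) ^ (-(1 + δ) * r.natDegree) =
        ((U.filter (fun r => r.natDegree = n)).card : ℝ) * (2 : ℝ) ^ (-(1 + δ) * n) := by
      rw [← nsmul_eq_mul, ← Finset.sum_const]
      refine Finset.sum_congr rfl fun r hr => ?_
      rw [(Finset.mem_filter.1 hr).2]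
    rw [this]
    have hc' : ((U.filter (fun r => r.natDegree = n)).card : ℝ) ≤ 2 ^ (n + 1) := by exact_mod_cast hc
    calc _ ≤ (2 : ℝ) ^ (n + 1) * (2 : ℝ) ^ (-(1 + δ) * n) := by gcongr
      _ = 2 * x ^ n := by
        rw [hx, ← Real.rpow_natCast ((2 : ℝ) ^ (-δ)), ← Real.rpow_mul two_pos.le, pow_succ, mul_comm ((2:ℝ)^n) 2, mul_assoc,
          ← Real.rpow_natCast (2 : ℝ) n, ← Real.rpow_add two_pos]
        congr 2; ring
  refine le_trans (Finset.sum_le_sum h1) ?_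
  rw [← Finset.mul_sum, div_eq_mul_inv, ← tsum_geometric_of_lt_one hx0.le hx1]
  gcongr
  exact (summable_geometric_of_lt_one hx0.le hx1).sum_le_tsum _ (fun i _ => by positivity)

def Cd (δ : ℝ) (D : ℕ) : ℝ := Real.exp (8 / (1 - (2 : ℝ) ^ (-δ))) * 8 ^ (2 ^ D)

lemma prod_Cd {δ : ℝ} (hδ : 0 < δ) (D : ℕ) (U : Finset F2[X]) (hU : ∀ r ∈ U, Irreducible r) :
    ∏ r ∈ U, ((1 + 4 * (2 : ℝ) ^ (-(1 + δ) * r.natDegree)) * (if D ≤ r.natDegree then 1 else 8)) ≤ Cd δ D := by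
  rw [Finset.prod_mul_distrib, Cd]
  have h1 : ∏ r ∈ U, (1 + 4 * (2 : ℝ) ^ (-(1 + δ) * r.natDegree)) ≤ Real.exp (8 / (1 - (2 : ℝ) ^ (-δ))) := by
    calc _ ≤ ∏ r ∈ U, Real.exp (4 * (2 : ℝ) ^ (-(1 + δ) * r.natDegree)) := by
          refine Finset.prod_le_prod (fun r _ => by positivity) (fun r _ => ?_)
          rw [add_comm]; exact Real.add_one_le_exp _
      _ = Real.exp (4 * ∑ r ∈ U, (2 : ℝ) ^ (-(1 + δ) * r.natDegree)) := by
          rw [← Real.exp_sum, Finset.mul_sum]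
      _ ≤ _ := by
          rw [Real.exp_le_exp]
          have := geo_sum hδ U
          calc _ ≤ 4 * (2 / (1 - (2 : ℝ) ^ (-δ))) := by gcongr
            _ = _ := by ring
  have h2 : ∏ r ∈ U, (if D ≤ r.natDegree then (1:ℝ) else 8) ≤ 8 ^ (2 ^ D) := by
    refine prod_bound U (fun r => if D ≤ r.natDegree then (1:ℝ) else 8) D 8 (by norm_num) ?_ ?_ ?_
    · intro r _; split_ifs <;> norm_num
    · intro r _; split_ifs <;> norm_num
    · intro r _ h; rw [if_pos h]
  have h3 : 0 ≤ ∏ r ∈ U, (if D ≤ r.natDegree then (1:ℝ) else 8) :=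
    Finset.prod_nonneg fun r _ => by split_ifs <;> norm_num
  exact mul_le_mul h1 h2 h3 (Real.exp_pos _).le

lemma tail_bound {δ : ℝ} (hδ : 0 < δ) (hδ1 : δ ≤ 1) {D : ℕ} (hD : 5 ≤ (2 : ℝ) ^ (δ * D)) (Q : ℕ) (U : Finset F2[X])
    (hU : ∀ r ∈ U, Irreducible r) (R : F2[X] → Lf) (hR : ∀ r g, R r (r * g) = 0) :
    -(Cd δ D * (2 : ℝ) ^ (-(1 - δ) * Q)) ≤ ∑ u ∈ U.powerset.filter (fun u => ∑ r ∈ u, r.natDegree < Q),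
      (∏ r ∈ u, Am (R r) r) * ∏ r ∈ U \ u, Bm (R r) r := by
  have hf := fun r (hr : r ∈ U) => factor_bound hδ hδ1 hD (hU r hr) (R r) (hR r)
  have hsplit := Finset.sum_filter_add_sum_filter_not U.powerset (fun u => ∑ r ∈ u, r.natDegree < Q)
    (fun u => (∏ r ∈ u, Am (R r) r) * ∏ r ∈ U \ u, Bm (R r) r)
  rw [← Finset.prod_add] at hsplit
  have h0 : 0 ≤ ∏ r ∈ U, (Am (R r) r + Bm (R r) r) := Finset.prod_nonneg fun r hr => (hf r hr).2.1
  have h1 : ∑ u ∈ U.powerset.filter (fun u => ¬ ∑ r ∈ u, r.natDegree < Q),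
      (∏ r ∈ u, Am (R r) r) * ∏ r ∈ U \ u, Bm (R r) r ≤ Cd δ D * (2 : ℝ) ^ (-(1 - δ) * Q) := by
    calc _ ≤ ∑ u ∈ U.powerset.filter (fun u => ¬ ∑ r ∈ u, r.natDegree < Q),
          ((∏ r ∈ u, Am (R r) r * (2 : ℝ) ^ ((1 - δ) * r.natDegree)) * ∏ r ∈ U \ u, |Bm (R r) r|) * (2 : ℝ) ^ (-(1 - δ) * Q) := by
          refine Finset.sum_le_sum fun u hu => ?_
          rw [Finset.mem_filter, Finset.mem_powerset] at hu
          have hA : 0 ≤ ∏ r ∈ u, Am (R r) r := Finset.prod_nonneg fun r hr => (hf r (hu.1 hr)).1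
          rw [Finset.prod_mul_distrib, ← prod_rpow]
          have h5 : ∏ r ∈ U \ u, Bm (R r) r ≤ ∏ r ∈ U \ u, |Bm (R r) r| := by
            rw [← Finset.abs_prod]; exact le_abs_self _
          have h6 : 0 ≤ ∏ r ∈ U \ u, |Bm (R r) r| := Finset.prod_nonneg fun r _ => abs_nonneg _
          have h7 : 1 ≤ (2 : ℝ) ^ ((1 - δ) * ((∑ r ∈ u, r.natDegree : ℕ) : ℝ)) * (2 : ℝ) ^ (-(1 - δ) * Q) := by
            rw [← Real.rpow_add two_pos]
            apply Real.one_le_rpow one_le_two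
            have : (Q : ℝ) ≤ ((∑ r ∈ u, r.natDegree : ℕ) : ℝ) := by exact_mod_cast not_lt.1 hu.2
            nlinarith
          calc _ ≤ (∏ r ∈ u, Am (R r) r) * ∏ r ∈ U \ u, |Bm (R r) r| := by gcongr
            _ ≤ ((∏ r ∈ u, Am (R r) r) * ∏ r ∈ U \ u, |Bm (R r) r|) *
              ((2 : ℝ) ^ ((1 - δ) * ((∑ r ∈ u, r.natDegree : ℕ) : ℝ)) * (2 : ℝ) ^ (-(1 - δ) * Q)) :=
                le_mul_of_one_le_right (by positivity) h7
            _ = _ := by ring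
      _ ≤ ∑ u ∈ U.powerset,
          ((∏ r ∈ u, Am (R r) r * (2 : ℝ) ^ ((1 - δ) * r.natDegree)) * ∏ r ∈ U \ u, |Bm (R r) r|) * (2 : ℝ) ^ (-(1 - δ) * Q) := by
          refine Finset.sum_le_sum_of_subset_of_nonneg (Finset.filter_subset _ _) fun u hu _ => ?_
          rw [Finset.mem_powerset] at hu
          have hA : 0 ≤ ∏ r ∈ u, Am (R r) r * (2 : ℝ) ^ ((1 - δ) * r.natDegree) :=
            Finset.prod_nonneg fun r hr => mul_nonneg (hf r (hu hr)).1 (by positivity)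
          have h6 : 0 ≤ ∏ r ∈ U \ u, |Bm (R r) r| := Finset.prod_nonneg fun r _ => abs_nonneg _
          positivity
      _ = (∏ r ∈ U, (Am (R r) r * (2 : ℝ) ^ ((1 - δ) * r.natDegree) + |Bm (R r) r|)) * (2 : ℝ) ^ (-(1 - δ) * Q) := by
          rw [← Finset.sum_mul, Finset.prod_add]
      _ ≤ _ := by
          gcongr
          refine le_trans (Finset.prod_le_prod (fun r hr => ?_) (fun r hr => (hf r hr).2.2)) (prod_Cd hδ D U hU)
          have := (hf r hr).1
          positivity
  linarith

def UU (N : ℕ) : Finset F2[X] := (GN N).filter (fun r => Irreducible r)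
def DD (N : ℕ) : Finset (Finset F2[X]) := (UU N).powerset.filter (fun u => ∑ r ∈ u, r.natDegree < N / 8)

lemma UU_irr (N : ℕ) : ∀ r ∈ UU N, Irreducible r := fun r h => (Finset.mem_filter.1 h).2

lemma mem_DD {N : ℕ} {u : Finset F2[X]} : u ∈ DD N ↔ u ⊆ UU N ∧ ∑ r ∈ u, r.natDegree < N / 8 := by
  rw [DD, Finset.mem_filter, Finset.mem_powerset]

lemma card_DD (N : ℕ) : ((DD N).card : ℝ) ≤ 2 ^ (N / 8) := by
  have : (DD N).card ≤ (GN (N / 8)).card := by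
    refine Finset.card_le_card_of_injOn (fun u => ∏ r ∈ u, r) ?_ ?_
    · intro u hu
      obtain ⟨h1, h2⟩ := mem_DD.1 hu
      have hi : ∀ r ∈ u, Irreducible r := fun r h => UU_irr N r (h1 h)
      show _ ∈ GN (N / 8)
      rw [mem_GN]
      refine lt_of_le_of_lt degree_le_natDegree ?_
      rw [prod_natDegree hi]
      exact_mod_cast h2
    · intro u hu v hv h
      exact prod_inj (fun r h => UU_irr N r ((mem_DD.1 hu).1 h)) (fun r h => UU_irr N r ((mem_DD.1 hv).1 h)) h
  rw [card_GN] at this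
  exact_mod_cast this

lemma E0_nonneg (N : ℕ) : 0 ≤ E0 N := by rw [E0]; positivity
lemma E0_le (N : ℕ) (δ : ℝ) (D : ℕ) : E0 N ≤ E1 N δ D := by
  rw [E1]; have : (0:ℝ) ≤ 8 ^ (2 ^ D) * (2 : ℝ) ^ ((3 / 4 + δ / 4) * N) := by positivity
  linarith

lemma one_mem_GN {N : ℕ} (hN : 1 ≤ N) : (1 : F2[X]) ∈ GN N := by
  rw [mem_GN, degree_one]; exact_mod_cast hN

lemma Su_congr {N : ℕ} (hN : 1 ≤ N) (u : Finset F2[X]) (l ρ : Lf) (h : ∀ f ∈ GN N, l f = ρ f) : Su N u l = Su N u ρ := by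
  rw [Su, Su]
  refine Finset.sum_congr rfl fun g hg => ?_
  rw [h _ (GN_sub hg (one_mem_GN hN))]

lemma main_approx (N : ℕ) (w : Finset F2[X]) (hw : w ⊆ UU N)
    (hd : ∀ u ∈ DD N, ∑ r ∈ u, r.natDegree + ∑ r ∈ w, r.natDegree ≤ N / 2) (ρ : Lf) (R : F2[X] → Lf)
    (hR1 : ∀ r g, R r (r * g) = 0) (hR2 : ∀ r, r ∉ w → R r = 0) (hR3 : ∀ f, ρ f = ∑ r ∈ w, R r f) :
    2 ^ N * (∑ u ∈ DD N, (∏ r ∈ u, Am (R r) r) * ∏ r ∈ UU N \ u, Bm (R r) r) - 2 ^ (N / 8) * E0 N ≤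
      ∑ u ∈ DD N, Su N u ρ := by
  have h1 : ∀ u ∈ DD N, 2 ^ N * ((∏ r ∈ u, Am (R r) r) * ∏ r ∈ UU N \ u, Bm (R r) r) - E0 N ≤ Su N u ρ := by
    intro u hu
    have := abs_le.1 (Su_main N (UU N) u w (UU_irr N) (mem_DD.1 hu).1 hw (hd u hu) ρ R hR1 hR2 hR3)
    linarith [this.1]
  have h2 := Finset.sum_le_sum h1
  rw [Finset.sum_sub_distrib, ← Finset.mul_sum, Finset.sum_const, nsmul_eq_mul] at h2
  have h3 : ((DD N).card : ℝ) * E0 N ≤ 2 ^ (N / 8) * E0 N :=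
    mul_le_mul_of_nonneg_right (card_DD N) (E0_nonneg N)
  linarith

lemma total_lower {δ : ℝ} (hδ : 0 < δ) (hδ1 : δ ≤ 1) {D : ℕ} (hD : 5 ≤ (2 : ℝ) ^ (δ * D)) {N : ℕ} (hN : 1 ≤ N) (l : Lf) :
    -(2 ^ N * (Cd δ D * (2 : ℝ) ^ (-(1 - δ) * (N / 8 : ℕ))) + 2 ^ (N / 8) * E1 N δ D) ≤ ∑ u ∈ DD N, Su N u l := by
  have hC : 0 ≤ 2 ^ N * (Cd δ D * (2 : ℝ) ^ (-(1 - δ) * (N / 8 : ℕ))) := by rw [Cd]; positivity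
  have hE0 := E0_le N δ D
  by_cases hcase : ∀ u ∈ DD N, |Su N u l| ≤ E1 N δ D
  · have h1 : ∀ u ∈ DD N, -E1 N δ D ≤ Su N u l := fun u hu => (abs_le.1 (hcase u hu)).1
    have h2 := Finset.sum_le_sum h1
    rw [Finset.sum_const, nsmul_eq_mul] at h2
    have h3 : ((DD N).card : ℝ) * E1 N δ D ≤ 2 ^ (N / 8) * E1 N δ D :=
      mul_le_mul_of_nonneg_right (card_DD N) (le_trans (E0_nonneg N) hE0)
    linarith
  · push Not at hcase
    obtain ⟨u0, hu0, hbig⟩ := hcase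
    obtain ⟨hu0U, hu0d⟩ := mem_DD.1 hu0
    have hk : ∃ k : Lf, (∀ g, k ((∏ r ∈ u0, r) * g) = 0) ∧ E1 N δ D < |Su N ∅ (l + k)| := by
      by_contra hcon
      push Not at hcon
      exact absurd (Su_bound N _ u0 (fun r h => UU_irr N r (hu0U h)) l hcon) (not_le.2 hbig)
    obtain ⟨k, hk0, hk1⟩ := hk
    rw [Su_empty] at hk1
    obtain ⟨P, hP, hPd, ρ', hρ1, hρ2⟩ := large_struct hδ hδ1 hD N (l + k) hk1
    have hPd' : 4 * (∑ r ∈ P, r.natDegree) < N := by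
      have : (4:ℝ) * ((∑ r ∈ P, r.natDegree : ℕ) : ℝ) < N := by linarith
      exact_mod_cast this
    set w := P ∪ u0 with hw
    have hPU : P ⊆ UU N := by
      intro r hr
      rw [UU, Finset.mem_filter, mem_GN]
      refine ⟨lt_of_le_of_lt degree_le_natDegree ?_, hP r hr⟩
      have := Finset.single_le_sum (f := fun r : F2[X] => r.natDegree) (fun _ _ => Nat.zero_le _) hr
      exact_mod_cast (show r.natDegree < N by omega)
    have hwU : w ⊆ UU N := Finset.union_subset hPU hu0U
    have hwi : ∀ r ∈ w, Irreducible r := fun r h => UU_irr N r (hwU h)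
    have hwd : ∑ r ∈ w, r.natDegree ≤ ∑ r ∈ P, r.natDegree + ∑ r ∈ u0, r.natDegree := by
      rw [← Finset.sum_union_inter]
      exact Nat.le_add_right _ _
    have hkill : ∀ g, (ρ' - k) ((∏ r ∈ w, r) * g) = 0 := by
      intro g
      obtain ⟨a, ha⟩ := Finset.prod_dvd_prod_of_subset P w (fun r => r) Finset.subset_union_left
      obtain ⟨b, hb⟩ := Finset.prod_dvd_prod_of_subset u0 w (fun r => r) Finset.subset_union_right
      rw [LinearMap.sub_apply]
      have h1 : ρ' ((∏ r ∈ w, r) * g) = 0 := by rw [ha, mul_assoc]; exact hρ2 _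
      have h2 : k ((∏ r ∈ w, r) * g) = 0 := by rw [hb, mul_assoc]; exact hk0 _
      rw [h1, h2, sub_zero]
    obtain ⟨R, hR1, hR2, hR3⟩ := decomp w hwi (ρ' - k) hkill
    have hlρ : ∀ f ∈ GN N, l f = (ρ' - k) f := by
      intro f hf
      have := hρ1 f hf
      rw [LinearMap.add_apply] at this
      rw [LinearMap.sub_apply, ← this]; ring
    have happ := main_approx N w hwU (by
      intro u hu
      have := (mem_DD.1 hu).2
      omega) (ρ' - k) R hR1 hR2 hR3
    have htail := tail_bound hδ hδ1 hD (N / 8) (UU N) (UU_irr N) R hR1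
    rw [← DD] at htail
    have e : ∑ u ∈ DD N, Su N u l = ∑ u ∈ DD N, Su N u (ρ' - k) :=
      Finset.sum_congr rfl fun u _ => Su_congr hN u _ _ hlρ
    rw [e]
    have h5 := mul_le_mul_of_nonneg_left htail (show (0:ℝ) ≤ 2 ^ N by positivity)
    have h6 : (2:ℝ) ^ (N / 8) * E0 N ≤ 2 ^ (N / 8) * E1 N δ D := by gcongr
    rw [mul_neg] at h5
    linarith

lemma total_zero {N : ℕ} (hN : 8 ≤ N) : (2:ℝ) ^ N - 2 ^ (N / 8) * E0 N ≤ ∑ u ∈ DD N, Su N u 0 := by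
  have happ := main_approx N ∅ (Finset.empty_subset _) (by
      intro u hu
      have := (mem_DD.1 hu).2
      simp only [Finset.sum_empty]
      omega) 0 (fun _ => 0) (fun _ _ => rfl) (fun _ _ => rfl) (fun f => by simp)
  have hnn : ∀ u ∈ DD N, 0 ≤ (∏ r ∈ u, Am 0 r) * ∏ r ∈ UU N \ u, Bm 0 r := by
    intro u hu
    refine mul_nonneg (Finset.prod_nonneg fun r hr => ?_) (Finset.prod_nonneg fun r hr => ?_)
    · have hi := UU_irr N r ((mem_DD.1 hu).1 hr)
      rw [Am_eq hi, Bm_zero hi]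
      have : (0:ℝ) ≤ 1 / phi r := by positivity
      nlinarith
    · rw [Bm_zero (UU_irr N r (Finset.mem_sdiff.1 hr).1)]; norm_num
  have hemp : (∅ : Finset F2[X]) ∈ DD N := by
    rw [mem_DD]; refine ⟨Finset.empty_subset _, ?_⟩
    simp only [Finset.sum_empty]; omega
  have h1 := Finset.single_le_sum hnn hemp
  have h2 : (∏ r ∈ (∅ : Finset F2[X]), Am 0 r) * ∏ r ∈ UU N \ ∅, Bm 0 r = 1 := by
    rw [Finset.prod_empty, one_mul]
    exact Finset.prod_eq_one fun r hr => Bm_zero (UU_irr N r (Finset.mem_sdiff.1 hr).1)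
  rw [h2] at h1
  have h5 := mul_le_mul_of_nonneg_left h1 (show (0:ℝ) ≤ 2 ^ N by positivity)
  linarith

lemma asym {δ : ℝ} (hδ : 0 < δ) (hδ1 : δ ≤ 1) (D : ℕ) : ∃ N₀ : ℕ, 16 ≤ N₀ ∧ ∀ N : ℕ, N₀ ≤ N →
    2 ^ N * (Cd δ D * (2 : ℝ) ^ (-(1 - δ) * (N / 8 : ℕ))) + 2 ^ (N / 8) * E1 N δ D ≤ (2 : ℝ) ^ ((7 / 8 + δ) * N) := by
  set r : ℝ := (2 : ℝ) ^ (3 / 4 * δ) with hr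
  have hr1 : 1 < r := Real.one_lt_rpow one_lt_two (by positivity)
  have hC : 0 ≤ Cd δ D := by rw [Cd]; positivity
  set K : ℝ := 8 ^ (2 ^ D) with hK
  have hK0 : 0 < K := by positivity
  set A : ℝ := 2 * Cd δ D + K + 32 with hA
  have hA0 : 0 < A := by positivity
  have ho := isLittleO_pow_const_const_pow_of_one_lt (R := ℝ) 2 hr1
  have hev := ho.bound (show (0:ℝ) < 1 / A by positivity)
  obtain ⟨N1, hN1⟩ := Filter.eventually_atTop.1 hev
  refine ⟨max N1 16, le_max_right _ _, fun N hN => ?_⟩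
  have h16 : 16 ≤ N := le_trans (le_max_right _ _) hN
  have h := hN1 N (le_trans (le_max_left _ _) hN)
  rw [Real.norm_of_nonneg (by positivity), Real.norm_of_nonneg (by positivity)] at h
  have h1 : A * (N : ℝ) ^ 2 ≤ r ^ N := by
    calc A * (N : ℝ) ^ 2 ≤ A * (1 / A * r ^ N) := by gcongr
      _ = r ^ N := by field_simp
  have hNr : (16 : ℝ) ≤ N := by exact_mod_cast h16
  have hq1 : ((N / 8 : ℕ) : ℝ) ≤ N / 8 := by exact_mod_cast Nat.cast_div_le (m := N) (n := 8) (α := ℝ)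
  have hq2 : (N : ℝ) / 8 - 1 ≤ ((N / 8 : ℕ) : ℝ) := by
    have : N ≤ 8 * (N / 8) + 8 := by omega
    have : (N : ℝ) ≤ 8 * ((N / 8 : ℕ) : ℝ) + 8 := by exact_mod_cast this
    linarith
  set X : ℝ := (2 : ℝ) ^ ((7 / 8 + δ / 4) * N) with hX
  have hX0 : 0 < X := by positivity
  have t1 : (2:ℝ) ^ N * (Cd δ D * (2 : ℝ) ^ (-(1 - δ) * (N / 8 : ℕ))) ≤ 2 * Cd δ D * X := by
    have : (2:ℝ) ^ N * (2 : ℝ) ^ (-(1 - δ) * (N / 8 : ℕ)) ≤ 2 * X := by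
      have e : (2:ℝ) * X = (2:ℝ) ^ (1 + (7 / 8 + δ / 4) * N) := by
        rw [hX, Real.rpow_add two_pos, Real.rpow_one]
      rw [e, ← Real.rpow_natCast, ← Real.rpow_add two_pos]
      apply Real.rpow_le_rpow_of_exponent_le one_le_two
      nlinarith
    calc _ = Cd δ D * ((2:ℝ) ^ N * (2 : ℝ) ^ (-(1 - δ) * (N / 8 : ℕ))) := by ring
      _ ≤ Cd δ D * (2 * X) := by gcongr
      _ = _ := by ring
  have hQ : (2:ℝ) ^ (N / 8) ≤ (2:ℝ) ^ ((1 / 8 : ℝ) * N) := by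
    rw [← Real.rpow_natCast]
    apply Real.rpow_le_rpow_of_exponent_le one_le_two
    linarith
  have t2 : (2:ℝ) ^ (N / 8) * E0 N ≤ 32 * N ^ 2 * X := by
    rw [E0]
    calc _ ≤ (2:ℝ) ^ ((1 / 8 : ℝ) * N) * (8 * (N + 1) ^ 2 * (2 : ℝ) ^ ((3 / 4 : ℝ) * N)) := by gcongr
      _ = 8 * (N + 1) ^ 2 * (2 : ℝ) ^ ((7 / 8 : ℝ) * N) := by
        have : (2 : ℝ) ^ ((7 / 8 : ℝ) * N) = (2:ℝ) ^ ((1 / 8 : ℝ) * N) * (2 : ℝ) ^ ((3 / 4 : ℝ) * N) := by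
          rw [← Real.rpow_add two_pos]; congr 1; ring
        rw [this]; ring
      _ ≤ 32 * N ^ 2 * X := by
        have : (8 : ℝ) * (N + 1) ^ 2 ≤ 32 * N ^ 2 := by nlinarith
        have h2 : (2 : ℝ) ^ ((7 / 8 : ℝ) * N) ≤ X := by
          apply Real.rpow_le_rpow_of_exponent_le one_le_two
          nlinarith
        gcongr
  have t3 : (2:ℝ) ^ (N / 8) * (K * (2 : ℝ) ^ ((3 / 4 + δ / 4) * N)) ≤ K * X := by
    calc _ ≤ (2:ℝ) ^ ((1 / 8 : ℝ) * N) * (K * (2 : ℝ) ^ ((3 / 4 + δ / 4) * N)) := by gcongr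
      _ = K * X := by
        have : X = (2:ℝ) ^ ((1 / 8 : ℝ) * N) * (2 : ℝ) ^ ((3 / 4 + δ / 4) * N) := by
          rw [← Real.rpow_add two_pos, hX]; congr 1; ring
        rw [this]; ring
  have hN2 : (1:ℝ) ≤ (N:ℝ) ^ 2 := by nlinarith
  have e : (2 : ℝ) ^ ((7 / 8 + δ) * N) = r ^ N * X := by
    rw [hr, ← Real.rpow_natCast ((2 : ℝ) ^ (3 / 4 * δ)), ← Real.rpow_mul two_pos.le, hX, ← Real.rpow_add two_pos]
    congr 1; ring
  rw [e, E1, mul_add]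
  calc _ ≤ 2 * Cd δ D * X + (32 * N ^ 2 * X + K * X) := by linarith
    _ = (2 * Cd δ D + K + 32 * N ^ 2) * X := by ring
    _ ≤ (A * N ^ 2) * X := by
      gcongr
      rw [hA]; nlinarith
    _ ≤ r ^ N * X := by gcongr

def thL (θ : Kinf) : Lf := Polynomial.lsum (fun i => (LinearMap.id : F2 →ₗ[F2] F2).smulRight (θ.coeff (1 + (i : ℤ))))

lemma thL_eq (θ : Kinf) (f : F2[X]) : (polyToK f * θ).coeff 1 = thL θ f := by
  rw [polyToK, Finset.sum_mul, HahnSeries.coeff_sum, thL, Polynomial.lsum_apply, Polynomial.sum]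
  refine Finset.sum_congr rfl fun i _ => ?_
  rw [HahnSeries.coeff_single_mul]
  simp

lemma eKr_eq (θ : Kinf) (f : F2[X]) : eKr (polyToK f * θ) = sg (thL θ f) := by
  rw [eKr, thL_eq, sg]

def PsiN (N : ℕ) (f : F2[X]) : ℝ := if f ∈ GN N then lam (f + 1) * ∑ u ∈ DD N, ∏ r ∈ u, hh r f else 0

lemma PsiN_supp {N : ℕ} (hN : 1 ≤ N) (f : F2[X]) (h : ¬ ∃ r : F2[X], Irreducible r ∧ r ∈ GN N ∧ f = r - 1) : PsiN N f = 0 := by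
  rw [PsiN]
  split_ifs with hf
  · have : ¬ Irreducible (f + 1) := fun hi => h ⟨f + 1, hi, GN_add hf (one_mem_GN hN), by ring⟩
    rw [lam, if_neg this, zero_mul]
  · rfl

lemma PsiN_sum {N : ℕ} (hN : 1 ≤ N) (l : Lf) : ∑ f ∈ GN N, PsiN N f * sg (l f) = ∑ u ∈ DD N, Su N u l := by
  simp only [Su]
  rw [Finset.sum_comm]
  symm
  refine Finset.sum_bij (fun g _ => g - 1) (fun g hg => GN_sub hg (one_mem_GN hN)) (fun a _ b _ h => sub_left_inj.1 h)
    (fun b hb => ⟨b + 1, GN_add hb (one_mem_GN hN), by ring⟩) (fun g hg => ?_)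
  rw [PsiN, if_pos (GN_sub hg (one_mem_GN hN)), sub_add_cancel, Finset.mul_sum, Finset.sum_mul]
  exact Finset.sum_congr rfl fun u _ => by ring

theorem final : ∀ ε : ℝ, 0 < ε → ∃ c : ℝ, 0 < c ∧ ∃ N₀ : ℕ, ∀ N : ℕ, N₀ ≤ N →
      ∃ Ψ : F2[X] → ℝ,
        (∀ f : F2[X], (¬ ∃ r : F2[X], Irreducible r ∧ r ∈ GN N ∧ f = r - 1) → Ψ f = 0) ∧
        (∀ θ : Kinf, InT θ →
          -((2 : ℝ) ^ ((N : ℝ) - (1 / 8 - ε) * (N : ℝ))) ≤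
            ∑ f ∈ GN N, Ψ f * eKr (polyToK f * θ)) ∧
        (c * 2 ^ N ≤ ∑ f ∈ GN N, Ψ f) := by
  intro ε hε
  set δ : ℝ := min ε (1 / 16) with hδd
  have hδ : 0 < δ := lt_min hε (by norm_num)
  have hδε : δ ≤ ε := min_le_left _ _
  have hδ16 : δ ≤ 1 / 16 := min_le_right _ _
  have hδ1 : δ ≤ 1 := by linarith
  obtain ⟨D, hD'⟩ := exists_nat_ge (3 / δ)
  have hD : 5 ≤ (2 : ℝ) ^ (δ * D) := by
    have : 3 ≤ δ * D := by rw [div_le_iff₀ hδ] at hD'; linarith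
    calc (5:ℝ) ≤ (2:ℝ) ^ (3:ℝ) := by norm_num
      _ ≤ _ := Real.rpow_le_rpow_of_exponent_le one_le_two this
  obtain ⟨N₀, h16, hN₀⟩ := asym hδ hδ1 D
  refine ⟨1 / 2, by norm_num, N₀, fun N hN => ⟨PsiN N, PsiN_supp (by omega), fun θ _ => ?_, ?_⟩⟩
  · simp only [eKr_eq]
    rw [PsiN_sum (by omega)]
    refine le_trans ?_ (total_lower hδ hδ1 hD (by omega) (thL θ))
    refine neg_le_neg (le_trans (hN₀ N hN) ?_)
    apply Real.rpow_le_rpow_of_exponent_le one_le_two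
    have : (0:ℝ) ≤ N := by positivity
    nlinarith
  · have h0 := PsiN_sum (N := N) (by omega) 0
    simp only [LinearMap.zero_apply, sg_zero, mul_one] at h0
    rw [h0]
    refine le_trans ?_ (total_zero (by omega))
    have h1 := hN₀ N hN
    have hC : 0 ≤ 2 ^ N * (Cd δ D * (2 : ℝ) ^ (-(1 - δ) * (N / 8 : ℕ))) := by rw [Cd]; positivity
    have h6 : (2:ℝ) ^ (N / 8) * E0 N ≤ 2 ^ (N / 8) * E1 N δ D := by
      have := E0_le N δ D
      gcongr
    have hNr : (16 : ℝ) ≤ N := by exact_mod_cast le_trans h16 hN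
    have h7 : (2 : ℝ) ^ ((7 / 8 + δ) * N) ≤ 1 / 2 * 2 ^ N := by
      have e : (1 / 2 : ℝ) * 2 ^ N = (2:ℝ) ^ ((N : ℝ) - 1) := by
        rw [Real.rpow_sub two_pos, Real.rpow_natCast, Real.rpow_one]; ring
      rw [e]
      apply Real.rpow_le_rpow_of_exponent_le one_le_two
      nlinarith
    linarith

end VDC

/-- For every `ε > 0` and all sufficiently large `N` there is `Ψ : F₂[x] → ℝ` with:
(1) `Ψ(f) = 0` unless `f = r − 1` for some prime `r ∈ G_N`;
(2) `Σ_{f ∈ G_N} Ψ(f) e(fθ) ≥ −2^{N−K}` for all `θ ∈ T`, where `K = (1/8 − ε)N`;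
(3) `Σ_{f ∈ G_N} Ψ(f) ≫ 2^N`. -/
theorem statement_1 :
    ∀ ε : ℝ, 0 < ε → ∃ c : ℝ, 0 < c ∧ ∃ N₀ : ℕ, ∀ N : ℕ, N₀ ≤ N →
      ∃ Ψ : F2[X] → ℝ,
        (∀ f : F2[X], (¬ ∃ r : F2[X], Irreducible r ∧ r ∈ GN N ∧ f = r - 1) → Ψ f = 0) ∧
        (∀ θ : Kinf, InT θ →
          -((2 : ℝ) ^ ((N : ℝ) - (1 / 8 - ε) * (N : ℝ))) ≤
            ∑ f ∈ GN N, Ψ f * eKr (polyToK f * θ)) ∧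
        (c * 2 ^ N ≤ ∑ f ∈ GN N, Ψ f) := by
  exact VDC.final
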